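/- Let R be a commutative Noetherian ring admitting a dualizing complex and M a nonzero finitely generated R-module. Then M is G–Gorenstein if and only if M_p is a G–Gorenstein R_p-module for all p ∈ Supp M, if and only if M_m is a G–Gorenstein R_m-module for all maximal ideals m ∈ Supp M. -/

import Mathlib

universe u

namespace GG

open RingTheory.Sequence

variable (R : Type u) [CommRing R]

/-- A module `N` is Gorenstein injective if it is a kernel in a `Hom(Inj,−)`-exact exact
doubly infinite complex of injective modules. -/
def IsGorensteinInjective (N : Type u) [AddCommGroup N] [Module R N] : Prop :=
  ∃ (X : ℤ → ModuleCat.{u} R) (d : ∀ n : ℤ, X n →ₗ[R] X (n + 1)),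
    (∀ n, Module.Injective R (X n)) ∧
    (∀ n, LinearMap.range (d n) = LinearMap.ker (d (n + 1))) ∧
    (∀ (I : ModuleCat.{u} R), Module.Injective R I →
      ∀ (n : ℤ) (φ : I →ₗ[R] X (n + 1)), (d (n + 1)).comp φ = 0 →
        ∃ ψ : I →ₗ[R] X n, (d n).comp ψ = φ) ∧
    Nonempty (N ≃ₗ[R] LinearMap.ker (d 0))

/-- A module `N` is Gorenstein projective if it is a kernel in a `Hom(−,Proj)`-exact exact
doubly infinite complex of projective modules. -/
def IsGorensteinProjective (N : Type u) [AddCommGroup N] [Module R N] : Prop :=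
  ∃ (X : ℤ → ModuleCat.{u} R) (d : ∀ n : ℤ, X n →ₗ[R] X (n + 1)),
    (∀ n, Module.Projective R (X n)) ∧
    (∀ n, LinearMap.range (d n) = LinearMap.ker (d (n + 1))) ∧
    (∀ (P : ModuleCat.{u} R), Module.Projective R P →
      ∀ (n : ℤ) (φ : X (n + 1) →ₗ[R] P), φ.comp (d n) = 0 →
        ∃ ψ : X (n + 1 + 1) →ₗ[R] P, ψ.comp (d (n + 1)) = φ) ∧
    Nonempty (N ≃ₗ[R] LinearMap.ker (d 0))

/-- A module `N` is Gorenstein flat if it is a kernel in an `(Inj ⊗ −)`-exact exact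
doubly infinite complex of flat modules. -/
def IsGorensteinFlat (N : Type u) [AddCommGroup N] [Module R N] : Prop :=
  ∃ (X : ℤ → ModuleCat.{u} R) (d : ∀ n : ℤ, X n →ₗ[R] X (n + 1)),
    (∀ n, Module.Flat R (X n)) ∧
    (∀ n, LinearMap.range (d n) = LinearMap.ker (d (n + 1))) ∧
    (∀ (I : ModuleCat.{u} R), Module.Injective R I →
      ∀ n : ℤ, LinearMap.range (LinearMap.lTensor (R := R) I (d n)) =
        LinearMap.ker (LinearMap.lTensor (R := R) I (d (n + 1)))) ∧
    Nonempty (N ≃ₗ[R] LinearMap.ker (d 0))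

/-- Existence of a right resolution of length `≤ n` by modules satisfying `P`. -/
def CoresolutionLE (P : ModuleCat.{u} R → Prop) (M : Type u) [AddCommGroup M] [Module R M]
    (n : ℕ) : Prop :=
  ∃ (G : ℕ → ModuleCat.{u} R) (d : ∀ i : ℕ, G i →ₗ[R] G (i + 1)) (ε : M →ₗ[R] G 0),
    (∀ i, P (G i)) ∧ Function.Injective ε ∧
    LinearMap.range ε = LinearMap.ker (d 0) ∧
    (∀ i, LinearMap.range (d i) = LinearMap.ker (d (i + 1))) ∧
    (∀ i, n < i → ∀ x : G i, x = 0)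

/-- Existence of a left resolution of length `≤ n` by modules satisfying `P`. -/
def ResolutionLE (P : ModuleCat.{u} R → Prop) (M : Type u) [AddCommGroup M] [Module R M]
    (n : ℕ) : Prop :=
  ∃ (G : ℕ → ModuleCat.{u} R) (d : ∀ i : ℕ, G (i + 1) →ₗ[R] G i) (ε : G 0 →ₗ[R] M),
    (∀ i, P (G i)) ∧ Function.Surjective ε ∧
    LinearMap.ker ε = LinearMap.range (d 0) ∧
    (∀ i, LinearMap.ker (d i) = LinearMap.range (d (i + 1))) ∧
    (∀ i, n < i → ∀ x : G i, x = 0)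

/-- `Gid_R M ≤ n`. -/
def gidLE (M : Type u) [AddCommGroup M] [Module R M] (n : ℕ) : Prop :=
  CoresolutionLE R (fun N => IsGorensteinInjective R N) M n

/-- `id_R M ≤ n`. -/
def idLE (M : Type u) [AddCommGroup M] [Module R M] (n : ℕ) : Prop :=
  CoresolutionLE R (fun N => Module.Injective R N) M n

/-- `pd_R M ≤ n`. -/
def pdLE (M : Type u) [AddCommGroup M] [Module R M] (n : ℕ) : Prop :=
  ResolutionLE R (fun N => Module.Projective R N) M n

/-- `fd_R M ≤ n`. -/
def fdLE (M : Type u) [AddCommGroup M] [Module R M] (n : ℕ) : Prop :=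
  ResolutionLE R (fun N => Module.Flat R N) M n

/-- `Gfd_R M ≤ n`. -/
def gfdLE (M : Type u) [AddCommGroup M] [Module R M] (n : ℕ) : Prop :=
  ResolutionLE R (fun N => IsGorensteinFlat R N) M n

/-- Gorenstein injective dimension, as an extended natural number. -/
noncomputable def gid (M : Type u) [AddCommGroup M] [Module R M] : ℕ∞ :=
  sInf {c : ℕ∞ | ∃ n : ℕ, c = n ∧ gidLE R M n}

/-- The depth of a module over a local ring: the supremum of the lengths of regular
sequences contained in the maximal ideal. -/
noncomputable def mdepth [IsLocalRing R] (M : Type u) [AddCommGroup M] [Module R M] : ℕ∞ :=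
  sSup {c : ℕ∞ | ∃ rs : List R, c = rs.length ∧
    (∀ r ∈ rs, r ∈ IsLocalRing.maximalIdeal R) ∧ RingTheory.Sequence.IsRegular M rs}

/-- The Krull dimension of a module: the Krull dimension of its support. -/
noncomputable def mdim (M : Type u) [AddCommGroup M] [Module R M] : WithBot ℕ∞ :=
  Order.krullDim ↥(Module.support R M)

/-- The height of a prime in the support of `M`. -/
noncomputable def htM (M : Type u) [AddCommGroup M] [Module R M] (p : PrimeSpectrum R) : ℕ∞ :=
  ⨆ h : p ∈ Module.support R M, Order.height (⟨p, h⟩ : ↥(Module.support R M))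

/-- A Cohen–Macaulay module over a local ring: depth equals Krull dimension. -/
def IsCMModule [IsLocalRing R] (M : Type u) [AddCommGroup M] [Module R M] : Prop :=
  (mdepth R M : WithBot ℕ∞) = mdim R M

/-- A maximal Cohen–Macaulay module over a local ring. -/
def IsMaximalCM [IsLocalRing R] (M : Type u) [AddCommGroup M] [Module R M] : Prop :=
  IsCMModule R M ∧ mdim R M = ringKrullDim R

/-- A Cohen–Macaulay local ring. -/
def IsCMLocalRing [IsLocalRing R] : Prop :=
  (mdepth R R : WithBot ℕ∞) = ringKrullDim R

/-- A Gorenstein local ring: a Noetherian local ring of finite self-injective dimension. -/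
def IsGorensteinLocalRing [IsLocalRing R] : Prop :=
  IsNoetherianRing R ∧ ∃ n : ℕ, idLE R R n

/-- A regular local ring: Noetherian, and the maximal ideal is generated by `dim R` elements. -/
def IsRegularLocal [IsLocalRing R] : Prop :=
  IsNoetherianRing R ∧ ∃ s : Finset R, Ideal.span (s : Set R) = IsLocalRing.maximalIdeal R ∧
    (s.card : WithBot ℕ∞) = ringKrullDim R

/-- A (not necessarily local) Gorenstein ring: all localizations at primes are Gorenstein. -/
def IsGorensteinRing : Prop :=
  ∀ p : PrimeSpectrum R, ∃ n : ℕ,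
    idLE (Localization.AtPrime p.asIdeal) (Localization.AtPrime p.asIdeal) n

/-- `R` admits a dualizing complex; by Kawasaki's theorem this is equivalent to being a
homomorphic image of a finite-dimensional Gorenstein ring. -/
def HasDualizingComplex : Prop :=
  ∃ Q : CommRingCat.{u}, IsNoetherianRing Q ∧ ringKrullDim Q < ⊤ ∧ IsGorensteinRing Q ∧
    ∃ f : Q →+* R, Function.Surjective f

section Cousin

/-- The product of the localizations of `N` at the primes in `S`. -/
noncomputable abbrev locProd (S : Set (PrimeSpectrum R)) (N : Type u) [AddCommGroup N]
    [Module R N] : Type u :=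
  Π p : S, LocalizedModule p.1.asIdeal.primeCompl N

/-- The submodule of the product of localizations consisting of finitely supported families;
this is the direct sum `⊕_{p ∈ S} N_p`. -/
noncomputable def finSupp (S : Set (PrimeSpectrum R)) (N : Type u) [AddCommGroup N]
    [Module R N] : Submodule R (locProd R S N) where
  carrier := {f | {p : S | f p ≠ 0}.Finite}
  add_mem' := by
    intro f g hf hg
    refine (hf.union hg).subset ?_
    intro p hp
    by_contra h
    simp only [Set.mem_union, Set.mem_setOf_eq, not_or, not_not] at h
    exact hp (by simp [Pi.add_apply, h.1, h.2])
  zero_mem' := by simp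
  smul_mem' := by
    intro c f hf
    refine hf.subset ?_
    intro p hp
    by_contra h
    simp only [Set.mem_setOf_eq, not_not] at h
    exact hp (by simp [Pi.smul_apply, h])

/-- The canonical map `N → ∏_{p ∈ S} N_p`. -/
noncomputable def thetaFull (S : Set (PrimeSpectrum R)) (N : Type u) [AddCommGroup N]
    [Module R N] : N →ₗ[R] locProd R S N :=
  LinearMap.pi fun p => LocalizedModule.mkLinearMap p.1.asIdeal.primeCompl N

/-- The cokernel of `N → ⊕_{p ∈ S} N_p` (computed inside the direct sum). -/
noncomputable abbrev nextKType (S : Set (PrimeSpectrum R)) (N : Type u) [AddCommGroup N]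
    [Module R N] : Type u :=
  ↥(finSupp R S N) ⧸
    (Submodule.comap (finSupp R S N).subtype (LinearMap.range (thetaFull R S N)))

/-- The sequence of "kernel/cokernel" modules in the inductive construction
of the Cousin complex of `M` with respect to the filtration `F`. -/
noncomputable def cousinK (F : ℕ → Set (PrimeSpectrum R)) (M : ModuleCat.{u} R) :
    ℕ → ModuleCat.{u} R
  | 0 => M
  | n + 1 => ModuleCat.of R (nextKType R (F n \ F (n + 1)) (cousinK F M n))

/-- The `n`-th term `M^n = ⊕_{p ∈ ∂F_n} (coker d^{n-2})_p` of the Cousin complex. -/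
noncomputable abbrev cousinC (F : ℕ → Set (PrimeSpectrum R)) (M : ModuleCat.{u} R) (n : ℕ) :
    Type u :=
  ↥(finSupp R (F n \ F (n + 1)) (cousinK R F M n))

/-- The canonical map from the `n`-th cokernel into the product of its localizations. -/
noncomputable def cousinTheta (F : ℕ → Set (PrimeSpectrum R)) (M : ModuleCat.{u} R) (n : ℕ) :
    (cousinK R F M n) →ₗ[R] locProd R (F n \ F (n + 1)) (cousinK R F M n) :=
  thetaFull R _ _

/-- The (full) `n`-th differential of the Cousin complex, from `M^n` to the product at
level `n+1` (it lands inside the direct sum `M^{n+1}`). -/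
noncomputable def cousinD (F : ℕ → Set (PrimeSpectrum R)) (M : ModuleCat.{u} R) (n : ℕ) :
    (cousinC R F M n) →ₗ[R] locProd R (F (n + 1) \ F (n + 2)) (cousinK R F M (n + 1)) :=
  (cousinTheta R F M (n + 1)).comp
    (Submodule.mkQ (Submodule.comap (finSupp R (F n \ F (n + 1)) (cousinK R F M n)).subtype
      (LinearMap.range (thetaFull R (F n \ F (n + 1)) (cousinK R F M n)))))

/-- `F` is a filtration of `Spec R`: descending, and every element of `∂F_n = F_n \ F_{n+1}`
is a minimal member of `F_n`. -/
def IsFiltration (F : ℕ → Set (PrimeSpectrum R)) : Prop :=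
  (∀ n, F (n + 1) ⊆ F n) ∧
    ∀ n, ∀ p ∈ F n \ F (n + 1), ∀ q ∈ F n, q ≤ p → q = p

/-- The filtration `F` admits `M`. -/
def Admits (F : ℕ → Set (PrimeSpectrum R)) (M : Type u) [AddCommGroup M] [Module R M] : Prop :=
  Module.support R M ⊆ F 0

/-- The `M`-height filtration `K_i = {p ∈ Supp M | ht_M p ≥ i}`. -/
noncomputable def heightFiltration (M : Type u) [AddCommGroup M] [Module R M] :
    ℕ → Set (PrimeSpectrum R) :=
  fun i => {p | p ∈ Module.support R M ∧ (i : ℕ∞) ≤ htM R M p}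

/-- The Cousin complex `C(F, M)` is exact at `M, M⁰, …, M^t`
(together with the well-definedness of the differentials into the direct sums). -/
def CousinPartiallyExact (F : ℕ → Set (PrimeSpectrum R)) (M : ModuleCat.{u} R) (t : ℕ) : Prop :=
  (∀ n, LinearMap.range (cousinTheta R F M n) ≤ finSupp R (F n \ F (n + 1)) (cousinK R F M n)) ∧
  Function.Injective (cousinTheta R F M 0) ∧
  (∀ n ≤ t, LinearMap.ker (cousinD R F M n) =
    Submodule.comap (finSupp R (F n \ F (n + 1)) (cousinK R F M n)).subtype
      (LinearMap.range (cousinTheta R F M n)))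

/-- The Cousin complex `C(F, M)` is exact and all of its terms satisfy `P`, i.e. it provides
a `P`-resolution of `M`. -/
def CousinResolves (F : ℕ → Set (PrimeSpectrum R)) (M : ModuleCat.{u} R)
    (P : ModuleCat.{u} R → Prop) : Prop :=
  (∀ n, LinearMap.range (cousinTheta R F M n) ≤ finSupp R (F n \ F (n + 1)) (cousinK R F M n)) ∧
  Function.Injective (cousinTheta R F M 0) ∧
  (∀ n, LinearMap.ker (cousinD R F M n) =
    Submodule.comap (finSupp R (F n \ F (n + 1)) (cousinK R F M n)).subtype
      (LinearMap.range (cousinTheta R F M n))) ∧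
  (∀ n, P (ModuleCat.of R (cousinC R F M n)))

/-- A G–Gorenstein module: a nonzero finitely generated module whose Cousin complex with
respect to the `M`-height filtration is a Gorenstein injective resolution. -/
def IsGGorenstein (M : ModuleCat.{u} R) : Prop :=
  (∃ x : M, x ≠ 0) ∧ Module.Finite R M ∧
    CousinResolves R (heightFiltration R M) M (fun N => IsGorensteinInjective R N)

/-- A Gorenstein module: a nonzero finitely generated module whose Cousin complex with
respect to the `M`-height filtration is an injective resolution. -/
def IsGorensteinModule (M : ModuleCat.{u} R) : Prop :=
  (∃ x : M, x ≠ 0) ∧ Module.Finite R M ∧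
    CousinResolves R (heightFiltration R M) M (fun N => Module.Injective R N)

end Cousin

/-- A system of parameters of a local ring. -/
def IsSOP [IsLocalRing R] (rs : List R) : Prop :=
  (rs.length : WithBot ℕ∞) = ringKrullDim R ∧
    (∀ r ∈ rs, r ∈ IsLocalRing.maximalIdeal R) ∧
    IsLocalRing.maximalIdeal R ≤ (Ideal.span {r | r ∈ rs}).radical

/-- A balanced big Cohen–Macaulay module: every system of parameters of `R` is a regular
sequence on `M`. -/
def IsBalancedBigCM [IsLocalRing R] (M : Type u) [AddCommGroup M] [Module R M] : Prop :=
  ∀ rs : List R, IsSOP R rs → RingTheory.Sequence.IsRegular M rs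

end GG

namespace GGP
section P1
variable {R : Type u} [CommRing R]

/-- extension along an arbitrary map whose kernel is contained in the kernel -/
lemma ext_of_ker_le {A B I : Type u} [AddCommGroup A] [Module R A] [AddCommGroup B] [Module R B]
    [AddCommGroup I] [Module R I] (hI : Module.Injective R I) (v : A →ₗ[R] B) (g : A →ₗ[R] I)
    (h : LinearMap.ker v ≤ LinearMap.ker g) : ∃ g' : B →ₗ[R] I, g' ∘ₗ v = g := by
  have hinj : Function.Injective ((LinearMap.ker v).liftQ v le_rfl) := by
    rw [← LinearMap.ker_eq_bot]; exact Submodule.ker_liftQ_eq_bot _ _ _ le_rfl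
  obtain ⟨g', hg'⟩ := hI.out _ hinj ((LinearMap.ker v).liftQ g h)
  refine ⟨g', LinearMap.ext fun a => ?_⟩
  have := hg' ((LinearMap.ker v).mkQ a)
  simpa using this

lemma ext_of_inj {A B I : Type u} [AddCommGroup A] [Module R A] [AddCommGroup B] [Module R B]
    [AddCommGroup I] [Module R I] (hI : Module.Injective R I) (v : A →ₗ[R] B) 
    (hv : Function.Injective v) (g : A →ₗ[R] I) : ∃ g' : B →ₗ[R] I, g' ∘ₗ v = g := 
  ext_of_ker_le hI v g (by rw [LinearMap.ker_eq_bot.mpr hv]; exact bot_le)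

lemma inj_of_retract {I H : Type u} [AddCommGroup H] [Module R H]
    [AddCommGroup I] [Module R I] (hI : Module.Injective R I) (i : H →ₗ[R] I) (r : I →ₗ[R] H)
    (hri : r ∘ₗ i = LinearMap.id) : Module.Injective R H := by
  refine ⟨fun X Y _ _ _ _ f hf g => ?_⟩
  obtain ⟨g', hg'⟩ := hI.out f hf (i ∘ₗ g)
  refine ⟨r ∘ₗ g', fun x => ?_⟩
  have := congrArg r (hg' x)
  have h2 := LinearMap.congr_fun hri (g x)
  simp at this h2 ⊢
  rw [this, h2]

lemma inj_of_equiv {I H : Type u} [AddCommGroup H] [Module R H]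
    [AddCommGroup I] [Module R I] (hI : Module.Injective R I) (e : H ≃ₗ[R] I) :
    Module.Injective R H := 
  inj_of_retract hI e.toLinearMap e.symm.toLinearMap (by ext; simp)

lemma retract_of_inj {H B : Type u} [AddCommGroup H] [Module R H] [AddCommGroup B] [Module R B]
    (hH : Module.Injective R H) (v : H →ₗ[R] B) (hv : Function.Injective v) :
    ∃ r : B →ₗ[R] H, r ∘ₗ v = LinearMap.id := ext_of_inj hH v hv LinearMap.id

lemma inj_dfinsupp [IsNoetherianRing R] {ι : Type u} (I : ι → Type u)
    [∀ i, AddCommGroup (I i)] [∀ i, Module R (I i)] (hI : ∀ i, Module.Injective R (I i)) :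
    Module.Injective R (Π₀ i, I i) := by
  classical
  rw [← Module.Baer.iff_injective]
  intro J g
  have hfg : (LinearMap.range g).FG := by
    have : Module.Finite R J := Module.IsNoetherian.finite R J
    exact Module.Finite.iff_fg.mp inferInstance
  obtain ⟨s, hs⟩ := hfg
  let t : Finset ι := s.biUnion (fun x => x.support)
  have ht : ∀ j : J, ∀ i ∉ t, g j i = 0 := by
    intro j i hi
    have hmem : g j ∈ Submodule.span R (s : Set (Π₀ i, I i)) := by rw [hs]; exact ⟨j, rfl⟩
    have : Submodule.span R (s : Set (Π₀ i, I i)) ≤ LinearMap.ker (DFinsupp.lapply (R := R) i) := by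
      rw [Submodule.span_le]
      intro x hx
      simp only [SetLike.mem_coe, LinearMap.mem_ker, DFinsupp.lapply_apply]
      by_contra h
      exact hi (Finset.mem_biUnion.mpr ⟨x, hx, by simpa using h⟩)
    exact this hmem
  have hB : ∀ i, ∃ x : I i, ∀ (j : R) (hj : j ∈ J), j • x = g ⟨j, hj⟩ i := by
    intro i
    obtain ⟨g', hg'⟩ := Module.Baer.of_injective (hI i) J (DFinsupp.lapply i ∘ₗ g)
    refine ⟨g' 1, fun j hj => ?_⟩
    rw [← map_smul, smul_eq_mul, mul_one, hg' j hj]; rfl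
  choose x hx using hB
  let y : Π₀ i, I i := DFinsupp.mk t (fun i => x i)
  refine ⟨LinearMap.toSpanSingleton R _ y, fun j hj => ?_⟩
  ext i
  rw [LinearMap.toSpanSingleton_apply, DFinsupp.smul_apply, DFinsupp.mk_apply]
  split_ifs with h
  · exact hx i j hj
  · rw [ht _ i h, smul_zero]

/-- The torsion submodule for a multiplicative family of ideals. -/
def Gam (F : Submonoid (Ideal R)) (I : Type u) [AddCommGroup I] [Module R I] :
    Submodule R I where
  carrier := {x | ∃ b : Ideal R, b ∈ F ∧ ∀ r ∈ b, r • x = 0}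
  add_mem' {x y} hx hy := by
    rw [Set.mem_ofPred_eq] at *
    obtain ⟨b, hb, hx⟩ := hx
    obtain ⟨c, hc, hy⟩ := hy
    refine ⟨b * c, F.mul_mem hb hc, fun r hr => ?_⟩
    rw [smul_add, hx r (Ideal.mul_le_left hr), hy r (Ideal.mul_le_right hr), add_zero]
  zero_mem' := ⟨1, F.one_mem, fun r _ => smul_zero r⟩
  smul_mem' := by
    intro c x hx
    rw [Set.mem_ofPred_eq] at *
    obtain ⟨b, hb, hx⟩ := hx
    exact ⟨b, hb, fun r hr => by rw [smul_comm, hx r hr, smul_zero]⟩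

lemma mem_Gam {F : Submonoid (Ideal R)} {I : Type u} [AddCommGroup I] [Module R I] {x : I} :
    x ∈ Gam F I ↔ ∃ b : Ideal R, b ∈ F ∧ ∀ r ∈ b, r • x = 0 := Iff.rfl

lemma Gam_map {F : Submonoid (Ideal R)} {I I' : Type u} [AddCommGroup I] [Module R I]
    [AddCommGroup I'] [Module R I'] (f : I →ₗ[R] I') {x : I} (hx : x ∈ Gam F I) :
    f x ∈ Gam F I' := by
  obtain ⟨b, hb, h⟩ := mem_Gam.mp hx
  exact ⟨b, hb, fun r hr => by rw [← map_smul, h r hr, map_zero]⟩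

lemma Gam_uniform {F : Submonoid (Ideal R)} {I : Type u} [AddCommGroup I] [Module R I] 
    (N : Submodule R I) (hN : N.FG) (h : N ≤ Gam F I) :
    ∃ b ∈ F, ∀ r ∈ b, ∀ x ∈ N, r • x = 0 := by
  obtain ⟨s, hs⟩ := hN
  subst hs
  induction s using Finset.cons_induction with
  | empty => exact ⟨1, F.one_mem, by simp⟩
  | cons a s ha ih =>
    obtain ⟨b, hb, hb'⟩ := ih (le_trans (Submodule.span_mono (by simp)) h)
    obtain ⟨c, hc, hc'⟩ := mem_Gam.mp <| h (Submodule.subset_span (by simp : a ∈ _))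
    refine ⟨b * c, F.mul_mem hb hc, fun r hr x hx => ?_⟩
    rw [Finset.coe_cons, Submodule.mem_span_insert] at hx
    obtain ⟨k, z, hz, rfl⟩ := hx
    rw [smul_add, hb' r (Ideal.mul_le_left hr) z hz, smul_comm,
      hc' r (Ideal.mul_le_right hr)]; simp

lemma Gam_inj [IsNoetherianRing R] (F : Submonoid (Ideal R)) {I : Type u} [AddCommGroup I]
    [Module R I] (hI : Module.Injective R I) : Module.Injective R (Gam F I) := by
  rw [← Module.Baer.iff_injective]
  intro J g
  have hfg : (LinearMap.range ((Gam F I).subtype ∘ₗ g)).FG := by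
    have : Module.Finite R J := Module.IsNoetherian.finite R J
    exact Module.Finite.iff_fg.mp inferInstance
  obtain ⟨b, hb, hb'⟩ := Gam_uniform (F := F) _ hfg (by
    rintro _ ⟨x, rfl⟩; exact (g x).2)
  obtain ⟨k, hk⟩ := Ideal.exists_pow_inf_eq_pow_smul (I := b) (M := R) J
  have hk1 := hk (k+1) (by omega)
  let v : J →ₗ[R] R ⧸ (b^(k+1)) := (Ideal.Quotient.mkₐ R (b^(k+1))).toLinearMap ∘ₗ J.subtype
  obtain ⟨g', hg'⟩ := ext_of_ker_le hI v ((Gam F I).subtype ∘ₗ g) (by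
    rintro ⟨j, hj⟩ hjk
    have h1 : j ∈ b^(k+1) := by
      simpa [v, Ideal.Quotient.eq_zero_iff_mem] using hjk
    have h2 : j ∈ b ^ (k+1-k) • (b^k • (⊤ : Submodule R R) ⊓ J) := by
      rw [← hk1]; exact ⟨by simpa using h1, hj⟩
    rw [show k+1-k = 1 by omega, pow_one] at h2
    have h3 : j ∈ b • J := Submodule.smul_mono le_rfl inf_le_right h2
    have h4 : ∀ z ∈ b • (⊤ : Submodule R J), ((g z : Gam F I) : I) = 0 := by
      intro z hz
      refine Submodule.smul_induction_on hz ?_ ?_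
      · intro r hr n _
        have := hb' r hr (g n : Gam F I) ⟨n, rfl⟩
        rw [map_smul]; exact this
      · intro x y hx hy
        rw [map_add, Submodule.coe_add, hx, hy, add_zero]
    have h5 : b • J = (b • (⊤ : Submodule R J)).map J.subtype := by
      rw [Submodule.map_smul'']; simp
    rw [h5] at h3
    obtain ⟨z, hz, hzj⟩ := h3
    have : z = ⟨j, hj⟩ := Subtype.ext hzj
    subst this
    exact h4 _ hz)
  refine ⟨LinearMap.toSpanSingleton R _ (⟨g' 1, b^(k+1), F.pow_mem hb _, fun r hr => ?_⟩ : Gam F I), ?_⟩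
  · rw [← map_smul, show r • (1 : R ⧸ b^(k+1)) = Ideal.Quotient.mk _ r by
      rw [Algebra.smul_def, mul_one]; rfl,
      Ideal.Quotient.eq_zero_iff_mem.mpr hr, map_zero]
  · intro x hx
    apply Subtype.ext
    have := LinearMap.congr_fun hg' ⟨x, hx⟩
    simp only [LinearMap.toSpanSingleton_apply, Submodule.coe_smul]
    rw [← map_smul]
    simp [v] at this
    rw [← this]
    congr 1
    rw [Algebra.smul_def, mul_one]; rfl

end P1
end GGP

namespace GGP
section P2
variable {R : Type u} [CommRing R]

/-- `Hom(L, Y)` is exact -/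
def OO {Y : Type u} [AddCommGroup Y] [Module R Y] (b : Y →ₗ[R] Y)
    (L : Type u) [AddCommGroup L] [Module R L] : Prop :=
  ∀ φ : L →ₗ[R] Y, b ∘ₗ φ = 0 → ∃ ψ : L →ₗ[R] Y, b ∘ₗ ψ = φ

/-- every chain map from `D` to `Y` is null-homotopic -/
def Orth {Y : Type u} [AddCommGroup Y] [Module R Y] (b : Y →ₗ[R] Y)
    {D : ℕ → Type u} [∀ i, AddCommGroup (D i)] [∀ i, Module R (D i)]
    (d : ∀ i, D i →ₗ[R] D (i + 1)) : Prop :=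
  ∀ f : ∀ i, D i →ₗ[R] Y, (∀ i, f (i + 1) ∘ₗ d i = b ∘ₗ f i) →
    ∃ h : ∀ i, D i →ₗ[R] Y, ∀ i, f i = b ∘ₗ h i + h (i + 1) ∘ₗ d i

variable {Y : Type u} [AddCommGroup Y] [Module R Y] {b : Y →ₗ[R] Y}

lemma OO_of_retract {L L' : Type u} [AddCommGroup L] [Module R L] [AddCommGroup L'] [Module R L']
    (hL : OO b L) (i : L' →ₗ[R] L) (r : L →ₗ[R] L') (hri : r ∘ₗ i = LinearMap.id) : OO b L' := by
  intro φ hφ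
  obtain ⟨ψ, hψ⟩ := hL (φ ∘ₗ r) (by rw [← LinearMap.comp_assoc, hφ, LinearMap.zero_comp])
  refine ⟨ψ ∘ₗ i, ?_⟩
  rw [← LinearMap.comp_assoc, hψ, LinearMap.comp_assoc, hri, LinearMap.comp_id]

lemma OO_dfinsupp {ι : Type u} (L : ι → Type u)
    [∀ i, AddCommGroup (L i)] [∀ i, Module R (L i)] (hL : ∀ i, OO b (L i)) :
    OO b (Π₀ i, L i) := by
  classical
  intro φ hφ
  have : ∀ i, ∃ ψ : L i →ₗ[R] Y, b ∘ₗ ψ = φ ∘ₗ DFinsupp.lsingle i := fun i => 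
    hL i _ (by rw [← LinearMap.comp_assoc, hφ, LinearMap.zero_comp])
  choose ψ hψ using this
  refine ⟨DFinsupp.lsum ℕ ψ, ?_⟩
  refine DFinsupp.lhom_ext' fun i => ?_
  rw [← hψ]
  ext x
  simp

variable {D D' D'' : ℕ → Type u} [∀ i, AddCommGroup (D i)] [∀ i, Module R (D i)]
  [∀ i, AddCommGroup (D' i)] [∀ i, Module R (D' i)]
  [∀ i, AddCommGroup (D'' i)] [∀ i, Module R (D'' i)]
  {d : ∀ i, D i →ₗ[R] D (i + 1)} {d' : ∀ i, D' i →ₗ[R] D' (i + 1)}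
  {d'' : ∀ i, D'' i →ₗ[R] D'' (i + 1)}

lemma Orth.anti (hD : Orth b d) (f : ∀ i, D i →ₗ[R] Y) 
    (hf : ∀ i x, f (i + 1) (d i x) = - b (f i x)) :
    ∃ h : ∀ i, D i →ₗ[R] Y, ∀ i x, f i x = b (h i x) - h (i + 1) (d i x) := by
  obtain ⟨h, hh⟩ := hD (fun i => ((-1 : R)^i) • f i) (fun i => by
    ext x
    simp [hf, pow_succ])
  refine ⟨fun i => ((-1 : R)^i) • h i, fun i x => ?_⟩
  have := congrArg (((-1 : R)^i) • ·) (LinearMap.congr_fun (hh i) x)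
  simp only [LinearMap.smul_apply, smul_smul, ← mul_pow, LinearMap.add_apply,
    LinearMap.comp_apply, smul_add] at this
  simp only [mul_neg, mul_one, neg_neg, one_pow, one_smul] at this
  simp only [this, LinearMap.smul_apply, map_smul, pow_succ, mul_neg, mul_one, neg_smul, LinearMap.neg_apply, sub_neg_eq_add]

lemma Orth.quot (hb : ∀ y, b (b y) = 0) (hY : Module.Injective R Y) (hD' : Orth b d') (hD : Orth b d)
    (ι : ∀ i, D' i →ₗ[R] D i) (π : ∀ i, D i →ₗ[R] D'' i)
    (hι : ∀ i x, ι (i + 1) (d' i x) = d i (ι i x)) (hπ : ∀ i x, π (i + 1) (d i x) = d'' i (π i x))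
    (hinj : ∀ i, Function.Injective (ι i)) (hsurj : ∀ i, Function.Surjective (π i))
    (hex : ∀ i x, π i x = 0 ↔ ∃ y, ι i y = x) (hdd : ∀ i x, d (i + 1) (d i x) = 0) :
    Orth b d'' := by
  intro f hf
  have hf' : ∀ i x, f (i + 1) (d'' i x) = b (f i x) := fun i x => LinearMap.congr_fun (hf i) x
  obtain ⟨h, hh⟩ := hD (fun i => f i ∘ₗ π i) (fun i => by
    ext x
    simp [hπ, hf'])
  have hh' : ∀ i x, f i (π i x) = b (h i x) + h (i + 1) (d i x) :=
    fun i x => LinearMap.congr_fun (hh i) x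
  have hπι : ∀ i x, π i (ι i x) = 0 := fun i x => (hex i _).2 ⟨x, rfl⟩
  obtain ⟨k, hk⟩ := hD'.anti (fun i => h i ∘ₗ ι i) (fun i x => by
    have := hh' i (ι i x)
    rw [hπι, map_zero] at this
    simp only [LinearMap.comp_apply, hι]
    rw [eq_neg_iff_add_eq_zero, this, add_comm])
  have : ∀ i, ∃ k' : D i →ₗ[R] Y, k' ∘ₗ ι i = k i := fun i => ext_of_inj hY _ (hinj i) _
  choose k' hk' using this
  have hk'' : ∀ i x, k' i (ι i x) = k i x := fun i x => LinearMap.congr_fun (hk' i) x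
  have : ∀ i, ∃ h'' : D'' i →ₗ[R] Y, ∀ x, h'' (π i x) = h i x - b (k' i x) + k' (i + 1) (d i x) := by
    intro i
    obtain ⟨g, hg⟩ := ext_of_ker_le hY (π i) (h i - b ∘ₗ k' i + k' (i + 1) ∘ₗ d i) (by
      intro x hx
      obtain ⟨y, rfl⟩ := (hex i x).1 hx
      have := hk i y
      simp only [LinearMap.comp_apply] at this
      simp [← hι, hk'', this])
    exact ⟨g, fun x => by simpa using LinearMap.congr_fun hg x⟩
  choose h'' hh'' using this
  refine ⟨h'', fun i => ?_⟩
  ext x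
  obtain ⟨y, rfl⟩ := hsurj i x
  simp only [LinearMap.add_apply, LinearMap.comp_apply, ← hπ, hh'', hh', hdd, map_zero,
    map_add, map_sub, hb]
  abel

lemma Orth.sub (hb : ∀ y, b (b y) = 0) (hY : Module.Injective R Y)
    (hD : Orth b d) (hD'' : Orth b d'')
    (ι : ∀ i, D' i →ₗ[R] D i) (π : ∀ i, D i →ₗ[R] D'' i)
    (hι : ∀ i x, ι (i + 1) (d' i x) = d i (ι i x)) (hπ : ∀ i x, π (i + 1) (d i x) = d'' i (π i x))
    (hinj : ∀ i, Function.Injective (ι i)) (hsurj : ∀ i, Function.Surjective (π i))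
    (hex : ∀ i x, π i x = 0 ↔ ∃ y, ι i y = x) (hdd : ∀ i x, d (i + 1) (d i x) = 0) :
    Orth b d' := by
  intro f hf
  have hf' : ∀ i x, f (i + 1) (d' i x) = b (f i x) := fun i x => LinearMap.congr_fun (hf i) x
  have hπι : ∀ i x, π i (ι i x) = 0 := fun i x => (hex i _).2 ⟨x, rfl⟩
  have : ∀ i, ∃ k' : D i →ₗ[R] Y, k' ∘ₗ ι i = f i := fun i => ext_of_inj hY _ (hinj i) _
  choose g hg using this
  have hg' : ∀ i x, g i (ι i x) = f i x := fun i x => LinearMap.congr_fun (hg i) x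
  have : ∀ i, ∃ c : D'' i →ₗ[R] Y, ∀ x, c (π i x) = b (g i x) - g (i + 1) (d i x) := by
    intro i
    obtain ⟨c, hc⟩ := ext_of_ker_le hY (π i) (b ∘ₗ g i - g (i + 1) ∘ₗ d i) (by
      intro x hx
      obtain ⟨y, rfl⟩ := (hex i x).1 hx
      simp [← hι, hg', hf'])
    exact ⟨c, fun x => by simpa using LinearMap.congr_fun hc x⟩
  choose c hc using this
  obtain ⟨k, hk⟩ := hD''.anti c (fun i x => by
    obtain ⟨y, rfl⟩ := hsurj i x
    rw [← hπ, hc, hc, hdd]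
    simp [hb])
  obtain ⟨h, hh⟩ := hD (fun i => g i - k i ∘ₗ π i) (fun i => by
    ext x
    have h1 := hk i (π i x)
    rw [hc, ← hπ] at h1
    simp only [LinearMap.sub_apply, LinearMap.comp_apply, map_sub]
    rw [sub_eq_iff_eq_add] at h1
    rw [h1]; abel)
  refine ⟨fun i => h i ∘ₗ ι i, fun i => ?_⟩
  ext x
  have := LinearMap.congr_fun (hh i) (ι i x)
  simp only [LinearMap.sub_apply, LinearMap.comp_apply, hg', hπι, map_zero, sub_zero,
    LinearMap.add_apply] at this
  simp only [this, LinearMap.comp_apply, LinearMap.add_apply, hι]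

lemma Orth.congr (hD : Orth b d) (e : ∀ i, D i ≃ₗ[R] D' i)
    (he : ∀ i x, e (i + 1) (d i x) = d' i (e i x)) : Orth b d' := by
  intro f hf
  obtain ⟨h, hh⟩ := hD (fun i => f i ∘ₗ (e i).toLinearMap) (fun i => by
    ext x
    have := LinearMap.congr_fun (hf i) (e i x)
    simpa [he] using this)
  refine ⟨fun i => h i ∘ₗ (e i).symm.toLinearMap, fun i => ?_⟩
  ext x
  obtain ⟨y, rfl⟩ := (e i).surjective x
  have := LinearMap.congr_fun (hh i) y
  simpa [← he] using this

lemma Orth.finsupp (hD : Orth b d) :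
    Orth b (D := fun i => ℕ →₀ D i) (fun i => Finsupp.mapRange.linearMap (d i)) := by
  intro f hf
  have hf' : ∀ i x, f (i + 1) (Finsupp.mapRange.linearMap (d i) x) = b (f i x) :=
    fun i x => LinearMap.congr_fun (hf i) x
  have : ∀ n, ∃ h : ∀ i, D i →ₗ[R] Y, ∀ i, f i ∘ₗ Finsupp.lsingle n = b ∘ₗ h i + h (i + 1) ∘ₗ d i := by
    intro n
    refine hD _ (fun i => ?_)
    ext x
    have := hf' i (Finsupp.single n x)
    simpa using this
  choose h hh using this
  refine ⟨fun i => Finsupp.lsum ℕ (fun n => h n i), fun i => ?_⟩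
  refine Finsupp.lhom_ext' fun n => ?_
  rw [hh]
  ext x
  simp

lemma Orth.of_terms (N : ℕ) (hN : ∀ i, N < i → ∀ x : D i, x = 0)
    (hdd : ∀ i x, d (i + 1) (d i x) = 0) (h : ∀ i, OO b (D i)) : Orth b d := by
  intro f hf
  have hf' : ∀ i x, f (i + 1) (d i x) = b (f i x) := fun i x => LinearMap.congr_fun (hf i) x
  have key : ∀ m, ∃ h : ∀ i, D i →ₗ[R] Y, ∀ i, N < i + m → f i = b ∘ₗ h i + h (i + 1) ∘ₗ d i := by
    intro m
    induction m with
    | zero =>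
      refine ⟨fun i => 0, fun i hi => ?_⟩
      ext x
      simp [hN i (by simpa using hi) x]
    | succ m ih =>
      obtain ⟨g, hg⟩ := ih
      have : ∀ i, ∃ g' : D i →ₗ[R] Y, N < (i + 1) + m → b ∘ₗ g' = f i - g (i + 1) ∘ₗ d i := by
        intro i
        by_cases hi : N < i + 1 + m
        · obtain ⟨ψ, hψ⟩ := h i (f i - g (i + 1) ∘ₗ d i) (by
            ext x
            have h1 := LinearMap.congr_fun (hg (i + 1) hi) (d i x)
            simp only [LinearMap.add_apply, LinearMap.comp_apply, hdd, map_zero, add_zero] at h1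
            simp [← h1, hf'])
          exact ⟨ψ, fun _ => hψ⟩
        · exact ⟨0, fun h => absurd h hi⟩
      choose g' hg' using this
      refine ⟨fun i => if N < i + m then g i else g' i, fun i hi => ?_⟩
      have h2 : N < i + 1 + m := by omega
      simp only [h2, if_true]
      split_ifs with h3
      · exact hg i h3
      · rw [hg' i h2]; abel
  obtain ⟨g, hg⟩ := key (N + 1)
  exact ⟨g, fun i => hg i (by omega)⟩

lemma Orth.of_exact (hb : ∀ y, b (b y) = 0) (hY : Module.Injective R Y)
    (h0 : Function.Injective (d 0))
    (hex : ∀ i x, d (i + 1) x = 0 → ∃ y, d i y = x) : Orth b d := by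
  intro f hf
  have hf' : ∀ i x, f (i + 1) (d i x) = b (f i x) := fun i x => LinearMap.congr_fun (hf i) x
  obtain ⟨h1, hh1⟩ := ext_of_inj hY _ h0 (f 0)
  have next : ∀ i (p : {p : (D i →ₗ[R] Y) × (D (i + 1) →ₗ[R] Y) // f i = b ∘ₗ p.1 + p.2 ∘ₗ d i}),
      ∃ q : {p : (D (i + 1) →ₗ[R] Y) × (D (i + 1 + 1) →ₗ[R] Y) // 
        f (i + 1) = b ∘ₗ p.1 + p.2 ∘ₗ d (i + 1)}, q.1.1 = p.1.2 := by
    rintro i ⟨⟨p1, p2⟩, hp⟩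
    obtain ⟨q, hq⟩ := ext_of_ker_le hY (d (i + 1)) (f (i + 1) - b ∘ₗ p2) (by
      intro x hx
      obtain ⟨y, rfl⟩ := hex i x hx
      have h1 := LinearMap.congr_fun hp y
      simp only [LinearMap.add_apply, LinearMap.comp_apply] at h1
      simp [hf', h1, hb])
    exact ⟨⟨⟨p2, q⟩, by rw [hq]; abel⟩, rfl⟩
  choose nx hnx using next
  let t : ∀ i, {p : (D i →ₗ[R] Y) × (D (i + 1) →ₗ[R] Y) // f i = b ∘ₗ p.1 + p.2 ∘ₗ d i} :=
    fun i => Nat.rec ⟨⟨0, h1⟩, by rw [hh1]; simp⟩ (fun i p => nx i p) i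
  refine ⟨fun i => (t i).1.1, fun i => ?_⟩
  have : (t (i + 1)).1.1 = (t i).1.2 := hnx i (t i)
  show f i = b ∘ₗ (t i).1.1 + (t (i + 1)).1.1 ∘ₗ d i
  rw [this]
  exact (t i).2

lemma Orth.split (hD : Orth b d) (h : ℕ) {H : Type u} [AddCommGroup H] [Module R H]
    (i : H →ₗ[R] D h) (r : ∀ k, D k →ₗ[R] H) (hri : r h ∘ₗ i = LinearMap.id)
    (hdi : d h ∘ₗ i = 0) (hrd : ∀ k, r (k + 1) ∘ₗ d k = 0) : OO b H := by
  intro φ hφ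
  obtain ⟨g, hg⟩ := hD (fun k => φ ∘ₗ r k) (fun k => by
    rw [LinearMap.comp_assoc, hrd, ← LinearMap.comp_assoc, hφ]; simp)
  refine ⟨g h ∘ₗ i, ?_⟩
  have := congrArg (· ∘ₗ i) (hg h)
  simp only [LinearMap.comp_assoc, hri, LinearMap.add_comp, hdi, LinearMap.comp_zero,
    LinearMap.comp_id, add_zero] at this
  exact this.symm

end P2
end GGP

namespace GGP
section P3
variable {R : Type u} [CommRing R] [IsNoetherianRing R]

lemma exists_prime_ann {M : Type u} [AddCommGroup M] [Module R M] (x : M) (hx : x ≠ 0) :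
    ∃ (p : Ideal R) (r : R), p.IsPrime ∧ ∀ s, s ∈ p ↔ s • (r • x) = 0 := by
  have : Nontrivial (Submodule.span R {x}) :=
    ⟨⟨⟨x, Submodule.mem_span_singleton_self x⟩, 0, fun h => hx (by simpa using h)⟩⟩
  obtain ⟨p, hp⟩ := associatedPrimes.nonempty R (Submodule.span R {x})
  rw [AssociatedPrimes.mem_iff, isAssociatedPrime_iff] at hp
  obtain ⟨hp, ⟨y, hy⟩, rfl⟩ := hp
  obtain ⟨r, rfl⟩ := Submodule.mem_span_singleton.mp hy
  refine ⟨_, r, hp, fun s => ?_⟩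
  rw [Submodule.mem_colon_singleton]
  simp [← Subtype.coe_inj]

variable {Y : Type u} [AddCommGroup Y] [Module R Y] {b : Y →ₗ[R] Y}

/-- there is a good injective module containing `R/p` -/
def Good (b : Y →ₗ[R] Y) (p : Ideal R) : Prop :=
  ∃ (E : ModuleCat.{u} R) (v : E), Module.Injective R E ∧ OO b E ∧ ∀ s : R, s ∈ p ↔ s • v = 0

lemma exists_max_indep {I : Type u} [AddCommGroup I] [Module R I] :
    ∃ S : Set (Submodule R I), sSupIndep S ∧ 
      (∀ N ∈ S, ∃ x : I, N = Submodule.span R {x} ∧ ∃ p : Ideal R, p.IsPrime ∧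
        ∀ s, s ∈ p ↔ s • x = 0) ∧
      ∀ N : Submodule R I, Disjoint N (sSup S) → N = ⊥ := by
  have zorn := zorn_subset
    (S := {S : Set (Submodule R I) | sSupIndep S ∧ 
      (∀ N ∈ S, ∃ x : I, N = Submodule.span R {x} ∧ ∃ p : Ideal R, p.IsPrime ∧
        ∀ s, s ∈ p ↔ s • x = 0)})
    fun c hc1 hc2 =>
      ⟨⋃₀ c,
        ⟨iSupIndep_sUnion_of_directed hc2.directedOn fun s hs => (hc1 hs).1,
          fun a ⟨s, sc, as⟩ => (hc1 sc).2 a as⟩,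
        fun _ => Set.subset_sUnion_of_mem⟩
  simp_rw [maximal_subset_iff] at zorn
  obtain ⟨S, ⟨s_ind, hS⟩, s_max⟩ := zorn
  refine ⟨S, s_ind, hS, fun N hN => ?_⟩
  by_contra hne
  obtain ⟨x, hxN, hx⟩ := Submodule.exists_mem_ne_zero_of_ne_bot hne
  obtain ⟨p, r, hp, hpr⟩ := exists_prime_ann (R := R) x hx
  set a := Submodule.span R {r • x} with ha
  have haN : a ≤ N := by
    rw [ha, Submodule.span_singleton_le_iff_mem]; exact N.smul_mem _ hxN
  have hne' : r • x ≠ 0 := fun h => hp.ne_top (by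
    rw [Ideal.eq_top_iff_one, hpr, h, smul_zero])
  have a_dis_Sup_s : Disjoint a (sSup S) := hN.mono_left haN
  have haS : a ∈ S := by
    rw [s_max ⟨fun x hx => ?_, fun x hx => ?_⟩ Set.subset_union_left]
    · exact Set.mem_union_right _ (Set.mem_singleton _)
    · rw [Set.mem_union, Set.mem_singleton_iff] at hx
      obtain rfl | xa := eq_or_ne x a
      · simp only [Set.mem_singleton, Set.insert_sdiff_of_mem, Set.union_singleton]
        exact a_dis_Sup_s.mono_right (sSup_le_sSup Set.sdiff_subset)
      · have h : (S ∪ {a}) \ {x} = S \ {x} ∪ {a} := by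
          simp only [Set.union_singleton]
          rw [Set.insert_sdiff_of_notMem]
          rw [Set.mem_singleton_iff]
          exact Ne.symm xa
        rw [h, sSup_union, sSup_singleton]
        apply
          (s_ind (hx.resolve_right xa)).disjoint_sup_right_of_disjoint_sup_left
            (a_dis_Sup_s.mono_right _).symm
        rw [← sSup_insert, Set.insert_sdiff_singleton, Set.insert_eq_of_mem (hx.resolve_right xa)]
    · rw [Set.mem_union, Set.mem_singleton_iff] at hx
      obtain hx | rfl := hx
      · exact hS x hx
      · exact ⟨_, ha, p, hp, hpr⟩
  have : a = ⊥ := by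
    have := a_dis_Sup_s.mono_right (le_sSup haS)
    exact disjoint_self.mp this
  rw [ha, Submodule.span_singleton_eq_bot] at this
  exact hne' this

lemma OO_of_good {I : Type u} [AddCommGroup I] [Module R I] (hI : Module.Injective R I)
    (h : ∀ (p : Ideal R) (x : I), p.IsPrime → (∀ s, s ∈ p ↔ s • x = 0) → Good b p) : OO b I := by
  classical
  obtain ⟨S, hind, hS, hess⟩ := exists_max_indep (R := R) (I := I)
  have : ∀ N : S, ∃ E : ModuleCat.{u} R, Module.Injective R E ∧ OO b E ∧ 
      ∃ f : N.1 →ₗ[R] E, Function.Injective f := by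
    rintro ⟨N, hN⟩
    obtain ⟨x, rfl, p, hp, hpx⟩ := hS N hN
    obtain ⟨E, v, hE, hEO, hv⟩ := h p x hp hpx
    refine ⟨E, hE, hEO, ?_⟩
    have hker : ∀ s : R, s • x = 0 ↔ s • v = 0 := fun s => (hpx s).symm.trans (hv s)
    obtain ⟨g, hg⟩ := ext_of_ker_le hE (LinearMap.toSpanSingleton R I x)
      (LinearMap.toSpanSingleton R E v) (fun s hs => by
        exact (hker s).1 hs)
    refine ⟨g ∘ₗ Submodule.subtype _, ?_⟩
    rw [← LinearMap.ker_eq_bot, LinearMap.ker_eq_bot']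
    rintro ⟨y, hy⟩ hgy
    obtain ⟨s, rfl⟩ := Submodule.mem_span_singleton.mp hy
    have h1 := LinearMap.congr_fun hg s
    have h2 : g (s • x) = 0 := hgy
    have : s • v = 0 := h1.symm.trans h2
    exact Subtype.ext ((hker s).2 this)
  choose E hE hEO f hf using this
  have hj := ((sSupIndep_iff S).1 hind).dfinsupp_lsum_injective
  set j := DFinsupp.lsum ℕ fun i : S => (i.1).subtype with hjdef
  let g : (Π₀ N : S, N.1) →ₗ[R] (Π₀ N : S, E N) := DFinsupp.mapRange.linearMap f
  have hg : Function.Injective g := by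
    apply (DFinsupp.mapRange_injective (fun N => f N) (fun N => map_zero _)).mpr
    exact hf
  have hE' := inj_dfinsupp (fun N : S => E N) hE
  obtain ⟨g', hg'⟩ := ext_of_inj hE' j hj g
  have hrange : sSup S = LinearMap.range j := by
    rw [sSup_eq_iSup', Submodule.iSup_eq_range_dfinsupp_lsum]
  have hinj : Function.Injective g' := by
    rw [← LinearMap.ker_eq_bot]
    apply hess
    rw [hrange, Submodule.disjoint_def]
    rintro _ hx ⟨y, rfl⟩
    have h1 := LinearMap.congr_fun hg' y
    have h2 : g y = 0 := by rw [← h1]; exact hx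
    rw [hg (h2.trans (map_zero g).symm), map_zero]
  obtain ⟨r, hr⟩ := retract_of_inj hI g' hinj
  exact OO_of_retract (OO_dfinsupp (fun N : S => E N) hEO) g' r hr

end P3
end GGP

namespace GGP
section P4
variable {R : Type u} [CommRing R]

section tele
variable {D : Type u} [AddCommGroup D] [Module R D]

/-- the telescope map `1 - x * shift` -/
noncomputable def sig (x : R) (D : Type u) [AddCommGroup D] [Module R D] :
    (ℕ →₀ D) →ₗ[R] (ℕ →₀ D) :=
  LinearMap.id - x • Finsupp.lmapDomain D R Nat.succ

lemma sig_zero (x : R) (v : ℕ →₀ D) : sig x D v 0 = v 0 := by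
  simp [sig, Finsupp.mapDomain_notin_range]

lemma sig_succ (x : R) (v : ℕ →₀ D) (k : ℕ) : sig x D v (k + 1) = v (k + 1) - x • v k := by
  have := Finsupp.mapDomain_apply Nat.succ_injective v k
  simp only [sig, LinearMap.sub_apply, LinearMap.smul_apply, LinearMap.id_apply,
    Finsupp.lmapDomain_apply, Finsupp.sub_apply, Finsupp.smul_apply]
  rw [← this]

lemma sig_inj (x : R) : Function.Injective (sig x D) := by
  rw [← LinearMap.ker_eq_bot, LinearMap.ker_eq_bot']
  intro v hv
  ext k
  induction k with
  | zero => rw [← sig_zero x, hv]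
  | succ k ih =>
    have := sig_succ x v k
    rw [hv, ih] at this
    simpa using this.symm

/-- first map to the telescope -/
noncomputable def kap (x : R) (D : Type u) [AddCommGroup D] [Module R D] :
    D →ₗ[R] (ℕ →₀ D) ⧸ LinearMap.range (sig x D) :=
  (LinearMap.range (sig x D)).mkQ ∘ₗ Finsupp.lsingle 0

lemma single_tele (x : R) (k m : ℕ) (y : D) :
    (LinearMap.range (sig x D)).mkQ (Finsupp.single k y) =
      (LinearMap.range (sig x D)).mkQ (Finsupp.single (k + m) (x ^ m • y)) := by
  induction m with
  | zero => simp
  | succ m ih =>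
    rw [ih, ← sub_eq_zero, ← map_sub]
    rw [Submodule.mkQ_apply, Submodule.Quotient.mk_eq_zero]
    refine ⟨Finsupp.single (k + m) (x ^ m • y), ?_⟩
    simp [sig, pow_succ', mul_smul, ← add_assoc]

lemma kap_zero_iff (x : R) (y : D) : kap x D y = 0 ↔ ∃ k : ℕ, x ^ k • y = 0 := by
  constructor
  · intro h
    have : Finsupp.single 0 y ∈ LinearMap.range (sig x D) := by
      rwa [kap, LinearMap.comp_apply, Submodule.mkQ_apply, Submodule.Quotient.mk_eq_zero] at h
    obtain ⟨v, hv⟩ := this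
    have hk : ∀ k, v k = x ^ k • y := by
      intro k
      induction k with
      | zero => rw [← sig_zero x, hv]; simp
      | succ k ih =>
        have := sig_succ x v k
        rw [hv, ih] at this
        simp at this
        rw [pow_succ', mul_smul, ← sub_eq_zero]; exact this.symm
    obtain ⟨k, hk'⟩ := Infinite.exists_notMem_finset v.support
    exact ⟨k, by rw [← hk]; simpa using hk'⟩
  · rintro ⟨k, hk⟩
    rw [kap, LinearMap.comp_apply, Finsupp.lsingle_apply, single_tele x 0 k, hk]
    simp

lemma exists_div [IsNoetherianRing R] (hD : Module.Injective R D) (x : R) (k : ℕ) (y : D) :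
    ∃ (z : D) (m : ℕ), x ^ m • (x ^ k • z) = x ^ m • y := by
  let f : ℕ →o Ideal R := ⟨fun n => LinearMap.ker (LinearMap.lsmul R R (x ^ n)), by
    intro a c hac r hr
    simp only [LinearMap.mem_ker, LinearMap.lsmul_apply, smul_eq_mul] at hr ⊢
    obtain ⟨e, rfl⟩ := Nat.exists_eq_add_of_le hac
    rw [pow_add, mul_assoc, mul_left_comm, hr, mul_zero]⟩
  obtain ⟨m, hm⟩ := monotone_stabilizes_iff_noetherian.mpr ‹IsNoetherianRing R› f
  obtain ⟨g, hg⟩ := ext_of_ker_le hD (LinearMap.lsmul R R (x ^ (m + k)))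
    (LinearMap.toSpanSingleton R D (x ^ m • y)) (by
      intro r hr
      have : r ∈ f m := by rw [hm (m + k) (by omega)]; exact hr
      have h2 : x ^ m * r = 0 := this
      show r • (x ^ m • y) = 0
      rw [smul_smul, mul_comm, h2, zero_smul])
  refine ⟨g 1, m, ?_⟩
  have := LinearMap.congr_fun hg 1
  simp only [LinearMap.comp_apply, LinearMap.lsmul_apply, LinearMap.toSpanSingleton_apply,
    map_smul, one_smul] at this
  rw [smul_smul, ← pow_add, this]

lemma kap_surj [IsNoetherianRing R] (hD : Module.Injective R D) (x : R) :
    Function.Surjective (kap x D) := by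
  rw [← LinearMap.range_eq_top, eq_top_iff]
  have : (⊤ : Submodule R ((ℕ →₀ D) ⧸ LinearMap.range (sig x D))) =
      LinearMap.range (LinearMap.range (sig x D)).mkQ := by simp
  rw [this]
  rintro _ ⟨v, rfl⟩
  induction v using Finsupp.induction_linear with
  | zero => simp
  | add f g hf hg => rw [map_add]; exact add_mem hf hg
  | single k y =>
    obtain ⟨z, m, hz⟩ := exists_div hD x k y
    refine ⟨z, ?_⟩
    rw [kap, LinearMap.comp_apply, Finsupp.lsingle_apply, single_tele x 0 (k + m),
      single_tele x k m, ← hz, smul_smul, ← pow_add, zero_add, add_comm m k]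

end tele

lemma mem_Gam_powers {I : Type u} [AddCommGroup I] [Module R I] {q : Ideal R} {y : I} :
    y ∈ Gam (Submonoid.powers q) I ↔ ∃ k : ℕ, ∀ r ∈ q ^ k, r • y = 0 := by
  rw [mem_Gam]
  constructor
  · rintro ⟨_, ⟨k, rfl⟩, h⟩; exact ⟨k, h⟩
  · rintro ⟨k, h⟩; exact ⟨_, ⟨k, rfl⟩, h⟩

lemma mem_Gam_span {I : Type u} [AddCommGroup I] [Module R I] {x : R} {y : I} :
    y ∈ Gam (Submonoid.powers (Ideal.span {x})) I ↔ ∃ k : ℕ, x ^ k • y = 0 := by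
  rw [mem_Gam_powers]
  refine exists_congr fun k => ?_
  rw [Ideal.span_singleton_pow]
  constructor
  · intro h; exact h _ (Ideal.mem_span_singleton_self _)
  · intro h r hr
    obtain ⟨s, rfl⟩ := Ideal.mem_span_singleton'.mp hr
    rw [mul_smul, h, smul_zero]

variable {Y : Type u} [AddCommGroup Y] [Module R Y] {b : Y →ₗ[R] Y}
  {D : ℕ → Type u} [∀ i, AddCommGroup (D i)] [∀ i, Module R (D i)]
  {d : ∀ i, D i →ₗ[R] D (i + 1)}

/-- differential on the torsion subcomplex -/
def gd (F : Submonoid (Ideal R)) (d : ∀ i, D i →ₗ[R] D (i + 1)) (i : ℕ) :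
    Gam F (D i) →ₗ[R] Gam F (D (i + 1)) :=
  (d i).restrict (fun _ hx => Gam_map (d i) hx)

@[simp] lemma gd_coe (F : Submonoid (Ideal R)) (i : ℕ) (x : Gam F (D i)) :
    (gd F d i x : D (i + 1)) = d i x := rfl

lemma Orth.gam_span [IsNoetherianRing R] (hb : ∀ y, b (b y) = 0) (hY : Module.Injective R Y)
    (hD : Orth b d) (hinj : ∀ i, Module.Injective R (D i)) (hdd : ∀ i x, d (i + 1) (d i x) = 0)
    (x : R) : Orth b (gd (Submonoid.powers (Ideal.span {x})) d) := by
  have hfin := hD.finsupp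
  have hcomm : ∀ i v, sig x (D (i + 1)) (Finsupp.mapRange.linearMap (d i) v) =
      Finsupp.mapRange.linearMap (d i) (sig x (D i) v) := by
    intro i v
    ext k
    cases k with
    | zero => simp [sig_zero]
    | succ k => simp [sig_succ]
  have hq : Orth b (D := fun i => (ℕ →₀ D i) ⧸ LinearMap.range (sig x (D i)))
      (fun i => Submodule.mapQ _ _ (Finsupp.mapRange.linearMap (d i)) (by
        rintro _ ⟨v, rfl⟩
        exact ⟨_, hcomm i v⟩)) := by
    refine Orth.quot hb hY hfin hfin (fun i => sig x (D i)) (fun i => Submodule.mkQ _)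
      hcomm ?_ (fun i => sig_inj x) (fun i => Submodule.mkQ_surjective _) ?_ ?_
    · intro i v; rfl
    · intro i v
      rw [Submodule.mkQ_apply, Submodule.Quotient.mk_eq_zero]; rfl
    · intro i v
      ext k
      simp [hdd]
  refine Orth.sub hb hY hD hq (fun i => Submodule.subtype _) (fun i => kap x (D i)) ?_ ?_ 
    (fun i => Subtype.val_injective) (fun i => kap_surj (hinj i) x) ?_ hdd
  · intro i v; rfl
  · intro i v
    simp [kap]
  · intro i v
    rw [kap_zero_iff, ← mem_Gam_span]
    exact ⟨fun h => ⟨⟨v, h⟩, rfl⟩, by rintro ⟨w, rfl⟩; exact w.2⟩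

/-- iterated torsion -/
noncomputable def gamEquiv {F1 F2 F3 : Submonoid (Ideal R)} {I : Type u} [AddCommGroup I]
    [Module R I] (h : ∀ y : I, y ∈ Gam F3 I ↔ y ∈ Gam F1 I ∧ y ∈ Gam F2 I) :
    Gam F1 (Gam F2 I) ≃ₗ[R] Gam F3 I :=
  LinearEquiv.ofBijective
    (((Gam F2 I).subtype ∘ₗ (Gam F1 (Gam F2 I)).subtype).codRestrict (Gam F3 I) (fun y => by
      rw [h]
      exact ⟨Gam_map (Gam F2 I).subtype y.2, y.1.2⟩)) (by
    constructor
    · intro x y hxy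
      have := congrArg Subtype.val hxy
      exact Subtype.ext (Subtype.ext this)
    · rintro ⟨y, hy⟩
      obtain ⟨h1, h2⟩ := (h y).1 hy
      obtain ⟨c, hc, hc'⟩ := mem_Gam.mp h1
      exact ⟨⟨⟨y, h2⟩, mem_Gam.mpr ⟨c, hc, fun r hr => Subtype.ext (hc' r hr)⟩⟩, rfl⟩)

lemma Orth.gam [IsNoetherianRing R] (hb : ∀ y, b (b y) = 0) (hY : Module.Injective R Y)
    (q : Ideal R) : ∀ {D : ℕ → Type u} [∀ i, AddCommGroup (D i)] [∀ i, Module R (D i)]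
    {d : ∀ i, D i →ₗ[R] D (i + 1)}
    (_ : Orth b d) (_ : ∀ i, Module.Injective R (D i)) (_ : ∀ i x, d (i + 1) (d i x) = 0),
     Orth b (gd (Submonoid.powers q) d) := by
  have hq : q.FG := IsNoetherian.noetherian q
  induction q, hq using Submodule.fg_induction with
  | singleton x => 
    intro D _ _ d hD hinj hdd
    exact hD.gam_span hb hY hinj hdd x
  | sup N1 N2 h1 h2 ih1 ih2 =>
    intro D _ _ d hD hinj hdd
    have i2 := ih2 hD hinj hdd
    have i1 := ih1 i2 (fun i => Gam_inj _ (hinj i)) (fun i x => Subtype.ext (hdd i x))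
    refine i1.congr (fun i => gamEquiv ?_) ?_
    · intro y
      simp only [mem_Gam_powers]
      constructor
      · rintro ⟨k, hk⟩
        exact ⟨⟨k, fun r hr => hk r (Ideal.pow_right_mono le_sup_left k hr)⟩,
          ⟨k, fun r hr => hk r (Ideal.pow_right_mono le_sup_right k hr)⟩⟩
      · rintro ⟨⟨k, hk⟩, ⟨l, hl⟩⟩
        refine ⟨k + l, fun r hr => ?_⟩
        obtain ⟨s, hs, t, ht, rfl⟩ := Submodule.mem_sup.mp (Ideal.sup_pow_add_le_pow_sup_pow hr)
        rw [add_smul, hk s hs, hl t ht, add_zero]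
    · intro i x; rfl

/-- ideals not contained in a prime -/
def Zfam (q : Ideal R) [hq : q.IsPrime] : Submonoid (Ideal R) where
  carrier := {c | ¬ c ≤ q}
  mul_mem' := by
    intro x y hx hy h
    exact (hq.mul_le.mp h).elim hx hy
  one_mem' := by
    intro h
    exact hq.ne_top (top_le_iff.mp (by simpa using h))

lemma mem_Zfam (q : Ideal R) [hq : q.IsPrime] (c : Ideal R) : c ∈ Zfam q ↔ ¬ c ≤ q := Iff.rfl

/-- The local piece `Γ_q(I)_q` -/
abbrev Loc (q : Ideal R) [q.IsPrime] (I : Type u) [AddCommGroup I] [Module R I] : Type u :=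
  Gam (Submonoid.powers q) I ⧸ Gam (Zfam q) (Gam (Submonoid.powers q) I)

/-- differential on the local piece -/
def locd (q : Ideal R) [q.IsPrime] (d : ∀ i, D i →ₗ[R] D (i + 1)) (i : ℕ) :
    Loc q (D i) →ₗ[R] Loc q (D (i + 1)) :=
  Submodule.mapQ _ _ (gd (Submonoid.powers q) d i) (fun _ hx => Gam_map _ hx)

/-- the local pieces of `D` have split cohomology -/
def LocSplit (d : ∀ i, D i →ₗ[R] D (i + 1)) : Prop :=
  ∀ (q : Ideal R) [q.IsPrime], ∃ (H : ModuleCat.{u} R) (n : ℕ) (i : H →ₗ[R] Loc q (D n))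
    (r : ∀ k, Loc q (D k) →ₗ[R] H), r n ∘ₗ i = LinearMap.id ∧ locd q d n ∘ₗ i = 0 ∧
    (∀ k, r (k + 1) ∘ₗ locd q d k = 0) ∧ ∃ v : H, v ≠ 0

lemma Good_of_prime [IsNoetherianRing R] (hb : ∀ y, b (b y) = 0) (hY : Module.Injective R Y)
    (hD : Orth b d) (hinj : ∀ i, Module.Injective R (D i)) (hdd : ∀ i x, d (i + 1) (d i x) = 0)
    (N : ℕ) (hN : ∀ i, N < i → ∀ x : D i, x = 0) (hs : LocSplit d)
    (q : Ideal R) (hq : q.IsPrime) : Good b q := by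
  revert hq
  induction q using WellFoundedGT.induction with
  | ind q ih =>
  intro hq
  have o1 := hD.gam hb hY q hinj hdd
  have i1 : ∀ i, Module.Injective R (Gam (Submonoid.powers q) (D i)) := fun i => Gam_inj _ (hinj i)
  have i2 : ∀ i, Module.Injective R (Gam (Zfam q) (Gam (Submonoid.powers q) (D i))) :=
    fun i => Gam_inj _ (i1 i)
  have o2 : Orth b (gd (Zfam q) (gd (Submonoid.powers q) d)) := by
    refine Orth.of_terms N ?_ ?_ (fun i => OO_of_good (i2 i) ?_)
    · intro i hi x
      exact Subtype.ext (Subtype.ext (hN i hi _))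
    · intro i x
      exact Subtype.ext (Subtype.ext (hdd i _))
    · intro p x hp hpx
      obtain ⟨c, hc, hcx⟩ := mem_Gam.mp x.2
      obtain ⟨k, hk⟩ := mem_Gam_powers.mp x.1.2
      have h1 : q ≤ p := hp.le_of_pow_le (n := k) (fun r hr => by
        rw [hpx]; exact Subtype.ext (Subtype.ext (hk r hr)))
      have h2 : c ≤ p := fun r hr => by
        rw [hpx]; exact Subtype.ext (hcx r hr)
      exact ih p (lt_of_le_not_ge h1 (fun h => (mem_Zfam q c).1 hc (h2.trans h))) hp
  have o3 : Orth b (locd q d) := by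
    refine Orth.quot hb hY o2 o1 (fun i => Submodule.subtype _) (fun i => Submodule.mkQ _)
      (fun i x => rfl) (fun i x => rfl) (fun i => Subtype.val_injective)
      (fun i => Submodule.mkQ_surjective _) ?_ (fun i x => Subtype.ext (hdd i _))
    intro i x
    rw [Submodule.mkQ_apply, Submodule.Quotient.mk_eq_zero]
    exact ⟨fun h => ⟨⟨x, h⟩, rfl⟩, by rintro ⟨w, rfl⟩; exact w.2⟩
  obtain ⟨H, n, i, r, hri, hdi, hrd, v, hv⟩ := hs q
  have hOH : OO b H := o3.split n i r hri hdi hrd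
  have hGinj : Module.Injective R (Loc q (D n)) := by
    obtain ⟨ρ, hρ⟩ := retract_of_inj (i2 n) (Submodule.subtype _) Subtype.val_injective
    have hρ' : ∀ x, ρ x.1 = x := fun x => LinearMap.congr_fun hρ x
    refine inj_of_retract (i1 n) (Submodule.liftQ _ (LinearMap.id - (Submodule.subtype _) ∘ₗ ρ) ?_)
      (Submodule.mkQ _) ?_
    · intro x hx
      simp only [LinearMap.mem_ker, LinearMap.sub_apply, LinearMap.id_apply, LinearMap.comp_apply,
        Submodule.subtype_apply]
      rw [hρ' ⟨x, hx⟩, sub_self]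
    · refine Submodule.linearMap_qext _ ?_
      ext x
      simp
  have hHinj : Module.Injective R H := inj_of_retract hGinj i (r n) hri
  obtain ⟨p, t, hp, hpt⟩ := exists_prime_ann (R := R) v hv
  have hiinj : Function.Injective i := by
    intro x y hxy
    have := congrArg (r n) hxy
    have h2 := fun z => LinearMap.congr_fun hri z
    simp only [LinearMap.comp_apply, LinearMap.id_apply] at h2
    rwa [h2, h2] at this
  have htv : t • v ≠ 0 := fun h => hp.ne_top (by
    rw [Ideal.eq_top_iff_one, hpt, h, smul_zero])
  obtain ⟨w, hw⟩ := Submodule.mkQ_surjective _ (i (t • v))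
  suffices p = q by
    subst this
    exact ⟨H, t • v, hHinj, hOH, hpt⟩
  apply le_antisymm
  · intro s hsp
    by_contra hsq
    have h1 : i (s • (t • v)) = 0 := by rw [(hpt s).1 hsp, map_zero]
    rw [map_smul, ← hw, ← map_smul, Submodule.mkQ_apply, Submodule.Quotient.mk_eq_zero] at h1
    obtain ⟨c, hc, hcx⟩ := mem_Gam.mp h1
    have : w ∈ Gam (Zfam q) (Gam (Submonoid.powers q) (D n)) := by
      refine mem_Gam.mpr ⟨c * Ideal.span {s}, mul_mem hc ?_, ?_⟩
      · rw [mem_Zfam, Ideal.span_singleton_le_iff_mem]; exact hsq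
      · intro z hz
        obtain ⟨z', hz', rfl⟩ := Ideal.mem_mul_span_singleton.mp hz
        rw [mul_smul, hcx z' hz']
    apply htv
    apply hiinj
    rw [← hw, Submodule.mkQ_apply, (Submodule.Quotient.mk_eq_zero _).mpr this, map_zero]
  · obtain ⟨k, hk⟩ := mem_Gam_powers.mp w.2
    refine hp.le_of_pow_le (n := k) (fun r hr => ?_)
    rw [hpt]
    apply hiinj
    rw [map_smul, ← hw, ← map_smul, show r • w = 0 from Subtype.ext (hk r hr), map_zero, map_zero]

theorem theoremK [IsNoetherianRing R] (hb : ∀ y, b (b y) = 0) (hY : Module.Injective R Y)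
    (hD : Orth b d) (hinj : ∀ i, Module.Injective R (D i)) (hdd : ∀ i x, d (i + 1) (d i x) = 0)
    (N : ℕ) (hN : ∀ i, N < i → ∀ x : D i, x = 0) (hs : LocSplit d)
    {I : Type u} [AddCommGroup I] [Module R I] (hI : Module.Injective R I) : OO b I :=
  OO_of_good hI (fun p _ hp _ => Good_of_prime hb hY hD hinj hdd N hN hs p hp)

end P4
end GGP

namespace GGP
section P5
variable {R : Type u} [CommRing R]

variable {D : ℕ → Type u} [∀ i, AddCommGroup (D i)] [∀ i, Module R (D i)]
  {d : ∀ i, D i →ₗ[R] D (i + 1)}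

/-- boundaries -/
def bd (d : ∀ i, D i →ₗ[R] D (i + 1)) : ∀ i, Submodule R (D i)
  | 0 => ⊥
  | i + 1 => LinearMap.range (d i)

/-- finitely generated cohomology -/
def FgCoh (d : ∀ i, D i →ₗ[R] D (i + 1)) : Prop :=
  ∀ i, ∃ C : Submodule R (D i), C.FG ∧ C ≤ LinearMap.ker (d i) ∧ LinearMap.ker (d i) ≤ C ⊔ bd d i

lemma exists_fg_map_eq {A B : Type u} [AddCommGroup A] [Module R A] [AddCommGroup B] [Module R B]
    (f : A →ₗ[R] B) (T : Submodule R B) (hT : T.FG) (h : T ≤ LinearMap.range f) :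
    ∃ L : Submodule R A, L.FG ∧ L.map f = T := by
  classical
  obtain ⟨s, rfl⟩ := hT
  have : ∀ x : s, ∃ a, f a = x := fun x => h (Submodule.subset_span x.2)
  choose a ha using this
  refine ⟨Submodule.span R (Set.range a), Submodule.fg_span (Set.finite_range a), ?_⟩
  rw [Submodule.map_span, ← Set.range_comp]
  congr 1
  ext y
  constructor
  · rintro ⟨x, rfl⟩; simp [ha]
  · intro hy; exact ⟨⟨y, hy⟩, ha _⟩

lemma exists_fg_sub [IsNoetherianRing R] (N : ℕ) (hN : ∀ i, N < i → ∀ x : D i, x = 0)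
    (hfg : FgCoh d) :
    ∃ S : ∀ i, Submodule R (D i), (∀ i, (S i).FG) ∧
      (∀ i, (S i).map (d i) = S (i + 1) ⊓ LinearMap.range (d i)) ∧
      (∀ i, LinearMap.ker (d i) ≤ S i ⊔ bd d i) := by
  have key : ∀ m, ∃ S : ∀ i, Submodule R (D i), (∀ i, (S i).FG) ∧
      (∀ i, N < i + m → (S i).map (d i) = S (i + 1) ⊓ LinearMap.range (d i)) ∧
      (∀ i, N < i + m → LinearMap.ker (d i) ≤ S i ⊔ bd d i) := by
    intro m
    induction m with
    | zero =>
      refine ⟨fun i => ⊥, fun i => Submodule.fg_bot, fun i hi => by simp, fun i hi x hx => ?_⟩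
      rw [hN i (by simpa using hi) x]; exact zero_mem _
    | succ m ih =>
      obtain ⟨S, hS1, hS2, hS3⟩ := ih
      have : ∀ i, ∃ T : Submodule R (D i), T.FG ∧
          T.map (d i) = S (i + 1) ⊓ LinearMap.range (d i) ∧ LinearMap.ker (d i) ≤ T ⊔ bd d i := by
        intro i
        obtain ⟨C, hC1, hC2, hC3⟩ := hfg i
        have : Module.Finite R (S (i + 1)) := Module.Finite.iff_fg.mpr (hS1 (i + 1))
        obtain ⟨L, hL1, hL2⟩ := exists_fg_map_eq (d i) (S (i + 1) ⊓ LinearMap.range (d i))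
          (Submodule.FG.of_le (hS1 (i + 1)) inf_le_left) inf_le_right
        refine ⟨L ⊔ C, hL1.sup hC1, ?_, ?_⟩
        · rw [Submodule.map_sup, hL2, show C.map (d i) = ⊥ from (Submodule.eq_bot_iff _).mpr (by rintro _ ⟨x, hx, rfl⟩; exact hC2 hx), sup_bot_eq]
        · exact hC3.trans (sup_le_sup_right le_sup_right _)
      choose T hT1 hT2 hT3 using this
      refine ⟨fun i => if N < i + m then S i else T i, ?_, ?_, ?_⟩
      · intro i
        dsimp only
        split_ifs
        · exact hS1 i
        · exact hT1 i
      · intro i hi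
        have h2 : N < i + 1 + m := by omega
        simp only [h2, if_true]
        split_ifs with h3
        · exact hS2 i h3
        · exact hT2 i
      · intro i hi
        dsimp only
        split_ifs with h3
        · exact hS3 i h3
        · exact hT3 i
  obtain ⟨S, h1, h2, h3⟩ := key (N + 1)
  exact ⟨S, h1, fun i => h2 i (by omega), fun i => h3 i (by omega)⟩

variable {Y : Type u} [AddCommGroup Y] [Module R Y] {b : Y →ₗ[R] Y}
  {Y' : Type u} [AddCommGroup Y'] [Module R Y'] {b' : Y' →ₗ[R] Y'}

lemma Orth.factor [IsNoetherianRing R] (hb : ∀ y, b (b y) = 0) (hY : Module.Injective R Y)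
    (hb' : ∀ y, b' (b' y) = 0) (hY' : Module.Injective R Y')
    (hD : Orth b d) (hdd : ∀ i x, d (i + 1) (d i x) = 0)
    (N : ℕ) (hN : ∀ i, N < i → ∀ x : D i, x = 0) (hfg : FgCoh d)
    (hfac : ∀ (S : ∀ i, Submodule R (D i)) (_ : ∀ i, (S i).FG) (hS : ∀ i, ∀ x ∈ S i, d i x ∈ S (i + 1))
      (f : ∀ i, S i →ₗ[R] Y') (_ : ∀ i (x : S i), f (i + 1) ⟨d i x, hS i x x.2⟩ = b' (f i x)),
      ∃ (u : Y →ₗ[R] Y') (g : ∀ i, S i →ₗ[R] Y), (∀ y, u (b y) = b' (u y)) ∧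
      (∀ i (x : S i), g (i + 1) ⟨d i x, hS i x x.2⟩ = b (g i x)) ∧ ∀ i x, u (g i x) = f i x) :
    Orth b' d := by
  obtain ⟨S, hS1, hS2, hS3⟩ := exists_fg_sub N hN hfg
  have hS : ∀ i, ∀ x ∈ S i, d i x ∈ S (i + 1) := fun i x hx => by
    have : d i x ∈ (S i).map (d i) := ⟨x, hx, rfl⟩
    rw [hS2] at this; exact this.1
  let W : ℕ → Type u := fun i => D i ⧸ S i
  let dW : ∀ i, W i →ₗ[R] W (i + 1) := fun i => Submodule.mapQ _ _ (d i) (hS i)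
  have hdW : ∀ i x, dW i ((S i).mkQ x) = (S (i + 1)).mkQ (d i x) := fun i x => rfl
  have key : ∀ i x, d i x ∈ S (i + 1) → ∃ y ∈ bd d i, x - y ∈ S i := by
    intro i x hx
    have : d i x ∈ (S i).map (d i) := by rw [hS2]; exact ⟨hx, x, rfl⟩
    obtain ⟨s, hs, hsx⟩ := this
    have h1 : x - s ∈ LinearMap.ker (d i) := by rw [LinearMap.mem_ker, map_sub, hsx, sub_self]
    obtain ⟨s', hs', y, hy, h2⟩ := Submodule.mem_sup.mp (hS3 i h1)
    refine ⟨y, hy, ?_⟩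
    have : x - y = s + s' := by rw [sub_eq_iff_eq_add, add_assoc, h2]; abel
    rw [this]; exact add_mem hs hs'
  have h0 : Function.Injective (dW 0) := by
    rw [← LinearMap.ker_eq_bot, LinearMap.ker_eq_bot']
    intro x hx
    obtain ⟨x, rfl⟩ := Submodule.mkQ_surjective _ x
    rw [hdW, Submodule.mkQ_apply, Submodule.Quotient.mk_eq_zero] at hx
    obtain ⟨y, hy, hxy⟩ := key 0 x hx
    rw [(Submodule.mem_bot R).mp hy, sub_zero] at hxy
    rwa [Submodule.mkQ_apply, Submodule.Quotient.mk_eq_zero]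
  have hex : ∀ i x, dW (i + 1) x = 0 → ∃ y, dW i y = x := by
    intro i x hx
    obtain ⟨x, rfl⟩ := Submodule.mkQ_surjective _ x
    rw [hdW, Submodule.mkQ_apply, Submodule.Quotient.mk_eq_zero] at hx
    obtain ⟨y, ⟨z, rfl⟩, hxy⟩ := key (i + 1) x hx
    refine ⟨(S i).mkQ z, ?_⟩
    rw [hdW, eq_comm, ← sub_eq_zero, ← map_sub, Submodule.mkQ_apply, Submodule.Quotient.mk_eq_zero]
    exact hxy
  have oW : Orth b dW := Orth.of_exact hb hY h0 hex
  have oW' : Orth b' dW := Orth.of_exact hb' hY' h0 hex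
  intro f hf
  have hf' : ∀ i x, f (i + 1) (d i x) = b' (f i x) := fun i x => LinearMap.congr_fun (hf i) x
  obtain ⟨u, g0, hu, hg0, hug⟩ := hfac S hS1 hS (fun i => f i ∘ₗ (S i).subtype) (fun i x => by simp [hf'])
  have : ∀ i, ∃ k' : D i →ₗ[R] Y, k' ∘ₗ (S i).subtype = g0 i :=
    fun i => ext_of_inj hY _ Subtype.val_injective _
  choose g hg using this
  have hg' : ∀ i (x : S i), g i x.1 = g0 i x := fun i x => LinearMap.congr_fun (hg i) x
  have : ∀ i, ∃ c : W i →ₗ[R] Y, ∀ x, c ((S i).mkQ x) = b (g i x) - g (i + 1) (d i x) := by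
    intro i
    refine ⟨(S i).liftQ (b ∘ₗ g i - g (i + 1) ∘ₗ d i) ?_, fun x => rfl⟩
    intro x hx
    have h1 := hg' (i + 1) ⟨d i x, hS i x hx⟩
    have h2 := hg0 i ⟨x, hx⟩
    have h3 := hg' i ⟨x, hx⟩
    simp only at h1 h2 h3
    simp only [LinearMap.mem_ker, LinearMap.sub_apply, LinearMap.comp_apply]
    rw [h1, h2, h3, sub_self]
  choose c hc using this
  obtain ⟨k, hk⟩ := oW.anti c (fun i x => by
    obtain ⟨y, rfl⟩ := Submodule.mkQ_surjective _ x
    rw [hdW, hc, hc, hdd]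
    simp [hb])
  have hg2 : ∀ i x, (g (i + 1) - k (i + 1) ∘ₗ (S (i + 1)).mkQ) (d i x) 
      = b ((g i - k i ∘ₗ (S i).mkQ) x) := by
    intro i x
    have h1 := hk i ((S i).mkQ x)
    rw [hc, hdW] at h1
    simp only [LinearMap.sub_apply, LinearMap.comp_apply, map_sub]
    rw [sub_eq_iff_eq_add] at h1
    rw [h1]; abel
  obtain ⟨h, hh⟩ := hD (fun i => g i - k i ∘ₗ (S i).mkQ) (fun i => LinearMap.ext (hg2 i))
  have : ∀ i, ∃ c : W i →ₗ[R] Y', ∀ x, c ((S i).mkQ x) =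
      f i x - u ((g i - k i ∘ₗ (S i).mkQ) x) := by
    intro i
    refine ⟨(S i).liftQ (f i - u ∘ₗ (g i - k i ∘ₗ (S i).mkQ)) ?_, fun x => rfl⟩
    intro x hx
    have h2 := hug i ⟨x, hx⟩
    have h3 := hg' i ⟨x, hx⟩
    have h4 : (S i).mkQ x = 0 := by rwa [Submodule.mkQ_apply, Submodule.Quotient.mk_eq_zero]
    simp only [LinearMap.comp_apply, Submodule.subtype_apply] at h2 h3
    simp only [LinearMap.mem_ker, LinearMap.sub_apply, LinearMap.comp_apply, h4, map_zero, sub_zero]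
    rw [h3, h2, sub_self]
  choose c' hc' using this
  obtain ⟨k', hk'⟩ := oW' c' (fun i => by
    ext x
    have := hc' (i + 1) (d i x)
    rw [← hdW] at this
    simp only [LinearMap.comp_apply, this, hc', map_sub, hf', hg2, hu])
  refine ⟨fun i => k' i ∘ₗ (S i).mkQ + u ∘ₗ h i, fun i => ?_⟩
  ext x
  have h1 := LinearMap.congr_fun (hk' i) ((S i).mkQ x)
  have h2 := congrArg u (LinearMap.congr_fun (hh i) x)
  rw [hc', LinearMap.add_apply, LinearMap.comp_apply, LinearMap.comp_apply, hdW, h2,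
    LinearMap.add_apply, LinearMap.comp_apply, LinearMap.comp_apply, map_add, hu,
    sub_eq_iff_eq_add] at h1
  rw [h1]
  simp only [LinearMap.comp_apply, LinearMap.add_apply, map_add]
  abel

/-- The properties of the dualizing complex that we need. -/
structure Dual (R : Type u) [CommRing R] where
  D : ℕ → ModuleCat.{u} R
  d : ∀ i, D i →ₗ[R] D (i + 1)
  N : ℕ
  hN : ∀ i, N < i → ∀ x : D i, x = 0
  hdd : ∀ i x, d (i + 1) (d i x) = 0
  hinj : ∀ i, Module.Injective R (D i)
  hs : LocSplit d
  hfg : FgCoh d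

theorem OO_factor [IsNoetherianRing R] (Δ : Dual R) (hb : ∀ y, b (b y) = 0)
    (hY : Module.Injective R Y) (hb' : ∀ y, b' (b' y) = 0) (hY' : Module.Injective R Y')
    (hO : ∀ I : ModuleCat.{u} R, Module.Injective R I → OO b I) 
    (hfac : ∀ (S : ∀ i, Submodule R (Δ.D i)) (_ : ∀ i, (S i).FG)
      (hS : ∀ i, ∀ x ∈ S i, Δ.d i x ∈ S (i + 1))
      (f : ∀ i, S i →ₗ[R] Y') (_ : ∀ i (x : S i), f (i + 1) ⟨Δ.d i x, hS i x x.2⟩ = b' (f i x)),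
      ∃ (u : Y →ₗ[R] Y') (g : ∀ i, S i →ₗ[R] Y), (∀ y, u (b y) = b' (u y)) ∧
      (∀ i (x : S i), g (i + 1) ⟨Δ.d i x, hS i x x.2⟩ = b (g i x)) ∧ ∀ i x, u (g i x) = f i x)
    (I : ModuleCat.{u} R) (hI : Module.Injective R I) : OO b' I := by
  have h1 : Orth b Δ.d := Orth.of_terms Δ.N Δ.hN Δ.hdd (fun i => hO _ (Δ.hinj i))
  have h2 : Orth b' Δ.d := h1.factor hb hY hb' hY' Δ.hdd Δ.N Δ.hN Δ.hfg hfac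
  exact theoremK hb' hY' h2 Δ.hinj Δ.hdd Δ.N Δ.hN Δ.hs hI

end P5
end GGP

namespace GGP
section P6
open GG
variable {R : Type u} [CommRing R]

/-- ungraded reformulation of Gorenstein injectivity -/
def GI' (R : Type u) [CommRing R] (N : Type u) [AddCommGroup N] [Module R N] : Prop :=
  ∃ (Y : ModuleCat.{u} R) (b : Y →ₗ[R] Y) (e : ℤ → Y →ₗ[R] Y) (i : N →ₗ[R] Y),
    Module.Injective R Y ∧ (∀ y, b (b y) = 0) ∧ (∀ n y, e n (e n y) = e n y) ∧
    (∀ n y, b (e n y) = e (n + 1) (b y)) ∧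
    (∀ n y, e n y = y → b y = 0 → ∃ z, b z = y) ∧
    (∀ I : ModuleCat.{u} R, Module.Injective R I → OO b I) ∧
    Function.Injective i ∧ ∀ y, (∃ x, i x = y) ↔ (e 0 y = y ∧ b y = 0)

lemma GI'.toGI {N : Type u} [AddCommGroup N] [Module R N] (h : GI' R N) :
    IsGorensteinInjective R N := by
  obtain ⟨Y, b, e, i, hY, hb, he, hbe, hex, hO, hi, hr⟩ := h
  have hm : ∀ n, ∀ y ∈ LinearMap.range (e n), b y ∈ LinearMap.range (e (n + 1)) := by
    rintro n _ ⟨y, rfl⟩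
    exact ⟨b y, (hbe n y).symm⟩
  have hr1 : ∀ n y, y ∈ LinearMap.range (e n) ↔ e n y = y := fun n y =>
    ⟨by rintro ⟨z, rfl⟩; exact he n z, fun h => ⟨y, h⟩⟩
  refine ⟨fun n => ModuleCat.of R (LinearMap.range (e n)), fun n => b.restrict (hm n), ?_, ?_, ?_, ?_⟩
  · intro n
    refine inj_of_retract hY (LinearMap.range (e n)).subtype (e n).rangeRestrict ?_
    ext x
    exact (hr1 n x).1 x.2
  · intro n
    apply le_antisymm
    · rintro _ ⟨y, rfl⟩
      exact Subtype.ext (hb _)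
    · intro y hy
      have h1 : b y.1 = 0 := congrArg Subtype.val (LinearMap.mem_ker.mp hy)
      have h2 := (hr1 _ y.1).1 y.2
      obtain ⟨z, hz⟩ := hex (n + 1) y.1 h2 h1
      refine ⟨⟨e n z, z, rfl⟩, Subtype.ext ?_⟩
      show b (e n z) = y.1
      rw [hbe, hz, h2]
  · intro I hI n φ hφ
    obtain ⟨ψ, hψ⟩ := hO I hI ((LinearMap.range (e (n + 1))).subtype ∘ₗ φ) (by
      ext x
      exact congrArg Subtype.val (LinearMap.congr_fun hφ x))
    refine ⟨(e n).rangeRestrict ∘ₗ ψ, ?_⟩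
    refine LinearMap.ext fun x => Subtype.ext ?_
    show b (e n (ψ x)) = (φ x).1
    rw [hbe]
    have : b (ψ x) = (φ x).1 := LinearMap.congr_fun hψ x
    rw [this]
    exact (hr1 _ _).1 (φ x).2
  · let j : N →ₗ[R] LinearMap.ker (b.restrict (hm 0)) :=
      LinearMap.codRestrict _ (LinearMap.codRestrict _ i (fun x => 
        (hr1 0 _).2 ((hr _).1 ⟨x, rfl⟩).1)) (fun x => Subtype.ext ((hr _).1 ⟨x, rfl⟩).2)
    refine ⟨LinearEquiv.ofBijective j ⟨?_, ?_⟩⟩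
    · intro x y hxy
      exact hi (congrArg (fun z => z.1.1) hxy)
    · rintro ⟨⟨y, hy⟩, hy2⟩
      obtain ⟨x, hx⟩ := (hr y).2 ⟨(hr1 _ _).1 hy, congrArg Subtype.val (LinearMap.mem_ker.mp hy2)⟩
      exact ⟨x, Subtype.ext (Subtype.ext hx)⟩

lemma exists_shift (X : ℤ → ModuleCat.{u} R) {Z : Type u} [AddCommGroup Z] [Module R Z]
    (g : ∀ n : ℤ, Z →ₗ[R] X (n + 1)) :
    ∃ G : ∀ n : ℤ, Z →ₗ[R] X n, ∀ n, G (n + 1) = g n := by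
  let G : ∀ n : ℤ, Z →ₗ[R] X n := fun n => (sub_add_cancel n 1) ▸ g (n - 1)
  refine ⟨G, fun n => ?_⟩
  have : ∀ (k : ℤ) (h : k + 1 = n + 1), (h ▸ g k : Z →ₗ[R] X (n + 1)) = g n := by
    intro k h
    obtain rfl : k = n := by omega
    rfl
  exact this _ _

lemma GI'.ofGI {N : Type u} [AddCommGroup N] [Module R N] (h : IsGorensteinInjective R N) :
    GI' R N := by
  obtain ⟨X, d, hinj, hex, hO, ⟨ι⟩⟩ := h
  obtain ⟨G, hG⟩ := exists_shift X (Z := ∀ n, X n) (fun n => d n ∘ₗ LinearMap.proj n)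
  have hG' : ∀ y n, G (n + 1) y = d n (y n) := fun y n => by rw [hG]; rfl
  have idx : ∀ {y z : ∀ n, X n}, (∀ n, y (n + 1) = z (n + 1)) → y = z := by
    intro y z h
    funext n
    obtain ⟨m, rfl⟩ : ∃ m, n = m + 1 := ⟨n - 1, by omega⟩
    exact h m
  have hdd : ∀ n x, d (n + 1) (d n x) = 0 := by
    intro n x
    have : d n x ∈ LinearMap.ker (d (n + 1)) := by rw [← hex]; exact ⟨x, rfl⟩
    exact this
  refine ⟨ModuleCat.of R (∀ n, X n), LinearMap.pi G, fun n => LinearMap.single R _ n ∘ₗ LinearMap.proj n,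
    LinearMap.single R (fun n => X n) 0 ∘ₗ (LinearMap.ker (d 0)).subtype ∘ₗ ι.toLinearMap, ?_, ?_, ?_, ?_, ?_, ?_, ?_, ?_⟩
  · have := hinj
    exact Module.Injective.pi R _
  · intro y
    funext n
    obtain ⟨m, rfl⟩ : ∃ m, n = m + 1 + 1 := ⟨n - 2, by omega⟩
    show G (m + 1 + 1) (fun n => G n y) = 0
    rw [hG', hG', hdd]
  · intro n y
    simp
  · intro n y
    refine idx fun m => ?_
    show G (m + 1) (Pi.single n (y n)) = (Pi.single (n + 1) (G (n + 1) y) : ∀ n, X n) (m + 1)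
    rw [hG', hG']
    by_cases h : m = n
    · subst h; simp
    · rw [Pi.single_eq_of_ne h, Pi.single_eq_of_ne (by omega), map_zero]
  · intro n y hy hby
    obtain ⟨m, rfl⟩ : ∃ m, n = m + 1 := ⟨n - 1, by omega⟩
    have h1 : y (m + 1) ∈ LinearMap.range (d m) := by
      rw [hex, LinearMap.mem_ker, ← hG']
      exact congrFun hby (m + 1 + 1)
    obtain ⟨z, hz⟩ := h1
    refine ⟨Pi.single m z, idx fun k => ?_⟩
    show G (k + 1) (Pi.single m z) = _
    rw [hG', ← hy]
    show _ = (Pi.single (m + 1) (y (m + 1)) : ∀ n, X n) (k + 1)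
    by_cases h : k = m
    · subst h; simp [hz]
    · rw [Pi.single_eq_of_ne h, Pi.single_eq_of_ne (by omega), map_zero]
  · intro I hI φ hφ
    have : ∀ n, ∃ ψ : I →ₗ[R] X n, d n ∘ₗ ψ = LinearMap.proj (n + 1) ∘ₗ φ := by
      intro n
      refine hO I hI n _ ?_
      ext x
      have := congrFun (LinearMap.congr_fun hφ x) (n + 1 + 1)
      show d (n + 1) (φ x (n + 1)) = 0
      rw [← hG']
      exact this
    choose ψ hψ using this
    refine ⟨LinearMap.pi ψ, LinearMap.ext fun x => idx fun n => ?_⟩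
    show G (n + 1) (fun n => ψ n x) = φ x (n + 1)
    rw [hG']
    exact LinearMap.congr_fun (hψ n) x
  · intro x y hxy
    exact ι.injective (Subtype.ext (Pi.single_injective (M := fun n => X n) 0 hxy))
  · intro y
    constructor
    · rintro ⟨x, rfl⟩
      refine ⟨by simp, idx fun m => ?_⟩
      show G (m + 1) (Pi.single 0 (ι x).1) = 0
      rw [hG']
      by_cases h : m = 0
      · subst h; simp
      · rw [Pi.single_eq_of_ne h, map_zero]
    · rintro ⟨h1, h2⟩
      have h3 : y 0 ∈ LinearMap.ker (d 0) := by
        rw [LinearMap.mem_ker, ← hG']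
        exact congrFun h2 (0 + 1)
      refine ⟨ι.symm ⟨y 0, h3⟩, ?_⟩
      refine Eq.trans ?_ h1
      simp

lemma GI_congr {N N' : Type u} [AddCommGroup N] [Module R N] [AddCommGroup N'] [Module R N']
    (e : N ≃ₗ[R] N') (h : IsGorensteinInjective R N) : IsGorensteinInjective R N' := by
  obtain ⟨X, d, hinj, hex, hO, ⟨ι⟩⟩ := h
  exact ⟨X, d, hinj, hex, hO, ⟨e.symm.trans ι⟩⟩

theorem GI_sum [IsNoetherianRing R] (Δ : Dual R) {ι : Type u} (N : ι → Type u)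
    [∀ p, AddCommGroup (N p)] [∀ p, Module R (N p)]
    (h : ∀ p, IsGorensteinInjective R (N p)) : IsGorensteinInjective R (Π₀ p, N p) := by
  classical
  have h' := fun p => GI'.ofGI (h p)
  choose Y b e i hY hb he hbe hex hO hi hr using h'
  apply GI'.toGI
  let b' : (Π₀ p, Y p) →ₗ[R] (Π₀ p, Y p) := DFinsupp.mapRange.linearMap b
  let c : (∀ p, Y p) →ₗ[R] (∀ p, Y p) := LinearMap.pi fun p => b p ∘ₗ LinearMap.proj p
  have hY' : Module.Injective R (Π₀ p, Y p) := inj_dfinsupp _ hY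
  have hb' : ∀ y, b' (b' y) = 0 := fun y => by ext p; simp [b', hb]
  refine ⟨ModuleCat.of R (Π₀ p, Y p), b', fun n => DFinsupp.mapRange.linearMap (fun p => e p n),
    DFinsupp.mapRange.linearMap i, hY', hb', ?_, ?_, ?_, ?_, ?_, ?_⟩
  · intro n (y : Π₀ p, Y p); ext p; simp [he]
  · intro n (y : Π₀ p, Y p); ext p; simp [b', hbe]
  · intro n (y : Π₀ p, Y p) h1 h2
    have : ∀ p, ∃ z, b p z = y p := fun p => 
      hex p n (y p) (by simpa using DFunLike.congr_fun h1 p) (by simpa [b'] using DFunLike.congr_fun h2 p)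
    choose z hz using this
    refine ⟨DFinsupp.mk y.support (fun p => z p), ?_⟩
    show b' _ = y
    ext p
    by_cases hp : p ∈ y.support
    · simp only [b', DFinsupp.mapRange.linearMap_apply, DFinsupp.mapRange_apply, DFinsupp.mk_of_mem hp]
      exact hz p
    · simp only [b', DFinsupp.mapRange.linearMap_apply, DFinsupp.mapRange_apply,
        DFinsupp.mk_of_notMem hp, map_zero]
      rw [DFinsupp.notMem_support_iff] at hp
      exact hp.symm
  · refine OO_factor Δ (Y := ∀ p, Y p) (b := c) (Y' := Π₀ p, Y p) ?_ ?_ hb' hY' ?_ ?_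
    · intro y; funext p; exact hb p _
    · exact Module.Injective.pi R _
    · intro I hI φ hφ
      have : ∀ p, ∃ ψ : I →ₗ[R] Y p, b p ∘ₗ ψ = LinearMap.proj p ∘ₗ φ := fun p =>
        hO p I hI _ (by ext x; exact congrFun (LinearMap.congr_fun hφ x) p)
      choose ψ hψ using this
      refine ⟨LinearMap.pi ψ, ?_⟩
      ext x p
      exact LinearMap.congr_fun (hψ p) x
    · intro S hS1 hS f hf
      have : ∀ k, ∃ T : Finset ι, ∀ x, (f k x).support ⊆ T := by
        intro k
        obtain ⟨s, hs⟩ := (Module.Finite.iff_fg.mpr (hS1 k)).fg_top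
        refine ⟨s.biUnion (fun x => (f k x).support), fun x => ?_⟩
        have hx : x ∈ Submodule.span R (s : Set (S k)) := hs ▸ Submodule.mem_top
        induction hx using Submodule.span_induction with
        | mem x h => exact Finset.subset_biUnion_of_mem (fun x => (f k x).support) h
        | zero => simp
        | add x y _ _ hx hy => 
          rw [map_add]; exact DFinsupp.support_add.trans (Finset.union_subset hx hy)
        | smul a x _ hx => rw [map_smul]; exact (DFinsupp.support_smul _ _).trans hx
      choose T hT using this
      let T' := (Finset.range (Δ.N + 1)).biUnion T
      let u : (∀ p, Y p) →ₗ[R] (Π₀ p, Y p) := ∑ p ∈ T', DFinsupp.lsingle p ∘ₗ LinearMap.proj p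
      have hu : ∀ y p, u y p = if p ∈ T' then y p else 0 := by
        intro y p
        simp only [u, LinearMap.sum_apply, LinearMap.comp_apply, LinearMap.proj_apply,
          DFinsupp.lsingle_apply, DFinsupp.finsetSum_apply, DFinsupp.single_apply]
        by_cases hp : p ∈ T'
        · rw [if_pos hp, Finset.sum_eq_single p]
          · simp
          · intro q _ hq; rw [dif_neg hq]
          · intro h; exact absurd hp h
        · rw [if_neg hp]
          refine Finset.sum_eq_zero fun q hq => ?_
          rw [dif_neg]; rintro rfl; exact hp hq
      refine ⟨u, fun k => DFinsupp.coeFnLinearMap R ∘ₗ f k, ?_, ?_, ?_⟩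
      · intro y
        ext p
        simp only [hu, b', DFinsupp.mapRange.linearMap_apply, DFinsupp.mapRange_apply]
        split_ifs
        · rfl
        · simp
      · intro k x
        simp only [LinearMap.comp_apply, hf]
        rfl
      · intro k x
        ext p
        rw [hu]
        by_cases hk : Δ.N < k
        · have : x = 0 := Subtype.ext (Δ.hN k hk _)
          rw [this]; simp
        · split_ifs with hp
          · rfl
          · by_contra hne
            refine hp (Finset.mem_biUnion.mpr ⟨k, by simp; omega, hT k x ?_⟩)
            rw [DFinsupp.mem_support_iff]
            exact fun h => hne h.symm
  · intro x y hxy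
    ext p
    have := DFunLike.congr_fun hxy p
    exact hi p (by simpa using this)
  · intro (y : Π₀ p, Y p)
    constructor
    · rintro ⟨x, rfl⟩
      refine ⟨?_, ?_⟩
      · ext p; simpa using ((hr p _).1 ⟨x p, rfl⟩).1
      · show b' _ = 0
        ext p; simpa [b'] using ((hr p _).1 ⟨x p, rfl⟩).2
    · rintro ⟨h1, h2⟩
      have : ∀ p, ∃ z, i p z = y p := fun p => (hr p _).2
        ⟨by simpa using DFunLike.congr_fun h1 p, by simpa [b'] using DFunLike.congr_fun h2 p⟩
      choose z hz using this
      refine ⟨DFinsupp.mk y.support (fun p => z p), ?_⟩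
      ext p
      by_cases hp : p ∈ y.support
      · simp only [DFinsupp.mapRange.linearMap_apply, DFinsupp.mapRange_apply, DFinsupp.mk_of_mem hp]
        exact hz p
      · simp only [DFinsupp.mapRange.linearMap_apply, DFinsupp.mapRange_apply,
          DFinsupp.mk_of_notMem hp, map_zero]
        rw [DFinsupp.notMem_support_iff] at hp
        exact hp.symm

end P6
end GGP

namespace GGP
section P6b
open GG
variable {R : Type u} [CommRing R]

/-- semilinear localization maps -/
structure IsLoc (S : Submonoid R) {N N' : Type u} [AddCommGroup N] [Module R N] [AddCommGroup N']
    [Module (Localization S) N'] (f : N →ₛₗ[algebraMap R (Localization S)] N') : Prop where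
  surj : ∀ y, ∃ (s : S) (x : N), algebraMap R (Localization S) s • y = f x
  ker : ∀ x, f x = 0 → ∃ s : S, s • x = 0

/-- unbundle a semilinear localization map -/
lemma IsLoc.isLocalizedModule {S : Submonoid R} {N N' : Type u} [AddCommGroup N] [Module R N]
    [AddCommGroup N'] [Module (Localization S) N'] [Module R N'] [IsScalarTower R (Localization S) N']
    {f : N →ₛₗ[algebraMap R (Localization S)] N'} (hf : IsLoc S f) (g : N →ₗ[R] N')
    (hg : ∀ x, g x = f x) : IsLocalizedModule S g := by
  refine ⟨?_, ?_, ?_⟩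
  · intro s
    rw [Module.End.isUnit_iff]
    have hu := IsLocalization.map_units (Localization S) s
    constructor
    · intro x y hxy
      have : algebraMap R (Localization S) s • x = algebraMap R (Localization S) s • y := by
        rw [algebraMap_smul, algebraMap_smul]; exact hxy
      exact hu.smul_left_cancel.mp this
    · intro y
      refine ⟨hu.unit⁻¹.1 • y, ?_⟩
      show (s : R) • (hu.unit⁻¹.1 • y) = y
      rw [← algebraMap_smul (Localization S), smul_smul, IsUnit.mul_val_inv, one_smul]
  · intro y
    obtain ⟨s, x, h⟩ := hf.surj y
    refine ⟨(x, s), ?_⟩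
    show (s : R) • y = g x
    rw [← algebraMap_smul (Localization S), h, hg]
  · intro x y hxy
    obtain ⟨s, hs⟩ := hf.ker (x - y) (by rw [map_sub, ← hg, ← hg, hxy, sub_self])
    exact ⟨s, by rwa [smul_sub, sub_eq_zero] at hs⟩

/-- restriction of scalars preserves injectivity -/
lemma inj_restrict (S : Submonoid R) {I : Type u} [AddCommGroup I] [Module R I]
    [Module (Localization S) I] [IsScalarTower R (Localization S) I]
    (hI : Module.Injective (Localization S) I) : Module.Injective R I := by
  refine ⟨fun X Y _ _ _ _ f hf g => ?_⟩
  have hu : ∀ s : S, IsUnit (algebraMap R (Module.End R I) s) := by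
    intro s
    have hu := (IsLocalization.map_units (Localization S) s).map (algebraMap (Localization S) (Module.End (Localization S) I))
    rw [Module.End.isUnit_iff] at hu ⊢
    convert hu using 1
    ext x
    simp
  let g' : LocalizedModule S X →ₗ[Localization S] I :=
    (LocalizedModule.lift S g hu).extendScalarsOfIsLocalization S (Localization S)
  let f' : LocalizedModule S X →ₗ[Localization S] LocalizedModule S Y := LocalizedModule.map S f
  have hf' : Function.Injective f' := LocalizedModule.map_injective S f hf
  obtain ⟨h, hh⟩ := hI.out f' hf' g'
  refine ⟨h.restrictScalars R ∘ₗ LocalizedModule.mkLinearMap S Y, fun x => ?_⟩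
  have := hh (LocalizedModule.mk x 1)
  simp only [f', g', LocalizedModule.map_mk] at this
  simp only [LinearMap.comp_apply, LocalizedModule.mkLinearMap_apply, LinearMap.restrictScalars_apply]
  rw [this]
  show LocalizedModule.lift S g hu (LocalizedModule.mk x 1) = g x
  rw [LocalizedModule.lift_mk]
  simp

theorem GI_restrict [IsNoetherianRing R] (S : Submonoid R) (N : Type u) [AddCommGroup N]
    [Module R N] [Module (Localization S) N] [IsScalarTower R (Localization S) N]
    (h : IsGorensteinInjective (Localization S) N) : IsGorensteinInjective R N := by
  obtain ⟨Y, b, e, i, hY, hb, he, hbe, hex, hO, hi, hr⟩ := GI'.ofGI h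
  apply GI'.toGI
  let _ : Module R Y := Module.compHom Y (algebraMap R (Localization S))
  have : IsScalarTower R (Localization S) Y := ⟨fun r a y => by
    rw [Algebra.smul_def, mul_smul]; rfl⟩
  refine ⟨ModuleCat.of R Y, b.restrictScalars R, fun n => (e n).restrictScalars R,
    i.restrictScalars R, inj_restrict S hY, hb, he, hbe, hex, ?_, hi, hr⟩
  intro I hI (φ : I →ₗ[R] Y) hφ
  have hu : ∀ s : S, IsUnit (algebraMap R (Module.End R Y) s) := by
    intro s
    have hu := (IsLocalization.map_units (Localization S) s).map (algebraMap (Localization S) (Module.End (Localization S) Y))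
    rw [Module.End.isUnit_iff] at hu ⊢
    convert hu using 1
    ext x
    exact (algebraMap_smul (Localization S) (s : R) x).symm
  have hI' : Module.Injective (Localization S) (LocalizedModule S I) :=
    Module.injective_of_isLocalizedModule S (LocalizedModule.mkLinearMap S I)
  obtain ⟨ψ, hψ⟩ := hO (ModuleCat.of _ (LocalizedModule S I)) hI'
    ((LocalizedModule.lift S φ hu).extendScalarsOfIsLocalization S (Localization S)) (by
      have : (b.restrictScalars R) ∘ₗ (LocalizedModule.lift S φ hu) = 0 := by
        refine IsLocalizedModule.ext S (LocalizedModule.mkLinearMap S I) hu ?_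
        rw [LinearMap.comp_assoc, LocalizedModule.lift_comp, LinearMap.zero_comp]
        exact hφ
      ext x
      exact LinearMap.congr_fun this x)
  refine ⟨ψ.restrictScalars R ∘ₗ LocalizedModule.mkLinearMap S I, ?_⟩
  refine LinearMap.ext fun x => ?_
  have := LinearMap.congr_fun hψ (LocalizedModule.mk x 1)
  refine Eq.trans this ?_
  exact LinearMap.congr_fun (LocalizedModule.lift_comp S φ hu) x

theorem GI_loc' [IsNoetherianRing R] (Δ : Dual R) (S : Submonoid R) {N : Type u} [AddCommGroup N]
    [Module R N] (h : IsGorensteinInjective R N) :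
    IsGorensteinInjective (Localization S) (LocalizedModule S N) := by
  obtain ⟨Y, b, e, i, hY, hb, he, hbe, hex, hO, hi, hr⟩ := GI'.ofGI h
  apply GI'.toGI
  let b' : LocalizedModule S Y →ₗ[Localization S] LocalizedModule S Y := LocalizedModule.map S b
  have hb'm : ∀ y s, b' (LocalizedModule.mk y s) = LocalizedModule.mk (b y) s := fun y s => by
    simp [b', LocalizedModule.map_mk]
  have hem : ∀ n y s, LocalizedModule.map S (e n) (LocalizedModule.mk y s) = LocalizedModule.mk (e n y) s := fun n y s => by
    simp [LocalizedModule.map_mk]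
  have him : ∀ y s, LocalizedModule.map S i (LocalizedModule.mk y s) = LocalizedModule.mk (i y) s := fun y s => by
    simp [LocalizedModule.map_mk]
  have hY' : Module.Injective (Localization S) (LocalizedModule S Y) :=
    Module.injective_of_isLocalizedModule S (LocalizedModule.mkLinearMap S Y)
  have hb' : ∀ y, b' (b' y) = 0 := fun y => by
    induction y using LocalizedModule.induction_on with
    | h m s => rw [hb'm, hb'm, hb, LocalizedModule.zero_mk]
  have key : ∀ n (y : LocalizedModule S Y), LocalizedModule.map S (e n) y = y → b' y = 0 →
      ∃ (w : Y) (s : S), e n w = w ∧ b w = 0 ∧ y = LocalizedModule.mk w s := by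
    intro n y h1 h2
    induction y using LocalizedModule.induction_on with
    | h m s =>
    rw [hb'm] at h2
    obtain ⟨t, ht⟩ : ∃ t : S, t • b m = 0 := by
      rw [← LocalizedModule.zero_mk s, LocalizedModule.mk_eq] at h2
      obtain ⟨t, ht⟩ := h2
      exact ⟨t * s, by rw [mul_smul, ht]; simp⟩
    refine ⟨e n (t • m), t * s, he _ _, ?_, ?_⟩
    · rw [hbe]
      have : b (t • m) = t • b m := map_smul b (t : R) m
      rw [this, ht, map_zero]
    · rw [← h1, hem]
      have : e n (t • m) = t • e n m := map_smul (e n) (t : R) m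
      rw [this, LocalizedModule.mk_cancel_common_left]
  refine ⟨ModuleCat.of _ (LocalizedModule S Y), b', fun n => LocalizedModule.map S (e n), LocalizedModule.map S i, hY', hb', ?_, ?_, ?_, ?_, ?_, ?_⟩
  · intro n (y : LocalizedModule S Y)
    induction y using LocalizedModule.induction_on with
    | h m s => rw [hem, hem, he]
  · intro n (y : LocalizedModule S Y)
    induction y using LocalizedModule.induction_on with
    | h m s => rw [hem, hb'm, hb'm, hem, hbe]
  · intro n (y : LocalizedModule S Y) h1 h2
    obtain ⟨w, s, hw1, hw2, rfl⟩ := key n y h1 h2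
    obtain ⟨z, rfl⟩ := hex n w hw1 hw2
    exact ⟨LocalizedModule.mk z s, hb'm z s⟩
  · intro I hI φ hφ
    let _ : Module R I := Module.compHom I (algebraMap R (Localization S))
    have : IsScalarTower R (Localization S) I := ⟨fun r a y => by
      rw [Algebra.smul_def, mul_smul]; rfl⟩
    have hOO : OO (R := R) (Y := LocalizedModule S Y) (b'.restrictScalars R) I := by
      refine OO_factor Δ (Y := Y) (b := b) hb hY hb' (inj_restrict S hY') hO ?_
        (ModuleCat.of R I) (inj_restrict S hI)
      intro T hT1 hT f hf
      have hfin : ∀ k, Module.Finite R (T k) := fun k => Module.Finite.iff_fg.mpr (hT1 k)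
      have h1 : ∀ k, ∃ (g : T k →ₗ[R] Y) (s : S), LocalizedModule.mkLinearMap S Y ∘ₗ g = s • f k := by
        intro k
        have : Module.FinitePresentation R (T k) := Module.finitePresentation_of_finite R _
        exact Module.FinitePresentation.exists_lift_of_isLocalizedModule S _ _
      choose g s hg using h1
      let σ := ∏ k ∈ Finset.range (Δ.N + 1), s k
      have h2 : ∀ k, ∃ (g : T k →ₗ[R] Y), LocalizedModule.mkLinearMap S Y ∘ₗ g = σ • f k := by
        intro k
        by_cases hk : Δ.N < k
        · refine ⟨0, ?_⟩
          ext x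
          rw [show x = 0 from Subtype.ext (Δ.hN k hk _)]; simp
        · refine ⟨(∏ j ∈ (Finset.range (Δ.N + 1)).erase k, s j) • g k, ?_⟩
          have : σ = (∏ j ∈ (Finset.range (Δ.N + 1)).erase k, s j) * s k := by
            rw [mul_comm, Finset.mul_prod_erase _ _ (by simp; omega)]
          rw [this, mul_smul, ← hg]
          ext x
          simp
      choose g' hg' using h2
      have hg'' : ∀ k x, LocalizedModule.mkLinearMap S Y (g' k x) = σ • f k x :=
        fun k x => LinearMap.congr_fun (hg' k) x
      have h3 : ∀ k, ∃ t : S, ∀ x : T k, t • (g' (k + 1) ⟨Δ.d k x, hT k x x.2⟩) = t • b (g' k x) := by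
        intro k
        let dk : T k →ₗ[R] T (k + 1) := (Δ.d k).restrict (hT k)
        obtain ⟨t, ht⟩ := Module.Finite.exists_smul_of_comp_eq_of_isLocalizedModule S
          (LocalizedModule.mkLinearMap S Y) (g' (k + 1) ∘ₗ dk) (b ∘ₗ g' k) (by
            ext x
            have e1 : f (k + 1) (dk x) = b' (f k x) := hf k x
            have e2 : LocalizedModule.mkLinearMap S Y (b (g' k x)) = 
              b' (LocalizedModule.mkLinearMap S Y (g' k x)) := (hb'm _ _).symm
            simp only [LinearMap.comp_apply]
            rw [e2, hg'', hg'', e1]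
            exact (map_smul (b'.restrictScalars R) (σ : R) _).symm)
        exact ⟨t, fun x => LinearMap.congr_fun ht x⟩
      choose t ht using h3
      let τ := ∏ k ∈ Finset.range (Δ.N + 1), t k
      have h4 : ∀ k (x : T k), τ • (g' (k + 1) ⟨Δ.d k x, hT k x x.2⟩) = τ • b (g' k x) := by
        intro k x
        by_cases hk : Δ.N < k
        · obtain rfl : x = 0 := Subtype.ext (Δ.hN k hk _)
          have : (⟨Δ.d k (0 : T k), hT k _ (0 : T k).2⟩ : T (k + 1)) = 0 := Subtype.ext (by simp)
          rw [this]; simp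
        · have : τ = (∏ j ∈ (Finset.range (Δ.N + 1)).erase k, t j) * t k := by
            rw [mul_comm, Finset.mul_prod_erase _ _ (by simp; omega)]
          rw [this, mul_smul, ht, mul_smul]
      have hunit := IsLocalization.map_units (Localization S) (τ * σ)
      let u : Y →ₗ[R] LocalizedModule S Y :=
        ((hunit.unit⁻¹.1 • (LinearMap.id : LocalizedModule S Y →ₗ[Localization S] LocalizedModule S Y)).restrictScalars R) ∘ₗ LocalizedModule.mkLinearMap S Y
      have hu : ∀ y, u y = hunit.unit⁻¹.1 • LocalizedModule.mkLinearMap S Y y := fun y => rfl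
      refine ⟨u, fun k => τ • g' k, ?_, ?_, ?_⟩
      · intro y
        rw [hu, hu]
        show _ = b' _
        rw [map_smul]
        congr 1
        exact (hb'm _ _).symm
      · intro k x
        rw [LinearMap.smul_apply, LinearMap.smul_apply, h4]
        exact (map_smul b (τ : R) _).symm
      · intro k x
        rw [hu, LinearMap.smul_apply]
        have : LocalizedModule.mkLinearMap S Y (τ • g' k x) = (τ : R) • (LocalizedModule.mkLinearMap S Y (g' k x)) :=
          map_smul _ (τ : R) _
        rw [this, hg'']
        have : (τ : R) • σ • (f k x) = algebraMap R (Localization S) (τ * σ) • f k x := by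
          rw [map_mul, mul_smul, algebraMap_smul, algebraMap_smul]; rfl
        rw [this, smul_smul, show hunit.unit⁻¹.1 * algebraMap R (Localization S) (τ * σ) = 1 from hunit.val_inv_mul, one_smul]
    obtain ⟨ψ, hψ⟩ := hOO (φ.restrictScalars R) (by
      ext x; exact LinearMap.congr_fun hφ x)
    refine ⟨ψ.extendScalarsOfIsLocalization S (Localization S), ?_⟩
    ext x
    exact LinearMap.congr_fun hψ x
  · exact LocalizedModule.map_injective S i hi
  · intro (y : LocalizedModule S Y)
    constructor
    · rintro ⟨x, rfl⟩
      induction x using LocalizedModule.induction_on with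
      | h m s => 
        obtain ⟨h1, h2⟩ := (hr _).1 ⟨m, rfl⟩
        refine ⟨?_, ?_⟩
        · show LocalizedModule.map S (e 0) _ = _
          rw [him, hem, h1]
        · rw [him, hb'm, h2, LocalizedModule.zero_mk]
    · rintro ⟨h1, h2⟩
      obtain ⟨w, s, hw1, hw2, rfl⟩ := key 0 y h1 h2
      obtain ⟨z, rfl⟩ := (hr w).2 ⟨hw1, hw2⟩
      exact ⟨LocalizedModule.mk z s, him z s⟩

theorem GI_loc [IsNoetherianRing R] (Δ : Dual R) (S : Submonoid R) {N N' : Type u} [AddCommGroup N]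
    [Module R N] [AddCommGroup N'] [Module (Localization S) N']
    (f : N →ₛₗ[algebraMap R (Localization S)] N') (hf : IsLoc S f)
    (h : IsGorensteinInjective R N) : IsGorensteinInjective (Localization S) N' := by
  let _ : Module R N' := Module.compHom N' (algebraMap R (Localization S))
  have : IsScalarTower R (Localization S) N' := ⟨fun r a y => by
    rw [Algebra.smul_def, mul_smul]; rfl⟩
  let g : N →ₗ[R] N' := { toFun := f, map_add' := map_add f, map_smul' := fun r x => f.map_smulₛₗ r x }
  have := hf.isLocalizedModule g (fun _ => rfl)
  exact GI_congr ((IsLocalizedModule.iso S g).extendScalarsOfIsLocalization S (Localization S))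
    (GI_loc' Δ S h)

end P6b
end GGP

namespace GGP
section P7a
variable {S : Type u} [CommRing S]
  {J : ℕ → Type u} [∀ i, AddCommGroup (J i)] [∀ i, Module S (J i)]
  {d : ∀ i, J i →ₗ[S] J (i + 1)}

/-- `x` is killed by the ideal `b` -/
def Kil (b : Ideal S) {I : Type u} [AddCommGroup I] [Module S I] (x : I) : Prop :=
  ∀ r ∈ b, r • x = 0

section kil
variable {I : Type u} [AddCommGroup I] [Module S I] {b b' : Ideal S} {x y : I}
lemma Kil.add (hx : Kil b x) (hy : Kil b y) : Kil b (x + y) := fun r hr => by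
  rw [smul_add, hx r hr, hy r hr, add_zero]
lemma Kil.sub (hx : Kil b x) (hy : Kil b y) : Kil b (x - y) := fun r hr => by
  rw [smul_sub, hx r hr, hy r hr, sub_zero]
lemma Kil.smul (hx : Kil b x) (s : S) : Kil b (s • x) := fun r hr => by
  rw [smul_comm, hx r hr, smul_zero]
lemma Kil.map {I' : Type u} [AddCommGroup I'] [Module S I'] (f : I →ₗ[S] I') (hx : Kil b x) :
    Kil b (f x) := fun r hr => by
  rw [← map_smul, hx r hr, map_zero]
lemma Kil.mono (hx : Kil b x) (h : b' ≤ b) : Kil b' x := fun r hr => hx r (h hr)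
lemma Kil.sup (hx : Kil b x) (h : Kil b' x) : Kil (b ⊔ b') x := by
  intro r hr
  obtain ⟨y, hy, z, hz, rfl⟩ := Submodule.mem_sup.mp hr
  rw [add_smul, hx y hy, h z hz, add_zero]
lemma Kil.span {s : S} (h : s • x = 0) : Kil (Ideal.span {s}) x := by
  intro r hr
  obtain ⟨t, rfl⟩ := Ideal.mem_span_singleton'.mp hr
  rw [mul_smul, h, smul_zero]
lemma Kil.supspan {s : S} (hx : Kil b x) (h : s • x = 0) : Kil (b ⊔ Ideal.span {s}) x :=
  hx.sup (Kil.span h)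

lemma div (hI : Module.Injective S I) (b b' : Ideal S) (s : S) (h : ∀ r, r * s ∈ b → r ∈ b')
    (u : I) (hu : Kil b' u) : ∃ g : I, Kil b g ∧ s • g = u := by
  obtain ⟨g, hg⟩ := ext_of_ker_le hI (b.mkQ ∘ₗ LinearMap.toSpanSingleton S S s)
    (LinearMap.toSpanSingleton S I u) (by
      intro r hr
      have h1 : b.mkQ (r * s) = 0 := hr
      rw [Submodule.mkQ_apply, Submodule.Quotient.mk_eq_zero] at h1
      exact hu r (h r h1))
  refine ⟨g (b.mkQ 1), ?_, ?_⟩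
  · intro r hr
    rw [← map_smul, ← map_smul]
    have : b.mkQ (r • 1) = 0 := by
      rw [Submodule.mkQ_apply, Submodule.Quotient.mk_eq_zero]; simpa using hr
    rw [this, map_zero]
  · have := LinearMap.congr_fun hg 1
    simp only [LinearMap.comp_apply, LinearMap.toSpanSingleton_apply, one_smul] at this
    rw [← this, ← map_smul, ← map_smul]; simp
end kil

/-- vanishing of `Ext^i(S/b, -)` -/
def EC (d : ∀ i, J i →ₗ[S] J (i + 1)) (b : Ideal S) (i : ℕ) : Prop :=
  ∀ f : J (i + 1), Kil b f → d (i + 1) f = 0 → ∃ g : J i, Kil b g ∧ d i g = f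

/-- vanishing of `Ext^i(N, -)` -/
def EN (d : ∀ i, J i →ₗ[S] J (i + 1)) (N : Type u) [AddCommGroup N] [Module S N] (i : ℕ) : Prop :=
  ∀ f : N →ₗ[S] J (i + 1), d (i + 1) ∘ₗ f = 0 → ∃ g : N →ₗ[S] J i, d i ∘ₗ g = f

/-- shifted injective resolution of `S` -/
structure Res (d : ∀ i, J i →ₗ[S] J (i + 1)) : Prop where
  h0 : ∀ x : J 0, x = 0
  hinj : ∀ i, Module.Injective S (J i)
  hdd : ∀ i x, d (i + 1) (d i x) = 0
  hex : ∀ i x, d (i + 2) x = 0 → ∃ y, d (i + 1) y = x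
  hunit : ∃ e : J 1, d 1 e = 0 ∧ (∀ f, d 1 f = 0 → ∃ s : S, f = s • e) ∧ ∀ s : S, s • e = 0 → s = 0

lemma EC_iff_EN {b : Ideal S} {i : ℕ} : EC d b i ↔ EN d (S ⧸ b) i := by
  constructor
  · intro h f hf
    obtain ⟨g, hg, hgf⟩ := h (f (b.mkQ 1)) (by
      intro r hr
      rw [← map_smul, ← map_smul]
      have : b.mkQ (r • 1) = 0 := by
        rw [Submodule.mkQ_apply, Submodule.Quotient.mk_eq_zero]; simpa using hr
      rw [this, map_zero]) (LinearMap.congr_fun hf _)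
    refine ⟨b.liftQ (LinearMap.toSpanSingleton S _ g) (fun r hr => hg r hr), ?_⟩
    ext
    show d i ((1 : S) • g) = _
    rw [one_smul, hgf]; rfl
  · intro h f hf hdf
    obtain ⟨g, hg⟩ := h (b.liftQ (LinearMap.toSpanSingleton S _ f) (fun r hr => hf r hr)) (by
      ext
      show d (i + 1) ((1 : S) • f) = _
      rw [one_smul, hdf]; rfl)
    refine ⟨g (b.mkQ 1), ?_, ?_⟩
    · intro r hr
      rw [← map_smul, ← map_smul]
      have : b.mkQ (r • 1) = 0 := by
        rw [Submodule.mkQ_apply, Submodule.Quotient.mk_eq_zero]; simpa using hr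
      rw [this, map_zero]
    · have := LinearMap.congr_fun hg (b.mkQ 1)
      rw [LinearMap.comp_apply] at this
      rw [this]
      show (1 : S) • f = f
      rw [one_smul]

lemma EC_top {i : ℕ} : EC d ⊤ i := fun f hf _ => ⟨0, fun r _ => smul_zero r, by
  rw [map_zero]; have := hf 1 trivial; rwa [one_smul, eq_comm] at this⟩

lemma EC_split (h : Res d) {b : Ideal S} {i : ℕ} (x : S) (b' : Ideal S) (hb' : ∀ r, r * x ∈ b ↔ r ∈ b')
    (h1 : EC d b' i) (h2 : EC d (b ⊔ Ideal.span {x}) i) : EC d b i := by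
  intro f hf hdf
  obtain ⟨g, hg, hgf⟩ := h1 (x • f) (by
    intro r hr
    rw [smul_smul]; exact hf _ ((hb' r).mpr hr)) (by rw [map_smul, hdf, smul_zero])
  obtain ⟨g', hg', hxg⟩ := div (h.hinj i) b b' x (fun r hr => (hb' r).mp hr) g hg
  obtain ⟨k, hk, hkf⟩ := h2 (f - d i g') ((hf.sub (hg'.map _)).supspan (by
    rw [smul_sub, ← map_smul, hxg, hgf, sub_self])) (by rw [map_sub, hdf, h.hdd, sub_zero])
  refine ⟨g' + k, hg'.add (hk.mono le_sup_left), by rw [map_add, hkf]; abel⟩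

/-- vanishing above the injective dimension -/
lemma EC_succ (h : Res d) {n : ℕ} (hn : Module.Injective S (LinearMap.ker (d (n + 1)))) (b : Ideal S) :
    EC d b (n + 1) := by
  intro f hf hdf
  obtain ⟨u, rfl⟩ := h.hex n f hdf
  obtain ⟨g, hg⟩ := ext_of_inj hn b.subtype Subtype.val_injective
    ((LinearMap.toSpanSingleton S _ u ∘ₗ b.subtype).codRestrict _ (by
      rintro ⟨r, hr⟩
      have := hf r hr
      rw [← map_smul] at this
      exact this))
  have hg' : ∀ r ∈ b, r • (g 1 : J (n + 1)) = r • u := by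
    intro r hr
    have := congrArg Subtype.val (LinearMap.congr_fun hg ⟨r, hr⟩)
    simp only [LinearMap.comp_apply, Submodule.subtype_apply, LinearMap.codRestrict_apply,
      LinearMap.toSpanSingleton_apply] at this
    rw [← this, ← Submodule.coe_smul, ← map_smul]; simp
  refine ⟨u - (g 1 : J (n + 1)), fun r hr => by rw [smul_sub, hg' r hr, sub_self], ?_⟩
  have : d (n + 1) (g 1 : J (n + 1)) = 0 := (g 1).2
  rw [map_sub, this, sub_zero]

lemma ker_inj_succ (h : Res d) {n : ℕ} (hn : Module.Injective S (LinearMap.ker (d (n + 1)))) :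
    Module.Injective S (LinearMap.ker (d (n + 2))) := by
  obtain ⟨r, hr⟩ := retract_of_inj hn (LinearMap.ker (d (n + 1))).subtype Subtype.val_injective
  have hr' : ∀ x (hx : d (n + 1) x = 0), (r x : J (n + 1)) = x := fun x hx =>
    congrArg Subtype.val (LinearMap.congr_fun hr ⟨x, hx⟩)
  -- section of d
  let q : J (n + 1) →ₗ[S] LinearMap.ker (d (n + 2)) := (d (n + 1)).codRestrict _ (fun x => h.hdd _ x)
  have hq : Function.Surjective q := by
    rintro ⟨x, hx⟩
    obtain ⟨y, hy⟩ := h.hex n x hx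
    exact ⟨y, Subtype.ext hy⟩
  let e := q.quotKerEquivOfSurjective hq
  have hs : ∃ s : LinearMap.ker (d (n + 2)) →ₗ[S] J (n + 1), q ∘ₗ s = LinearMap.id := by
    let s0 : (J (n + 1) ⧸ LinearMap.ker q) →ₗ[S] J (n + 1) := (LinearMap.ker q).liftQ
      (LinearMap.id - (LinearMap.ker (d (n + 1))).subtype ∘ₗ r) (by
        intro x hx
        have h1 : d (n + 1) x = 0 := congrArg Subtype.val hx
        rw [LinearMap.mem_ker, LinearMap.sub_apply, LinearMap.comp_apply, Submodule.subtype_apply, hr' x h1]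
        simp)
    refine ⟨s0 ∘ₗ e.symm.toLinearMap, ?_⟩
    ext y
    obtain ⟨x, rfl⟩ := hq y
    have : e.symm (q x) = (LinearMap.ker q).mkQ x := by rw [LinearEquiv.symm_apply_eq]; rfl
    simp only [LinearMap.comp_apply, LinearEquiv.coe_coe, this]
    have h2 : s0 ((LinearMap.ker q).mkQ x) = x - (r x : J (n + 1)) := rfl
    rw [h2]
    show d (n + 1) (x - (r x : J (n + 1))) = d (n + 1) x
    have : d (n + 1) (r x : J (n + 1)) = 0 := (r x).2
    rw [map_sub, this, sub_zero]
  obtain ⟨s, hs⟩ := hs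
  exact inj_of_retract (h.hinj (n + 1)) s q hs

lemma ker_inj_le (h : Res d) {n m : ℕ} (hnm : n ≤ m) (hn : Module.Injective S (LinearMap.ker (d (n + 1)))) :
    Module.Injective S (LinearMap.ker (d (m + 1))) := by
  induction m, hnm using Nat.le_induction with
  | base => exact hn
  | succ m _ ih => exact ker_inj_succ h ih

/-- invariant for regular sequences -/
def Inv (d : ∀ i, J i →ₗ[S] J (i + 1)) (I : Ideal S) (j : ℕ) : Prop :=
  (∀ i, i ≠ j → EC d I i) ∧ ∃ e : J (j + 1), Kil I e ∧ d (j + 1) e = 0 ∧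
    (∀ f, Kil I f → d (j + 1) f = 0 → ∃ (s : S) (g : J j), Kil I g ∧ f = s • e + d j g) ∧
    (∀ (s : S) (g : J j), Kil I g → s • e = d j g → s ∈ I)

lemma Inv_zero (h : Res d) : Inv d ⊥ 0 := by
  have hk : ∀ (i : ℕ) (x : J i), Kil (⊥ : Ideal S) x := by
    intro i x r hr
    rw [Ideal.mem_bot] at hr
    rw [hr, zero_smul]
  obtain ⟨e, he, h1, h2⟩ := h.hunit
  refine ⟨?_, e, hk _ _, he, ?_, ?_⟩
  · intro i hi f _ hf
    obtain ⟨i, rfl⟩ := Nat.exists_eq_succ_of_ne_zero hi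
    obtain ⟨y, hy⟩ := h.hex i f hf
    exact ⟨y, hk _ _, hy⟩
  · intro f _ hf
    obtain ⟨s, rfl⟩ := h1 f hf
    exact ⟨s, 0, hk _ _, by rw [map_zero, add_zero]⟩
  · intro s g _ hsg
    rw [h.h0 g, map_zero] at hsg
    rw [h2 s hsg]; exact zero_mem _

lemma Inv_succ (h : Res d) {I : Ideal S} {j : ℕ} (hI : Inv d I j) {x : S} (hx : ∀ r, r * x ∈ I → r ∈ I) :
    Inv d (I ⊔ Ideal.span {x}) (j + 1) := by
  obtain ⟨hE, e, hIe, hde, hgen, hann⟩ := hI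
  have hdiv : ∀ (i : ℕ) (u : J i), Kil I u → ∃ g : J i, Kil I g ∧ x • g = u := fun i u hu =>
    div (h.hinj i) I I x hx u hu
  have hx0 : ∀ (i : ℕ) (u : J i), Kil (I ⊔ Ideal.span {x}) u → x • u = 0 := fun i u hu =>
    hu x (le_sup_right (a := I) (Ideal.mem_span_singleton_self x))
  obtain ⟨g, hIg, hxg⟩ := hdiv _ e hIe
  refine ⟨?_, d (j + 1) g, ?_, h.hdd _ _, ?_, ?_⟩
  · intro i hi f hf hdf
    have hfI : Kil I f := hf.mono le_sup_left
    -- first write f = d u with u killed by I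
    have : ∃ u : J i, Kil I u ∧ d i u = f := by
      by_cases hij : i = j
      · subst hij
        obtain ⟨s, u, hu, hfu⟩ := hgen f hfI hdf
        have h1 := hx0 _ f hf
        rw [hfu, smul_add, smul_smul, ← map_smul] at h1
        have h2 := hann (x * s) (-(x • u)) (by
          have := (hu.smul x).sub (hu.smul x |>.add (hu.smul x))
          simpa using this) (by
            rw [map_neg]; exact eq_neg_of_add_eq_zero_left h1)
        have h3 := hx s (by rwa [mul_comm])
        refine ⟨u, hu, ?_⟩
        rw [hfu, hIe s h3, zero_add]
      · exact hE i hij f hfI hdf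
    obtain ⟨u, hu, rfl⟩ := this
    cases i with
    | zero => exact ⟨0, fun r _ => smul_zero r, by rw [h.h0 u]⟩
    | succ i =>
      have hij : i ≠ j := fun h => hi (by rw [h])
      obtain ⟨v, hv, hvu⟩ := hE i hij (x • u) (hu.smul x) (by
        rw [map_smul]; exact hx0 _ _ hf)
      obtain ⟨v', hv', hxv⟩ := hdiv i v hv
      refine ⟨u - d i v', (hu.sub (hv'.map _)).supspan ?_, ?_⟩
      · rw [smul_sub, ← map_smul, hxv, hvu, sub_self]
      · rw [map_sub, h.hdd, sub_zero]
  · refine (hIg.map _).supspan ?_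
    rw [← map_smul, hxg, hde]
  · intro f hf hdf
    obtain ⟨u, hu, rfl⟩ := hE (j + 1) (by omega) f (hf.mono le_sup_left) hdf
    obtain ⟨s, v, hv, hxu⟩ := hgen (x • u) (hu.smul x) (by rw [map_smul]; exact hx0 _ _ hf)
    obtain ⟨v', hv', hxv⟩ := hdiv j v hv
    refine ⟨s, u - s • g - d j v', ((hu.sub (hIg.smul s)).sub (hv'.map _)).supspan ?_, ?_⟩
    · rw [smul_sub, smul_sub, ← map_smul, hxv, hxu, smul_comm x s g, hxg]; abel
    · rw [map_sub, map_sub, h.hdd, map_smul]; abel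
  · intro s w hw hsw
    obtain ⟨s', v, hv, hsv⟩ := hgen (s • g - w) ((hIg.smul s).sub (hw.mono le_sup_left))
      (by rw [map_sub, map_smul, hsw, sub_self])
    have h1 := congrArg (x • ·) hsv
    simp only [smul_sub, smul_add, hx0 _ _ hw, smul_comm x s g, hxg, smul_smul, sub_zero] at h1
    have := hann (s - x * s') (x • v) (hv.smul x) (by
      rw [sub_smul, h1, map_smul]; abel)
    have h2 : s = (s - x * s') + x * s' := by ring
    rw [h2]
    exact add_mem (le_sup_left (a := I) this)
      (le_sup_right (a := I) (Ideal.mul_mem_right _ _ (Ideal.mem_span_singleton_self x)))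

end P7a
end GGP

namespace GGP
section P7b
variable {S : Type u} [CommRing S]
  {J : ℕ → Type u} [∀ i, AddCommGroup (J i)] [∀ i, Module S (J i)]
  {d : ∀ i, J i →ₗ[S] J (i + 1)}

/-- descend a map along a surjection -/
lemma desc {P N I : Type u} [AddCommGroup P] [Module S P] [AddCommGroup N] [Module S N]
    [AddCommGroup I] [Module S I] (π : P →ₗ[S] N) (hπ : Function.Surjective π) (g : P →ₗ[S] I)
    (h : ∀ x, π x = 0 → g x = 0) : ∃ g' : N →ₗ[S] I, ∀ x, g' (π x) = g x := by
  let e := π.quotKerEquivOfSurjective hπ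
  refine ⟨(LinearMap.ker π).liftQ g (fun x hx => h x hx) ∘ₗ e.symm.toLinearMap, fun x => ?_⟩
  have : e.symm (π x) = (LinearMap.ker π).mkQ x := by rw [LinearEquiv.symm_apply_eq]; rfl
  rw [LinearMap.comp_apply, LinearEquiv.coe_coe, this]; rfl

lemma EN_pi {T : Type u} [AddCommGroup T] [Module S T] {i : ℕ} (h : EN d T i) (m : ℕ) :
    EN d (Fin m → T) i := by
  classical
  intro f hf
  have : ∀ j : Fin m, ∃ g : T →ₗ[S] J i, d i ∘ₗ g = f ∘ₗ LinearMap.single S (fun _ => T) j := by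
    intro j
    refine h _ ?_
    rw [← LinearMap.comp_assoc, hf, LinearMap.zero_comp]
  choose g hg using this
  refine ⟨LinearMap.lsum S (fun _ => T) S g, ?_⟩
  apply LinearMap.pi_ext'
  intro j
  rw [← hg]
  ext x
  simp only [LinearMap.lsum_apply, LinearMap.comp_apply, LinearMap.sum_apply, map_sum,
    LinearMap.proj_apply, LinearMap.single_apply]
  rw [Finset.sum_eq_single j]
  · rw [Pi.single_eq_same]
  · intro k _ hk
    rw [Pi.single_eq_of_ne hk, map_zero, map_zero]
  · simp

lemma EN_shift (h : Res d) {P N : Type u} [AddCommGroup P] [Module S P] [AddCommGroup N] [Module S N]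
    (π : P →ₗ[S] N) (hπ : Function.Surjective π) {i : ℕ} (hP : EN d P (i + 1))
    (hK : EN d (LinearMap.ker π) i) : EN d N (i + 1) := by
  intro f hf
  obtain ⟨g, hg⟩ := hP (f ∘ₗ π) (by rw [← LinearMap.comp_assoc, hf, LinearMap.zero_comp])
  have hg' : ∀ x, d (i + 1) (g x) = f (π x) := LinearMap.congr_fun hg
  obtain ⟨k, hk⟩ := hK (g ∘ₗ (LinearMap.ker π).subtype) (by
    ext ⟨x, hx⟩
    show d (i + 1) (g x) = 0
    rw [hg', LinearMap.mem_ker.mp hx, map_zero])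
  obtain ⟨k', hk'⟩ := ext_of_inj (h.hinj i) (LinearMap.ker π).subtype Subtype.val_injective k
  obtain ⟨g', hg''⟩ := desc π hπ (g - d i ∘ₗ k') (by
    intro x hx
    have h1 := LinearMap.congr_fun hk' ⟨x, hx⟩
    have h2 := LinearMap.congr_fun hk ⟨x, hx⟩
    simp only [LinearMap.comp_apply, Submodule.subtype_apply] at h1 h2
    rw [LinearMap.sub_apply, LinearMap.comp_apply, h1, h2, sub_self])
  refine ⟨g', ?_⟩
  ext y
  obtain ⟨x, rfl⟩ := hπ y
  rw [LinearMap.comp_apply, hg'', LinearMap.sub_apply, LinearMap.comp_apply, map_sub, h.hdd, hg', sub_zero]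

lemma EN_zero (h : Res d) {P N : Type u} [AddCommGroup P] [Module S P] [AddCommGroup N] [Module S N]
    (π : P →ₗ[S] N) (hπ : Function.Surjective π) (hP : EN d P 0) : EN d N 0 := by
  intro f hf
  obtain ⟨g, hg⟩ := hP (f ∘ₗ π) (by rw [← LinearMap.comp_assoc, hf, LinearMap.zero_comp])
  refine ⟨0, ?_⟩
  ext y
  obtain ⟨x, rfl⟩ := hπ y
  have := LinearMap.congr_fun hg x
  rw [LinearMap.comp_apply, LinearMap.comp_apply, h.h0 (g x), map_zero] at this
  rw [← this]; simp

lemma cover_of_kil {I : Ideal S} {N : Type u} [AddCommGroup N] [Module S N] [Module.Finite S N]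
    (hN : ∀ r ∈ I, ∀ x : N, r • x = 0) :
    ∃ (m : ℕ) (π : (Fin m → S ⧸ I) →ₗ[S] N), Function.Surjective π := by
  classical
  obtain ⟨m, v, hv⟩ := Module.Finite.exists_fin (R := S) (M := N)
  let l : Fin m → (S ⧸ I) →ₗ[S] N := fun j =>
    Submodule.liftQ I (LinearMap.toSpanSingleton S N (v j)) (fun r hr => hN r hr _)
  refine ⟨m, LinearMap.lsum S (fun _ => S ⧸ I) S l, ?_⟩
  rw [← LinearMap.range_eq_top, eq_top_iff, ← hv, Submodule.span_le]
  rintro _ ⟨j, rfl⟩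
  refine ⟨Pi.single j (Submodule.mkQ I 1), ?_⟩
  rw [LinearMap.lsum_apply, LinearMap.sum_apply, Finset.sum_eq_single j]
  · simp only [LinearMap.comp_apply, LinearMap.proj_apply, Pi.single_eq_same]
    show (1 : S) • v j = v j
    rw [one_smul]
  · intro k _ hk
    simp [Pi.single_eq_of_ne hk]
  · simp

lemma EN_low [IsNoetherianRing S] (h : Res d) {I : Ideal S} {t : ℕ} (hI : ∀ i < t, EC d I i) :
    ∀ i < t, ∀ (N : Type u) [AddCommGroup N] [Module S N] [Module.Finite S N],
      (∀ r ∈ I, ∀ x : N, r • x = 0) → EN d N i := by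
  intro i
  induction i with
  | zero =>
    intro hi N _ _ _ hN
    obtain ⟨m, π, hπ⟩ := cover_of_kil hN
    exact EN_zero h π hπ (EN_pi (EC_iff_EN.mp (hI 0 hi)) m)
  | succ i ih =>
    intro hi N _ _ _ hN
    obtain ⟨m, π, hπ⟩ := cover_of_kil hN
    have : IsNoetherian S (Fin m → S ⧸ I) := inferInstance
    refine EN_shift h π hπ (EN_pi (EC_iff_EN.mp (hI _ hi)) m) (ih (by omega) _ ?_)
    rintro r hr ⟨x, hx⟩
    ext j
    obtain ⟨y, hy⟩ := Submodule.mkQ_surjective I (x j)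
    show r • x j = 0
    rw [← hy, ← map_smul, Submodule.mkQ_apply, Submodule.Quotient.mk_eq_zero]
    exact Ideal.mul_mem_right _ _ hr

/-- finite generation of `Ext^i(N,-)` -/
def FGN (d : ∀ i, J i →ₗ[S] J (i + 1)) (N : Type u) [AddCommGroup N] [Module S N] (i : ℕ) : Prop :=
  ∃ (m : ℕ) (c : Fin m → (N →ₗ[S] J (i + 1))), (∀ j, d (i + 1) ∘ₗ c j = 0) ∧
    ∀ f : N →ₗ[S] J (i + 1), d (i + 1) ∘ₗ f = 0 → ∃ (r : Fin m → S) (g : N →ₗ[S] J i),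
      f = ∑ j, r j • c j + d i ∘ₗ g

lemma FGN_all [IsNoetherianRing S] (h : Res d) : ∀ (i : ℕ) (N : Type u) [AddCommGroup N] [Module S N]
    [Module.Finite S N], FGN d N i := by
  intro i
  induction i with
  | zero =>
    intro N _ _ _
    obtain ⟨e, he, h1, h2⟩ := h.hunit
    have hfin : Module.Finite S (N →ₗ[S] S) := inferInstance
    obtain ⟨m, v, hv⟩ := Module.Finite.exists_fin (R := S) (M := N →ₗ[S] S)
    refine ⟨m, fun j => LinearMap.toSpanSingleton S _ e ∘ₗ v j, ?_, ?_⟩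
    · intro j
      ext x
      show d 1 (v j x • e) = 0
      rw [map_smul, he, smul_zero]
    · intro f hf
      have hf' : ∀ x, d 1 (f x) = 0 := LinearMap.congr_fun hf
      choose s hs using fun x => h1 (f x) (hf' x)
      let φ : N →ₗ[S] S :=
        { toFun := s
          map_add' := fun x y => by
            rw [← sub_eq_zero]; apply h2
            rw [sub_smul, add_smul, ← hs, ← hs, ← hs, map_add, sub_self]
          map_smul' := fun r x => by
            rw [← sub_eq_zero]; apply h2
            rw [sub_smul, ← hs, map_smul, RingHom.id_apply, smul_eq_mul, mul_smul, ← hs, sub_self] }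
      have : φ ∈ Submodule.span S (Set.range v) := by rw [hv]; trivial
      obtain ⟨r, hr⟩ := (Submodule.mem_span_range_iff_exists_fun S).mp this
      refine ⟨r, 0, ?_⟩
      ext x
      have h3 := LinearMap.congr_fun hr x
      rw [LinearMap.sum_apply] at h3
      rw [LinearMap.add_apply, LinearMap.comp_zero, LinearMap.zero_apply, add_zero, LinearMap.sum_apply,
        hs x]
      show φ x • e = _
      rw [← h3, Finset.sum_smul]
      refine Finset.sum_congr rfl fun j _ => ?_
      simp [mul_smul]
  | succ i ih =>
    intro N _ _ _
    obtain ⟨M, π, hπ⟩ := Module.Finite.exists_fin' S N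
    obtain ⟨m, c, hc, hgen⟩ := ih (LinearMap.ker π)
    choose c' hc' using fun j => ext_of_inj (h.hinj (i + 1)) (LinearMap.ker π).subtype
      Subtype.val_injective (c j)
    have hc'' : ∀ j x (hx : x ∈ LinearMap.ker π), c' j x = c j ⟨x, hx⟩ := fun j x hx =>
      LinearMap.congr_fun (hc' j) ⟨x, hx⟩
    have : ∀ j, ∃ k : N →ₗ[S] J (i + 2), ∀ x, k (π x) = (d (i + 1) ∘ₗ c' j) x := by
      intro j
      apply desc π hπ
      intro x hx
      rw [LinearMap.comp_apply, hc'' j x hx]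
      exact LinearMap.congr_fun (hc j) _
    choose k hk using this
    refine ⟨m, k, ?_, ?_⟩
    · intro j
      ext y
      obtain ⟨x, rfl⟩ := hπ y
      rw [LinearMap.comp_apply, hk, LinearMap.comp_apply, h.hdd]; rfl
    · intro f hf
      have hP : EN d (Fin M → S) (i + 1) := by
        apply EN_pi
        intro f hf
        obtain ⟨y, hy⟩ := h.hex i (f 1) (LinearMap.congr_fun hf 1)
        refine ⟨LinearMap.toSpanSingleton S _ y, ?_⟩
        ext
        simp [hy]
      obtain ⟨g, hg⟩ := hP (f ∘ₗ π) (by rw [← LinearMap.comp_assoc, hf, LinearMap.zero_comp])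
      have hg' : ∀ x, d (i + 1) (g x) = f (π x) := LinearMap.congr_fun hg
      obtain ⟨r, l, hl⟩ := hgen (g ∘ₗ (LinearMap.ker π).subtype) (by
        ext ⟨x, hx⟩
        show d (i + 1) (g x) = 0
        rw [hg', LinearMap.mem_ker.mp hx, map_zero])
      obtain ⟨l', hl'⟩ := ext_of_inj (h.hinj i) (LinearMap.ker π).subtype Subtype.val_injective l
      obtain ⟨g', hg''⟩ := desc π hπ (g - ∑ j, r j • c' j - d i ∘ₗ l') (by
        intro x hx
        have h1 := LinearMap.congr_fun hl' ⟨x, hx⟩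
        have h2 := LinearMap.congr_fun hl ⟨x, hx⟩
        simp only [LinearMap.comp_apply, Submodule.subtype_apply, LinearMap.add_apply, LinearMap.sum_apply,
          LinearMap.smul_apply] at h1 h2
        simp only [LinearMap.sub_apply, LinearMap.comp_apply, LinearMap.sum_apply, LinearMap.smul_apply,
          h1, h2, hc'' _ x hx]
        abel)
      refine ⟨r, g', ?_⟩
      ext y
      obtain ⟨x, rfl⟩ := hπ y
      simp only [LinearMap.add_apply, LinearMap.comp_apply, LinearMap.sum_apply, LinearMap.smul_apply,
        hg'', LinearMap.sub_apply, map_sub, h.hdd, hg', hk, map_sum, map_smul]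
      abel

lemma FG_EC [IsNoetherianRing S] (h : Res d) (b : Ideal S) (i : ℕ) :
    ∃ (m : ℕ) (c : Fin m → J (i + 1)), (∀ j, Kil b (c j) ∧ d (i + 1) (c j) = 0) ∧
      ∀ f, Kil b f → d (i + 1) f = 0 → ∃ (r : Fin m → S) (g : J i), Kil b g ∧
        f = ∑ j, r j • c j + d i g := by
  have hk : ∀ {I : Type u} [AddCommGroup I] [Module S I] (g : (S ⧸ b) →ₗ[S] I), Kil b (g (b.mkQ 1)) := by
    intro I _ _ g r hr
    rw [← map_smul, ← map_smul]
    have : b.mkQ (r • 1) = 0 := by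
      rw [Submodule.mkQ_apply, Submodule.Quotient.mk_eq_zero]; simpa using hr
    rw [this, map_zero]
  obtain ⟨m, c, hc, hgen⟩ := FGN_all h i (S ⧸ b)
  refine ⟨m, fun j => c j (b.mkQ 1), fun j => ⟨hk _, LinearMap.congr_fun (hc j) _⟩, ?_⟩
  intro f hf hdf
  obtain ⟨r, g, hg⟩ := hgen (b.liftQ (LinearMap.toSpanSingleton S _ f) (fun r hr => hf r hr)) (by
      ext
      show d (i + 1) ((1 : S) • f) = _
      rw [one_smul, hdf]; rfl)
  refine ⟨r, g (b.mkQ 1), hk _, ?_⟩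
  have := LinearMap.congr_fun hg (b.mkQ 1)
  simp only [LinearMap.add_apply, LinearMap.sum_apply, LinearMap.smul_apply, LinearMap.comp_apply] at this
  rw [← this]
  show f = (1 : S) • f
  rw [one_smul]

end P7b
end GGP

namespace GGP
section P7c
open RingTheory.Sequence
variable {S : Type u} [CommRing S]
  {J : ℕ → Type u} [∀ i, AddCommGroup (J i)] [∀ i, Module S (J i)]
  {d : ∀ i, J i →ₗ[S] J (i + 1)}

lemma inj_of_EC (h : Res d) {n : ℕ} (hE : ∀ b, EC d b n) : Module.Injective S (LinearMap.ker (d n)) := by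
  rw [← Module.Baer.iff_injective]
  intro b f
  obtain ⟨g, hg⟩ := ext_of_inj (h.hinj n) b.subtype Subtype.val_injective
    ((LinearMap.ker (d n)).subtype ∘ₗ f)
  have hg' : ∀ r (hr : r ∈ b), r • g 1 = f ⟨r, hr⟩ := by
    intro r hr
    have := LinearMap.congr_fun hg ⟨r, hr⟩
    simp only [LinearMap.comp_apply, Submodule.subtype_apply] at this
    rw [← this, ← map_smul]; simp
  obtain ⟨v, hv, hdv⟩ := hE b (d n (g 1)) (by
    intro r hr
    rw [← map_smul, hg' r hr]
    exact (f ⟨r, hr⟩).2) (h.hdd _ _)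
  refine ⟨LinearMap.toSpanSingleton S _ ⟨g 1 - v, by rw [LinearMap.mem_ker, map_sub, hdv, sub_self]⟩, ?_⟩
  intro r hr
  ext
  show r • (g 1 - v) = _
  rw [smul_sub, hv r hr, sub_zero, hg' r hr]

lemma EC_induct [IsNoetherianRing S] (h : Res d) {i : ℕ} (P : Ideal S → Prop)
    (hP : ∀ b b', P b → b ≤ b' → P b')
    (hp : ∀ p : Ideal S, p.IsPrime → P p → (∀ b, p < b → EC d b i) → EC d p i) :
    ∀ b, P b → EC d b i := by
  intro b
  induction b using WellFoundedGT.induction with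
  | ind b ih =>
    intro hb
    by_cases hpr : b.IsPrime
    · exact hp b hpr hb (fun b' hb' => ih b' hb' (hP b b' hb hb'.le))
    · by_cases htop : b = ⊤
      · rw [htop]; exact EC_top
      · rw [Ideal.isPrime_iff] at hpr
        push Not at hpr
        obtain ⟨y, x, hyx, hy, hx⟩ := hpr htop
        let b' : Ideal S := b.colon (Ideal.span {x})
        have hb' : ∀ r, r * x ∈ b ↔ r ∈ b' := by
          intro r
          rw [Ideal.mem_colon_span_singleton]
        have hle : b ≤ b' := fun r hr => (hb' r).mp (Ideal.mul_mem_right _ _ hr)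
        refine EC_split h x b' hb' (ih b' ?_ (hP _ _ hb hle)) (ih _ ?_ (hP _ _ hb le_sup_left))
        · exact lt_of_le_of_ne hle (fun he => hy (by rw [he]; exact (hb' y).mp hyx))
        · refine lt_of_le_of_ne le_sup_left (fun he => hx ?_)
          rw [he]; exact le_sup_right (a := b) (Ideal.mem_span_singleton_self x)

lemma nak [IsLocalRing S] [IsNoetherianRing S] (h : Res d) {n : ℕ}
    (h1 : EC d (IsLocalRing.maximalIdeal S) n) (h2 : ∀ b, EC d b (n + 1)) : ∀ b, EC d b n := by
  intro b
  refine EC_induct h (fun _ => True) (fun _ _ _ _ => trivial) ?_ b trivial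
  intro p hp _ _
  by_cases hpm : p = IsLocalRing.maximalIdeal S
  · rw [hpm]; exact h1
  have hle := IsLocalRing.le_maximalIdeal hp.ne_top
  obtain ⟨x, hxm, hxp⟩ := SetLike.exists_of_lt (lt_of_le_of_ne hle hpm)
  have hx : ∀ r, r * x ∈ p → r ∈ p := fun r hr => (hp.mem_or_mem hr).resolve_right hxp
  obtain ⟨m, c, hc, hgen⟩ := FG_EC h p n
  let B : Submodule S (J (n + 1)) :=
    { carrier := {f | ∃ g : J n, Kil p g ∧ d n g = f}
      add_mem' := by
        rintro _ _ ⟨g, hg, rfl⟩ ⟨g', hg', rfl⟩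
        exact ⟨g + g', hg.add hg', map_add _ _ _⟩
      zero_mem' := ⟨0, fun r _ => smul_zero r, map_zero _⟩
      smul_mem' := by
        rintro s _ ⟨g, hg, rfl⟩
        exact ⟨s • g, hg.smul s, map_smul _ _ _⟩ }
  let N : Submodule S (J (n + 1)) := Submodule.span S (Set.range c)
  have hZ : ∀ f, Kil p f → d (n + 1) f = 0 → f ∈ N ⊔ B := by
    intro f hf hdf
    obtain ⟨r, g, hg, rfl⟩ := hgen f hf hdf
    refine Submodule.add_mem_sup (Submodule.sum_mem _ fun j _ => Submodule.smul_mem _ _ ?_) ⟨g, hg, rfl⟩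
    exact Submodule.subset_span ⟨j, rfl⟩
  have hNB : N ≤ B := by
    refine Submodule.le_of_le_smul_of_le_jacobson_bot (I := IsLocalRing.maximalIdeal S)
      (Submodule.fg_span (Set.finite_range c)) ?_ ?_
    · rw [IsLocalRing.jacobson_eq_maximalIdeal _ bot_ne_top]
    · rw [Submodule.span_le]
      rintro _ ⟨j, rfl⟩
      obtain ⟨f', hf', hxf⟩ := div (h.hinj _) p p x hx (c j) (hc j).1
      obtain ⟨w, hw, hdw⟩ := h2 (p ⊔ Ideal.span {x}) (d (n + 1) f') ((hf'.map _).supspan (by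
        rw [← map_smul, hxf, (hc j).2])) (h.hdd _ _)
      have := hZ (f' - w) (hf'.sub (hw.mono le_sup_left)) (by rw [map_sub, hdw, sub_self])
      obtain ⟨a, ha, b', hb', hab⟩ := Submodule.mem_sup.mp this
      have hxw : x • w = 0 := hw x (le_sup_right (a := p) (Ideal.mem_span_singleton_self x))
      have : c j = x • b' + x • a := by
        rw [← smul_add, add_comm b' a, hab, smul_sub, hxw, sub_zero, hxf]
      rw [this]
      exact Submodule.add_mem_sup (Submodule.smul_mem _ _ hb') (Submodule.smul_mem_smul hxm ha)
  intro f hf hdf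
  have := hZ f hf hdf
  rw [sup_eq_right.mpr hNB] at this
  exact this

lemma regseq_max [IsLocalRing S] [IsNoetherianRing S] (h : Res d) {n : ℕ}
    (hn : Module.Injective S (LinearMap.ker (d (n + 1)))) :
    ∃ (t : ℕ) (I : Ideal S), Inv d I t ∧ (t : WithBot ℕ∞) ≤ ringKrullDim S ∧
      I ≤ IsLocalRing.maximalIdeal S ∧ ∃ z, z ∉ I ∧ ∀ r ∈ IsLocalRing.maximalIdeal S, r * z ∈ I := by
  let P : ℕ → Prop := fun j => ∃ rs : List S, rs.length = j ∧ (∀ r ∈ rs, r ∈ IsLocalRing.maximalIdeal S) ∧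
    IsWeaklyRegular S rs ∧ Inv d (Ideal.ofList rs) j
  have hle : ∀ rs : List S, (∀ r ∈ rs, r ∈ IsLocalRing.maximalIdeal S) →
      Ideal.ofList rs ≤ IsLocalRing.maximalIdeal S := fun rs hrs => Ideal.span_le.mpr hrs
  have hP0 : P 0 := ⟨[], rfl, by simp, IsWeaklyRegular.nil S S, by
    rw [Ideal.ofList_nil]; exact Inv_zero h⟩
  have hPn : ∀ j, P j → j ≤ n := by
    rintro j ⟨rs, hl, hm, hr, hE, e, he, hde, hgen, hann⟩
    by_contra hj
    obtain ⟨k, rfl⟩ : ∃ k, j = k + 1 := ⟨j - 1, by omega⟩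
    obtain ⟨g, hg, hge⟩ := EC_succ h (ker_inj_le h (show n ≤ k by omega) hn) (Ideal.ofList rs) e he hde
    have := hle rs hm (hann 1 g hg (by rw [one_smul, hge]))
    exact (Ideal.ne_top_iff_one _).mp (IsLocalRing.maximalIdeal.isMaximal S).ne_top this
  have : ∃ t, P t ∧ ¬ P (t + 1) := by
    by_contra hcon
    push Not at hcon
    have : ∀ t, P t := fun t => Nat.rec hP0 (fun k hk => hcon k hk) t
    have := hPn _ (this (n + 1))
    omega
  obtain ⟨t, ⟨rs, hl, hm, hr, hI⟩, hnot⟩ := this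
  refine ⟨t, Ideal.ofList rs, hI, ?_, hle rs hm, ?_⟩
  · have hreg := (IsLocalRing.isRegular_iff_isWeaklyRegular_of_subset_maximalIdeal hm).mpr hr
    rw [← ringKrullDim_add_length_eq_ringKrullDim_of_isRegular rs hreg, hl]
    have : Nontrivial (S ⧸ Ideal.ofList rs) := Ideal.Quotient.nontrivial_iff.mpr
      (fun he => (IsLocalRing.maximalIdeal.isMaximal S).ne_top (top_le_iff.mp (he ▸ hle rs hm)))
    have := ringKrullDim_nonneg_of_nontrivial (R := S ⧸ Ideal.ofList rs)
    calc (t : WithBot ℕ∞) = 0 + t := (zero_add _).symm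
      _ ≤ _ := by gcongr
  · by_contra hcon
    push Not at hcon
    apply hnot
    have hsub : Subsingleton ((S ⧸ IsLocalRing.maximalIdeal S) →ₗ[S] (S ⧸ Ideal.ofList rs)) := by
      refine ⟨fun f g => ?_⟩
      suffices ∀ f : (S ⧸ IsLocalRing.maximalIdeal S) →ₗ[S] (S ⧸ Ideal.ofList rs), f = 0 by
        rw [this f, this g]
      intro f
      obtain ⟨z, hz⟩ := Submodule.mkQ_surjective _ (f (Submodule.mkQ _ 1))
      have hz0 : z ∈ Ideal.ofList rs := by
        by_contra hzn
        obtain ⟨r, hr, hrz⟩ := hcon z hzn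
        apply hrz
        rw [← smul_eq_mul, ← Submodule.Quotient.mk_eq_zero (p := Ideal.ofList rs), ← Submodule.mkQ_apply,
          map_smul, hz, ← map_smul, ← map_smul]
        have : (Submodule.mkQ (IsLocalRing.maximalIdeal S)) (r • 1) = 0 := by
          rw [Submodule.mkQ_apply, Submodule.Quotient.mk_eq_zero]; simpa using hr
        rw [this, map_zero]
      ext
      have h3 : (Submodule.mkQ (Ideal.ofList rs)) z = 0 := by
        rw [Submodule.mkQ_apply, Submodule.Quotient.mk_eq_zero]; exact hz0
      rw [h3] at hz
      exact hz.symm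
    obtain ⟨x, hx, hreg⟩ := IsSMulRegular.subsingleton_linearMap_iff.mp hsub
    rw [Ideal.annihilator_quotient] at hx
    have hx' : ∀ r, r * x ∈ Ideal.ofList rs → r ∈ Ideal.ofList rs := by
      intro r hr
      have : x • (Submodule.mkQ (Ideal.ofList rs)) r = x • 0 := by
        rw [smul_zero, ← map_smul, Submodule.mkQ_apply, Submodule.Quotient.mk_eq_zero, smul_eq_mul, mul_comm]
        exact hr
      have := hreg this
      rwa [Submodule.mkQ_apply, Submodule.Quotient.mk_eq_zero] at this
    refine ⟨rs ++ [x], by simp [hl], ?_, ?_, ?_⟩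
    · intro r hr
      rw [List.mem_append, List.mem_singleton] at hr
      rcases hr with hr | rfl
      exacts [hm r hr, hx]
    · rw [isWeaklyRegular_append_iff, isWeaklyRegular_singleton_iff]
      refine ⟨hr, ?_⟩
      have : (Ideal.ofList rs • ⊤ : Submodule S S) = Ideal.ofList rs := by simp
      rw [this]; exact hreg
    · rw [Ideal.ofList_append, Ideal.ofList_singleton]
      exact Inv_succ h hI hx'

theorem bass [IsLocalRing S] [IsNoetherianRing S] (h : Res d)
    (hn : ∃ n, Module.Injective S (LinearMap.ker (d (n + 1)))) :
    ∃ n : ℕ, (n : WithBot ℕ∞) ≤ ringKrullDim S ∧ Module.Injective S (LinearMap.ker (d (n + 1))) ∧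
      ¬ EC d (IsLocalRing.maximalIdeal S) n ∧
      ∀ i < n, ∀ k : ℕ, EC d (IsLocalRing.maximalIdeal S ^ k) i := by
  classical
  let n := Nat.find hn
  have hinj : Module.Injective S (LinearMap.ker (d (n + 1))) := Nat.find_spec hn
  have hE : ¬ EC d (IsLocalRing.maximalIdeal S) n := by
    intro hE
    have hall := nak h hE (EC_succ h hinj)
    rcases Nat.eq_zero_or_pos n with h0 | hpos
    · rw [h0] at hall
      obtain ⟨e, he, h1, h2⟩ := h.hunit
      obtain ⟨g, _, hg⟩ := hall ⊥ e (by
        intro r hr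
        rw [Ideal.mem_bot] at hr
        rw [hr, zero_smul]) he
      rw [h.h0 g, map_zero] at hg
      exact one_ne_zero (h2 1 (by rw [← hg, smul_zero]))
    · have h3 := inj_of_EC h hall
      obtain ⟨k, hk⟩ : ∃ k, n = k + 1 := ⟨n - 1, by omega⟩
      rw [hk] at h3
      exact Nat.find_min hn (m := k) (show k < n by omega) h3
  obtain ⟨t, I, hI, ht, hIm, z, hzI, hz⟩ := regseq_max h hinj
  have hnt : n = t := by
    by_contra hne
    apply hE
    intro w hw hdw
    obtain ⟨u, hu, hzu⟩ := div (h.hinj _) I (IsLocalRing.maximalIdeal S) z (fun r hr => by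
      by_contra hrm
      have : IsUnit r := by simpa using hrm
      obtain ⟨v, rfl⟩ := this
      apply hzI
      have := Ideal.mul_mem_left I (↑v⁻¹ : S) hr
      rwa [← mul_assoc, Units.inv_mul, one_mul] at this) w hw
    obtain ⟨v, hv, hdv⟩ := EC_succ h hinj (I ⊔ Ideal.span {z}) (d (n + 1) u) ((hu.map _).supspan (by
      rw [← map_smul, hzu, hdw])) (h.hdd _ _)
    obtain ⟨g, hg, hgu⟩ := hI.1 n hne (u - v) (hu.sub (hv.mono le_sup_left))
      (by rw [map_sub, hdv, sub_self])
    refine ⟨z • g, ?_, ?_⟩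
    · intro r hr
      rw [smul_smul]; exact hg _ (hz r hr)
    · rw [map_smul, hgu, smul_sub, hzu, hv z (le_sup_right (a := I) (Ideal.mem_span_singleton_self z)),
        sub_zero]
  rw [← hnt] at hI ht
  refine ⟨n, ht, hinj, hE, ?_⟩
  intro i hi k
  have hm : EC d (IsLocalRing.maximalIdeal S) i := by
    rw [EC_iff_EN]
    refine EN_low h (I := I) (t := n) (fun i hi => hI.1 i hi.ne) i hi _ ?_
    intro r hr x
    obtain ⟨y, rfl⟩ := Submodule.mkQ_surjective _ x
    rw [← map_smul, Submodule.mkQ_apply, Submodule.Quotient.mk_eq_zero]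
    exact Ideal.mul_mem_right _ _ (hIm hr)
  refine EC_induct h (fun b => ∃ k, IsLocalRing.maximalIdeal S ^ k ≤ b) ?_ ?_ _ ⟨k, le_rfl⟩
  · rintro b b' ⟨k, hk⟩ hb
    exact ⟨k, hk.trans hb⟩
  · rintro p hp ⟨k, hk⟩ _
    have : p = IsLocalRing.maximalIdeal S :=
      le_antisymm (IsLocalRing.le_maximalIdeal hp.ne_top) (hp.le_of_pow_le hk)
    rw [this]; exact hm

end P7c
end GGP

namespace GGP
section P7d
variable {S : Type u} [CommRing S]

lemma range_sec {A B : Type u} [AddCommGroup A] [Module S A] [AddCommGroup B] [Module S B]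
    (f : A →ₗ[S] B) (hk : Module.Injective S (LinearMap.ker f)) :
    ∃ σ : LinearMap.range f →ₗ[S] A, ∀ b, f (σ b) = b := by
  obtain ⟨r, hr⟩ := retract_of_inj hk (LinearMap.ker f).subtype (Submodule.subtype_injective _)
  let e : A →ₗ[S] A := LinearMap.id - (LinearMap.ker f).subtype ∘ₗ r
  have he : LinearMap.ker f ≤ LinearMap.ker e := by
    intro x hx
    have := LinearMap.congr_fun hr ⟨x, hx⟩
    have h2 : r x = ⟨x, hx⟩ := this
    show x - ((r x : LinearMap.ker f) : A) = 0
    rw [h2, sub_self]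
  refine ⟨(Submodule.liftQ (LinearMap.ker f) e he) ∘ₗ f.quotKerEquivRange.symm.toLinearMap, ?_⟩
  rintro ⟨_, a, rfl⟩
  have h1 : f.quotKerEquivRange.symm ⟨f a, a, rfl⟩ = (LinearMap.ker f).mkQ a := by
    rw [LinearEquiv.symm_apply_eq]; rfl
  rw [LinearMap.comp_apply, LinearEquiv.coe_coe, h1]
  show f (a - ((r a : LinearMap.ker f) : A)) = f a
  rw [map_sub, LinearMap.mem_ker.mp (r a).2, sub_zero]

lemma inj_range {A B : Type u} [AddCommGroup A] [Module S A] [AddCommGroup B] [Module S B]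
    (f : A →ₗ[S] B) (hA : Module.Injective S A) (hk : Module.Injective S (LinearMap.ker f)) :
    Module.Injective S (LinearMap.range f) := by
  obtain ⟨σ, hσ⟩ := range_sec f hk
  exact inj_of_retract hA σ f.rangeRestrict (LinearMap.ext fun b => Subtype.ext (hσ b))

lemma inj_of_sub {A : Type u} [AddCommGroup A] [Module S A] (h : ∀ x : A, x = 0) :
    Module.Injective S A :=
  ⟨fun _ _ _ _ _ _ _ _ _ => ⟨0, fun _ => (h _).symm⟩⟩

variable {J : ℕ → Type u} [∀ i, AddCommGroup (J i)] [∀ i, Module S (J i)]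
  {d : ∀ i, J i →ₗ[S] J (i + 1)}

theorem bassrho [IsLocalRing S] [IsNoetherianRing S] (h : Res d)
    (n : ℕ) (hn : Module.Injective S (LinearMap.ker (d (n + 1))))
    (h1 : ¬ EC d (IsLocalRing.maximalIdeal S) n)
    (h2 : ∀ i < n, ∀ k, EC d (IsLocalRing.maximalIdeal S ^ k) i) :
    ∃ ρ : J (n + 1) →ₗ[S] J (n + 1), (∀ x, ρ (ρ x) = ρ x) ∧ (∀ x, d (n + 1) (ρ x) = 0) ∧
      (∀ y ∈ Gam (Submonoid.powers (IsLocalRing.maximalIdeal S)) (J n), ρ (d n y) = 0) ∧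
      ∃ v, Kil (IsLocalRing.maximalIdeal S) v ∧ ρ v ≠ 0 := by
  set m := IsLocalRing.maximalIdeal S with hm
  let F := Submonoid.powers m
  have hG : ∀ i, Module.Injective S (Gam F (J i)) := fun i => Gam_inj F (h.hinj i)
  have hker : ∀ i, i ≤ n → Module.Injective S (LinearMap.ker (gd F d i)) := by
    intro i
    induction i with
    | zero =>
      intro _
      exact inj_of_sub fun x => Subtype.ext (Subtype.ext (h.h0 _))
    | succ i ih =>
      intro hi
      have : LinearMap.ker (gd F d (i + 1)) = LinearMap.range (gd F d i) := by
        apply le_antisymm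
        · intro x hx
          obtain ⟨k, hk⟩ := mem_Gam_powers.mp x.2
          obtain ⟨g, hg, hg'⟩ := h2 i hi k x hk (congrArg Subtype.val hx)
          exact ⟨⟨g, mem_Gam_powers.mpr ⟨k, hg⟩⟩, Subtype.ext hg'⟩
        · rintro _ ⟨y, rfl⟩
          exact Subtype.ext (h.hdd _ _)
      rw [this]
      exact inj_range _ (hG i) (ih (by omega))
  obtain ⟨σ, hσ⟩ := range_sec (gd F d n) (hker n le_rfl)
  have hB := inj_range (gd F d n) (hG n) (hker n le_rfl)
  have hZ : Module.Injective S (Gam F (LinearMap.ker (d (n + 1)))) := Gam_inj F hn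
  let ι : Gam F (LinearMap.ker (d (n + 1))) →ₗ[S] J (n + 1) :=
    (LinearMap.ker (d (n + 1))).subtype ∘ₗ (Gam F (LinearMap.ker (d (n + 1)))).subtype
  have hι : Function.Injective ι := fun x y hxy => Subtype.ext (Subtype.ext hxy)
  obtain ⟨ζ, hζ⟩ := retract_of_inj hZ ι hι
  have hlift : ∀ x ∈ Gam F (J (n + 1)), d (n + 1) x = 0 → ∃ z, ι z = x := by
    intro x hx hdx
    obtain ⟨k, hk⟩ := mem_Gam_powers.mp hx
    exact ⟨⟨⟨x, hdx⟩, mem_Gam_powers.mpr ⟨k, fun r hr => Subtype.ext (hk r hr)⟩⟩, rfl⟩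
  let j : LinearMap.range (gd F d n) →ₗ[S] Gam F (LinearMap.ker (d (n + 1))) :=
    LinearMap.codRestrict _
      (LinearMap.codRestrict _ ((Gam F (J (n + 1))).subtype ∘ₗ (LinearMap.range (gd F d n)).subtype)
        (by rintro ⟨_, y, rfl⟩; exact h.hdd _ _))
      (by
        rintro ⟨x, hx⟩
        obtain ⟨k, hk⟩ := mem_Gam_powers.mp x.2
        exact mem_Gam_powers.mpr ⟨k, fun r hr => Subtype.ext (hk r hr)⟩)
  have hιj : ∀ b, ι (j b) = ((b : Gam F (J (n + 1))) : J (n + 1)) := fun _ => rfl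
  obtain ⟨β, hβ⟩ := retract_of_inj hB j (fun x y hxy => Subtype.ext (Subtype.ext (by
    rw [← hιj, hxy, hιj])))
  have hζ' : ∀ z, ζ (ι z) = z := LinearMap.congr_fun hζ
  have hβ' : ∀ z, β (j z) = z := LinearMap.congr_fun hβ
  let ρ : J (n + 1) →ₗ[S] J (n + 1) := ι ∘ₗ (LinearMap.id - j ∘ₗ β) ∘ₗ ζ
  have hρ : ∀ x, ρ x = ι (ζ x - j (β (ζ x))) := fun _ => rfl
  refine ⟨ρ, ?_, ?_, ?_, ?_⟩
  · intro x
    rw [hρ (ρ x), hρ x, hζ', map_sub β, hβ', sub_self, map_zero, sub_zero]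
  · intro x
    exact (ζ x - j (β (ζ x))).1.2
  · intro y hy
    have : d n y = ι (j ⟨gd F d n ⟨y, hy⟩, ⟨y, hy⟩, rfl⟩) := rfl
    rw [this, hρ, hζ', hβ', sub_self, map_zero]
  · rw [EC] at h1
    push Not at h1
    obtain ⟨w, hw, hdw, hw'⟩ := h1
    refine ⟨w, hw, fun h0 => ?_⟩
    obtain ⟨z, rfl⟩ := hlift w (mem_Gam_powers.mpr ⟨1, by rw [pow_one]; exact hw⟩) hdw
    rw [hρ, hζ'] at h0
    have hz : z = j (β z) := sub_eq_zero.mp (hι (by rw [h0, map_zero]))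
    have hkz : ∀ r ∈ m, r • z = 0 := fun r hr => hι (by rw [map_smul, map_zero]; exact hw r hr)
    refine hw' (σ (β z) : Gam F (J n)) (fun r hr => ?_) ?_
    · have : r • σ (β z) = 0 := by rw [← map_smul, ← map_smul, hkz r hr, map_zero, map_zero]
      exact congrArg Subtype.val this
    · have := congrArg Subtype.val (hσ (β z))
      rw [gd_coe] at this
      rw [this, ← hιj, ← hz]
end P7d
end GGP

namespace GGP
section P7e
open GG
variable {S : Type u} [CommRing S]

lemma exists_emb (X : ModuleCat.{u} S) : ∃ (E : ModuleCat.{u} S) (ι : X →ₗ[S] E),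
    Module.Injective S E ∧ Function.Injective ι ∧
      (Module.Injective S X → Function.Surjective ι) := by
  by_cases hX : Module.Injective S X
  · exact ⟨X, LinearMap.id, hX, Function.injective_id, fun _ => Function.surjective_id⟩
  · obtain ⟨I, hI, f, hf⟩ := CategoryTheory.EnoughInjectives.presentation X
    exact ⟨I, f.hom, Module.injective_module_of_injective_object S I,
      (ModuleCat.mono_iff_injective f).mp hf, fun h => absurd h hX⟩

/-- chosen embedding -/
noncomputable def emE (X : ModuleCat.{u} S) : ModuleCat.{u} S := (exists_emb X).choose
/-- chosen embedding -/
noncomputable def emi (X : ModuleCat.{u} S) : X →ₗ[S] emE X := (exists_emb X).choose_spec.choose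
lemma em_inj (X : ModuleCat.{u} S) : Module.Injective S (emE X) :=
  (exists_emb X).choose_spec.choose_spec.1
lemma emi_inj (X : ModuleCat.{u} S) : Function.Injective (emi X) :=
  (exists_emb X).choose_spec.choose_spec.2.1
lemma emi_surj (X : ModuleCat.{u} S) (h : Module.Injective S X) : Function.Surjective (emi X) :=
  (exists_emb X).choose_spec.choose_spec.2.2 h

/-- cosyzygies -/
noncomputable def Om (S : Type u) [CommRing S] : ℕ → ModuleCat.{u} S
  | 0 => ModuleCat.of S S
  | i + 1 => ModuleCat.of S (emE (Om S i) ⧸ LinearMap.range (emi (Om S i)))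

/-- projection to the cosyzygy -/
noncomputable def Omp (i : ℕ) : emE (Om S i) →ₗ[S] Om S (i + 1) :=
  (LinearMap.range (emi (Om S i))).mkQ

lemma Omp_surj (i : ℕ) : Function.Surjective (Omp (S := S) i) := Submodule.mkQ_surjective _
lemma Omp_zero (i : ℕ) (x) : Omp (S := S) i x = 0 ↔ ∃ y, emi (Om S i) y = x :=
  Submodule.Quotient.mk_eq_zero (LinearMap.range (emi (Om S i)))

/-- resolution -/
noncomputable def RJ (S : Type u) [CommRing S] : ℕ → ModuleCat.{u} S
  | 0 => ModuleCat.of S PUnit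
  | i + 1 => emE (Om S i)

/-- resolution -/
noncomputable def Rd (S : Type u) [CommRing S] : ∀ i, RJ S i →ₗ[S] RJ S (i + 1)
  | 0 => 0
  | i + 1 => emi (Om S (i + 1)) ∘ₗ Omp i

lemma Rd_succ (i : ℕ) (x : emE (Om S i)) :
    Rd S (i + 1) x = emi (Om S (i + 1)) (Omp i x) := rfl

lemma Rd_zero_iff (i : ℕ) (x : emE (Om S i)) :
    Rd S (i + 1) x = 0 ↔ ∃ y, emi (Om S i) y = x := by
  rw [← Omp_zero, Rd_succ]
  constructor
  · intro h; exact emi_inj _ (h.trans (map_zero _).symm)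
  · intro h; rw [h]; exact map_zero _

lemma Rd_res : Res (Rd S) where
  h0 x := rfl
  hinj i := by
    cases i with
    | zero => exact inj_of_sub fun x => rfl
    | succ i => exact em_inj _
  hdd i x := by
    cases i with
    | zero => exact map_zero _
    | succ i => exact (Rd_zero_iff (i + 1) _).mpr ⟨_, rfl⟩
  hex i x hx := by
    obtain ⟨y, rfl⟩ := (Rd_zero_iff (i + 1) _).mp hx
    obtain ⟨z, rfl⟩ := Omp_surj _ y
    exact ⟨z, rfl⟩
  hunit := by
    let e0 : Om S 0 := (1 : S)
    refine ⟨emi (Om S 0) e0, (Rd_zero_iff 0 _).mpr ⟨_, rfl⟩, ?_, ?_⟩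
    · intro f hf
      obtain ⟨y, rfl⟩ := (Rd_zero_iff 0 _).mp hf
      let y' : S := y
      refine ⟨y', ?_⟩
      refine Eq.trans ?_ (map_smul (emi (Om S 0)) y' e0)
      exact congrArg _ (mul_one y').symm
    · intro s hs
      have h1 : emi (Om S 0) (s • e0) = 0 := (map_smul (emi (Om S 0)) s e0).trans hs
      have h2 : s • e0 = 0 := emi_inj _ (h1.trans (map_zero _).symm)
      exact (mul_one s).symm.trans h2

lemma Rd_bdd (i : ℕ) (h : Module.Injective S (LinearMap.ker (Rd S (i + 1)))) (k : ℕ) (hk : i + 1 < k) :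
    ∀ x : RJ S k, x = 0 := by
  have h1 : Module.Injective S (Om S i) := by
    refine inj_of_equiv h (LinearEquiv.ofBijective ((emi (Om S i)).codRestrict _
      (fun y => (Rd_zero_iff i _).mpr ⟨y, rfl⟩)) ⟨?_, ?_⟩)
    · intro x y hxy
      exact emi_inj _ (congrArg Subtype.val hxy)
    · rintro ⟨x, hx⟩
      obtain ⟨y, rfl⟩ := (Rd_zero_iff i _).mp hx
      exact ⟨y, rfl⟩
  have h2 : ∀ k, ∀ x : Om S (i + 1 + k), x = 0 := by
    intro k
    induction k with
    | zero =>
      intro x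
      obtain ⟨z, rfl⟩ := Omp_surj _ x
      exact (Omp_zero _ _).mpr (emi_surj _ h1 z)
    | succ k ih =>
      intro x
      obtain ⟨z, rfl⟩ := Omp_surj _ x
      exact (Omp_zero _ _).mpr (emi_surj _ (inj_of_sub ih) z)
  obtain ⟨k, rfl⟩ := Nat.exists_eq_add_of_lt hk
  intro x
  have x' : emE (Om S (i + 1 + k)) := x
  obtain ⟨y, hy⟩ := emi_surj (Om S (i + 1 + k)) (inj_of_sub (h2 k)) x
  rw [h2 k y, map_zero] at hy
  exact hy.symm

open CategoryTheory in
lemma idim_shift {A B : Type u} [AddCommGroup A] [Module S A] [AddCommGroup B] [Module S B]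
    (f : A →ₗ[S] B) (hA : Module.Injective S A) (k : ℕ) :
    HasInjectiveDimensionLE (ModuleCat.of S (LinearMap.range f)) k ↔
      HasInjectiveDimensionLE (ModuleCat.of S (LinearMap.ker f)) (k + 1) := by
  have hS := LinearMap.shortExact_shortComplexKer (f := f.rangeRestrict) f.surjective_rangeRestrict
  have := hS.hasInjectiveDimensionLT_X₃_iff k ((Module.injective_iff_injective_object S A).mp hA)
  refine this.trans ?_
  refine ModuleCat.hasInjectiveDimensionLE_iff_of_linearEquiv (M := ModuleCat.of S (LinearMap.ker f.rangeRestrict)) (N := ModuleCat.of S (LinearMap.ker f)) ?_ (k + 1)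
  exact LinearEquiv.ofEq _ _ (LinearMap.ker_rangeRestrict f)

open CategoryTheory in
lemma idim_zero {A : Type u} [AddCommGroup A] [Module S A] :
    HasInjectiveDimensionLE (ModuleCat.of S A) 0 ↔ Module.Injective S A := by
  rw [Module.injective_iff_injective_object S A, injective_iff_hasInjectiveDimensionLT_one]

open CategoryTheory in
lemma idim_of_idLE (n : ℕ) (h : idLE S S n) : HasInjectiveDimensionLE (ModuleCat.of S S) n := by
  obtain ⟨G, d, ε, hG, hε, h0, hd, hn⟩ := h
  have key : ∀ k i, i + k = n →
      HasInjectiveDimensionLE (ModuleCat.of S (LinearMap.ker (d i))) k := by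
    intro k
    induction k with
    | zero =>
      intro i hi
      rw [idim_zero]
      have : LinearMap.ker (d i) = ⊤ := by
        rw [eq_top_iff]; intro x _; exact hn (i + 1) (by omega) _
      exact inj_of_equiv (hG i) ((LinearEquiv.ofEq _ _ this).trans Submodule.topEquiv)
    | succ k ih =>
      intro i hi
      rw [← idim_shift _ (hG i), hd]
      exact ih (i + 1) (by omega)
  refine (ModuleCat.hasInjectiveDimensionLE_iff_of_linearEquiv (M := ModuleCat.of S S)
    (N := ModuleCat.of S (LinearMap.ker (d 0))) ?_ n).mpr (key n 0 (by omega))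
  exact (LinearEquiv.ofInjective ε hε).trans (LinearEquiv.ofEq _ _ h0)

open CategoryTheory in
lemma Res.inj_of_idLE {J : ℕ → Type u} [∀ i, AddCommGroup (J i)] [∀ i, Module S (J i)]
    {d : ∀ i, J i →ₗ[S] J (i + 1)} (h : Res d) (n : ℕ) (hn : idLE S S n) :
    Module.Injective S (LinearMap.ker (d (n + 1))) := by
  have key : ∀ i k, i + k = n →
      HasInjectiveDimensionLE (ModuleCat.of S (LinearMap.ker (d (i + 1)))) k := by
    intro i
    induction i with
    | zero =>
      intro k hk
      obtain rfl : k = n := by omega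
      obtain ⟨e, he, hs, hi⟩ := h.hunit
      refine (ModuleCat.hasInjectiveDimensionLE_iff_of_linearEquiv (M := ModuleCat.of S S)
        (N := ModuleCat.of S (LinearMap.ker (d 1))) ?_ k).mp (idim_of_idLE k hn)
      refine LinearEquiv.ofBijective ((LinearMap.toSpanSingleton S _ e).codRestrict _
        (fun s => by
          rw [LinearMap.mem_ker, LinearMap.toSpanSingleton_apply, map_smul, he, smul_zero])) ⟨?_, ?_⟩
      · intro x y hxy
        have h1 : x • e = y • e := congrArg Subtype.val hxy
        exact sub_eq_zero.mp (hi (x - y) (by rw [sub_smul, h1, sub_self]))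
      · rintro ⟨x, hx⟩
        obtain ⟨s, rfl⟩ := hs x hx
        exact ⟨s, rfl⟩
    | succ i ih =>
      intro k hk
      have h1 := (idim_shift (d (i + 1)) (h.hinj _) k).mpr (ih (k + 1) (by omega))
      have : LinearMap.range (d (i + 1)) = LinearMap.ker (d (i + 1 + 1)) := by
        apply le_antisymm
        · rintro _ ⟨x, rfl⟩; exact h.hdd _ _
        · intro x hx; exact h.hex _ _ hx
      rwa [this] at h1
  exact idim_zero.mp (key n 0 (by omega))

end P7e
end GGP

namespace GGP
section P7f
open GG
variable {Q : Type u} [CommRing Q]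

lemma mk_zero_iff {S : Submonoid Q} {N : Type u} [AddCommGroup N] [Module Q N] (x : N) (s : S) :
    LocalizedModule.mk x s = 0 ↔ ∃ t : S, t • x = 0 := by
  constructor
  · intro h
    rw [← LocalizedModule.zero_mk s, LocalizedModule.mk_eq] at h
    obtain ⟨t, ht⟩ := h
    exact ⟨t * s, by rw [mul_smul, ht]; simp⟩
  · rintro ⟨t, ht⟩
    rw [← LocalizedModule.mk_cancel_common_left t, ht, LocalizedModule.zero_mk]

lemma lsmul_map {S : Submonoid Q} {N N' : Type u} [AddCommGroup N] [Module Q N]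
    [AddCommGroup N'] [Module Q N'] (f : N →ₗ[Q] N') (t : S) (x : N) : f (t • x) = t • f x :=
  map_smul f (t : Q) x

variable {J : ℕ → Type u} [∀ i, AddCommGroup (J i)] [∀ i, Module Q (J i)]
  {d : ∀ i, J i →ₗ[Q] J (i + 1)}

/-- localized differential -/
noncomputable abbrev ld (S : Submonoid Q) (d : ∀ i, J i →ₗ[Q] J (i + 1)) (i : ℕ) :
    LocalizedModule S (J i) →ₗ[Localization S] LocalizedModule S (J (i + 1)) :=
  LocalizedModule.map S (d i)

lemma Res.loc [IsNoetherianRing Q] (h : Res d) (S : Submonoid Q) : Res (ld S d) where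
  h0 x := by
    induction x using LocalizedModule.induction_on with
    | h m s => rw [h.h0 m, LocalizedModule.zero_mk]
  hinj i := by
    have := h.hinj i
    exact Module.injective_of_isLocalizedModule S (LocalizedModule.mkLinearMap S (J i))
  hdd i x := by
    induction x using LocalizedModule.induction_on with
    | h m s => rw [LocalizedModule.map_mk, LocalizedModule.map_mk, h.hdd, LocalizedModule.zero_mk]
  hex i x := by
    induction x using LocalizedModule.induction_on with
    | h m s =>
      intro hx
      rw [LocalizedModule.map_mk, mk_zero_iff] at hx
      obtain ⟨t, ht⟩ := hx
      rw [← lsmul_map] at ht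
      obtain ⟨y, hy⟩ := h.hex i _ ht
      refine ⟨LocalizedModule.mk y (t * s), ?_⟩
      rw [LocalizedModule.map_mk, hy, LocalizedModule.mk_cancel_common_left]
  hunit := by
    obtain ⟨e, he, hs, hi⟩ := h.hunit
    refine ⟨LocalizedModule.mk e 1, ?_, ?_, ?_⟩
    · rw [LocalizedModule.map_mk, he, LocalizedModule.zero_mk]
    · intro f
      induction f using LocalizedModule.induction_on with
      | h m s =>
        intro hx
        rw [LocalizedModule.map_mk, mk_zero_iff] at hx
        obtain ⟨t, ht⟩ := hx
        rw [← lsmul_map] at ht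
        obtain ⟨r, hr⟩ := hs _ ht
        refine ⟨Localization.mk r (t * s), ?_⟩
        rw [LocalizedModule.mk_smul_mk, ← hr, mul_one, LocalizedModule.mk_cancel_common_left]
    · intro r
      induction r using Localization.induction_on with
      | H y =>
        obtain ⟨r, s⟩ := y
        intro hr
        rw [LocalizedModule.mk_smul_mk, mk_zero_iff] at hr
        obtain ⟨t, ht⟩ := hr
        have : (t : Q) * r = 0 := hi _ (by rw [mul_smul]; exact ht)
        show Localization.mk r s = 0
        rw [Localization.mk_eq_mk', IsLocalization.mk'_eq_zero_iff]
        exact ⟨t, this⟩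

lemma inj_ker_loc {A B : Type u} [AddCommGroup A] [Module Q A] [AddCommGroup B] [Module Q B]
    (S : Submonoid Q) (f : A →ₗ[Q] B)
    (h : Module.Injective (Localization S) (LinearMap.ker (LocalizedModule.map S f))) :
    Module.Injective (Localization S) (LocalizedModule S (LinearMap.ker f)) := by
  refine inj_of_equiv h (LinearEquiv.ofBijective ((LocalizedModule.map S
    (LinearMap.ker f).subtype).codRestrict _ ?_) ⟨?_, ?_⟩)
  · intro x
    rw [LinearMap.mem_ker]
    induction x using LocalizedModule.induction_on with
    | h m s =>
      rw [LocalizedModule.map_mk, LocalizedModule.map_mk, Submodule.subtype_apply,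
        LinearMap.mem_ker.mp m.2, LocalizedModule.zero_mk]
  · intro x y hxy
    exact LocalizedModule.map_injective S _ (Submodule.subtype_injective _)
      (congrArg Subtype.val hxy)
  · rintro ⟨x, hx⟩
    rw [LinearMap.mem_ker] at hx
    induction x using LocalizedModule.induction_on with
    | h m s =>
      have hx' := hx
      rw [LocalizedModule.map_mk, mk_zero_iff] at hx'
      obtain ⟨t, ht⟩ := hx'
      rw [← lsmul_map] at ht
      refine ⟨LocalizedModule.mk ⟨t • m, ht⟩ (t * s), Subtype.ext ?_⟩
      show LocalizedModule.map S (LinearMap.ker f).subtype _ = _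
      rw [LocalizedModule.map_mk, Submodule.subtype_apply, LocalizedModule.mk_cancel_common_left]

lemma gor_loc [IsNoetherianRing Q] (hG : IsGorensteinRing Q) (h : Res d) (q : Ideal Q)
    [hq : q.IsPrime] :
    ∃ n : ℕ, (n : WithBot ℕ∞) ≤ ringKrullDim Q ∧
      Module.Injective (Localization.AtPrime q) (LinearMap.ker (ld q.primeCompl d (n + 1))) ∧
      ∃ ρ : LocalizedModule q.primeCompl (J (n + 1)) →ₗ[Localization.AtPrime q]
          LocalizedModule q.primeCompl (J (n + 1)),
        (∀ x, ρ (ρ x) = ρ x) ∧ (∀ x, ld q.primeCompl d (n + 1) (ρ x) = 0) ∧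
        (∀ y ∈ Gam (Submonoid.powers (IsLocalRing.maximalIdeal (Localization.AtPrime q)))
          (LocalizedModule q.primeCompl (J n)), ρ (ld q.primeCompl d n y) = 0) ∧
        ∃ v, Kil (IsLocalRing.maximalIdeal (Localization.AtPrime q)) v ∧ ρ v ≠ 0 := by
  have hL := h.loc q.primeCompl
  obtain ⟨m, hm⟩ := hG ⟨q, hq⟩
  have : IsNoetherianRing (Localization.AtPrime q) :=
    IsLocalization.isNoetherianRing q.primeCompl _ inferInstance
  obtain ⟨n, hn, h1, h2, h3⟩ := bass (S := Localization.AtPrime q) hL ⟨m, hL.inj_of_idLE m hm⟩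
  refine ⟨n, hn.trans ?_, h1, bassrho hL n h1 h2 h3⟩
  rw [IsLocalization.AtPrime.ringKrullDim_eq_height q (Localization.AtPrime q)]
  exact Ideal.height_le_ringKrullDim_of_ne_top hq.ne_top

lemma gor_bdd [IsNoetherianRing Q] (hG : IsGorensteinRing Q) (hd : ringKrullDim Q < ⊤) :
    ∃ N, ∀ k, N < k → ∀ x : RJ Q k, x = 0 := by
  obtain ⟨N, hN⟩ : ∃ N : ℕ, ringKrullDim Q ≤ N := by
    generalize ringKrullDim Q = x at hd
    induction x with
    | bot => exact ⟨0, bot_le⟩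
    | coe x =>
      induction x with
      | top => exact absurd hd (lt_irrefl _)
      | coe n => exact ⟨n, le_rfl⟩
  refine ⟨N + 1, Rd_bdd N ?_⟩
  refine Module.injective_of_localization_maximal fun q hq => ?_
  have : q.IsPrime := hq.isPrime
  apply inj_ker_loc
  obtain ⟨n, hn, h1, -⟩ := gor_loc hG (Rd_res (S := Q)) q
  have hnN : n ≤ N := by exact_mod_cast hn.trans hN
  have hL := (Rd_res (S := Q)).loc q.primeCompl
  exact ker_inj_le hL hnN h1
end P7f
end GGP

namespace GGP
section P7g
open GG
variable {Q R : Type u} [CommRing Q] [CommRing R]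

/-- elements killed by `ker f` -/
def annSub (f : Q →+* R) (J : Type u) [AddCommGroup J] [Module Q J] : Submodule Q J where
  carrier := {y | ∀ r, f r = 0 → r • y = 0}
  add_mem' := by
    intro a b ha hb r hr
    rw [smul_add, ha r hr, hb r hr, add_zero]
  zero_mem' := fun r _ => smul_zero r
  smul_mem' := by
    intro c x hx r hr
    rw [smul_comm, hx r hr, smul_zero]

lemma mem_annSub {f : Q →+* R} {J : Type u} [AddCommGroup J] [Module Q J] {y : J} :
    y ∈ annSub f J ↔ ∀ r, f r = 0 → r • y = 0 := Iff.rfl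

/-- scalar multiplication on the killed part -/
@[reducible] noncomputable def annSMul (f : Q →+* R) (hf : Function.Surjective f) (J : Type u) [AddCommGroup J]
    [Module Q J] : SMul R (annSub f J) := ⟨fun r x => Function.surjInv hf r • x⟩

lemma annSMul_eq (f : Q →+* R) (hf : Function.Surjective f) (J : Type u) [AddCommGroup J]
    [Module Q J] (c : Q) (x : annSub f J) : (annSMul f hf J).smul (f c) x = c • x := by
  show Function.surjInv hf (f c) • x = c • x
  apply Subtype.ext
  have := x.2 (Function.surjInv hf (f c) - c) (by
    rw [map_sub, Function.surjInv_eq hf, sub_self])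
  rw [sub_smul] at this
  exact sub_eq_zero.mp this

/-- module structure on the killed part -/
@[reducible] noncomputable def annMod (f : Q →+* R) (hf : Function.Surjective f) (J : Type u) [AddCommGroup J]
    [Module Q J] : Module R (annSub f J) :=
  let _ := annSMul f hf J
  Function.Surjective.moduleLeft f hf (annSMul_eq f hf J)

/-- the killed part as a module over `R` -/
noncomputable def DM (f : Q →+* R) (hf : Function.Surjective f) (J : Type u) [AddCommGroup J]
    [Module Q J] : ModuleCat.{u} R :=
  let _ := annMod f hf J
  ModuleCat.of R (annSub f J)

variable {f : Q →+* R} {hf : Function.Surjective f} {J J' : Type u} [AddCommGroup J]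
    [Module Q J] [AddCommGroup J'] [Module Q J']

noncomputable def DMj (x : DM f hf J) : J := Subtype.val (p := fun y => y ∈ annSub f J) x

lemma DMj_add (x y : DM f hf J) : DMj (x + y) = DMj x + DMj y := rfl
lemma DMj_zero : DMj (0 : DM f hf J) = 0 := rfl
lemma DMj_smul (c : Q) (x : DM f hf J) : DMj (f c • x) = c • DMj x :=
  congrArg Subtype.val (annSMul_eq f hf J c x)
lemma DMj_inj {x y : DM f hf J} (h : DMj x = DMj y) : x = y := Subtype.ext h
lemma DMj_mem (x : DM f hf J) (r : Q) (h : f r = 0) : r • DMj x = 0 := 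
  Subtype.property (p := fun y => y ∈ annSub f J) x r h
/-- lifting -/
noncomputable def DMk (y : J) (h : ∀ r, f r = 0 → r • y = 0) : DM f hf J :=
  (⟨y, h⟩ : annSub f J)
lemma DMj_k (y : J) (h : ∀ r, f r = 0 → r • y = 0) : DMj (DMk (hf := hf) y h) = y := rfl

/-- functoriality -/
noncomputable def DMmap (f : Q →+* R) (hf : Function.Surjective f) (g : J →ₗ[Q] J') :
    DM f hf J →ₗ[R] DM f hf J' where
  toFun x := DMk (g (DMj x)) (fun r hr => by rw [← map_smul, DMj_mem x r hr, map_zero])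
  map_add' x y := DMj_inj (by
    rw [DMj_k, DMj_add, map_add, DMj_add, DMj_k, DMj_k])
  map_smul' r x := by
    obtain ⟨c, rfl⟩ := hf r
    apply DMj_inj
    rw [RingHom.id_apply, DMj_k, DMj_smul, map_smul, DMj_smul, DMj_k]

lemma DMj_map (g : J →ₗ[Q] J') (x : DM f hf J) : DMj (DMmap f hf g x) = g (DMj x) := rfl

lemma DM_inj (hJ : Module.Injective Q J) : Module.Injective R (DM f hf J) := by
  refine ⟨fun X Y _ _ _ _ u hu g => ?_⟩
  let _ : Module Q X := Module.compHom X f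
  let _ : Module Q Y := Module.compHom Y f
  have hX : ∀ (c : Q) (x : X), c • x = f c • x := fun _ _ => rfl
  have hY : ∀ (c : Q) (x : Y), c • x = f c • x := fun _ _ => rfl
  let u' : X →ₗ[Q] Y :=
    { toFun := u
      map_add' := map_add u
      map_smul' := fun c x => (map_smul u (f c) x) }
  let g' : X →ₗ[Q] J :=
    { toFun := fun x => DMj (g x)
      map_add' := fun x y => by rw [map_add, DMj_add]
      map_smul' := fun c x => (congrArg DMj (map_smul g (f c) x)).trans (DMj_smul c _) }
  obtain ⟨h, hh⟩ := hJ.out u' hu g'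
  refine ⟨{ toFun := fun y => DMk (h y) (fun r hr => by
              rw [← map_smul, hY, hr, zero_smul, map_zero])
            map_add' := fun x y => DMj_inj (by rw [DMj_k, map_add, DMj_add, DMj_k, DMj_k])
            map_smul' := fun r y => by
              obtain ⟨c, rfl⟩ := hf r
              apply DMj_inj
              rw [RingHom.id_apply, DMj_k, ← hY, map_smul, DMj_smul, DMj_k] }, fun x => ?_⟩
  exact DMj_inj (hh x)

/-- Localization identifies the local piece. -/
lemma loc_iso [IsNoetherianRing R] (p : Ideal R) [hp : p.IsPrime] {D T : Type u} [AddCommGroup D]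
    [Module R D] [AddCommGroup T] [Module R T] (hD : Module.Injective R D) (φ : D →ₗ[R] T)
    (h1 : ∀ s ∉ p, ∀ y : T, s • y = 0 → y = 0) (h2 : ∀ x, φ x = 0 → ∃ s ∉ p, s • x = 0)
    (h3 : ∀ y, ∃ s ∉ p, ∃ x, s • y = φ x) :
    ∃ Φ : Loc p D ≃ₗ[R] Gam (Submonoid.powers p) T,
      ∀ x : Gam (Submonoid.powers p) D,
        (Φ ((Gam (Zfam p) (Gam (Submonoid.powers p) D)).mkQ x) : T) = φ x := by
  let φ' : Gam (Submonoid.powers p) D →ₗ[R] Gam (Submonoid.powers p) T :=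
    φ.restrict (fun _ hx => Gam_map φ hx)
  have hker : Gam (Zfam p) (Gam (Submonoid.powers p) D) = LinearMap.ker φ' := by
    apply le_antisymm
    · intro x hx
      obtain ⟨c, hc, hcx⟩ := mem_Gam.mp hx
      obtain ⟨s, hs, hsp⟩ := Set.not_subset.mp ((mem_Zfam p c).mp hc)
      refine Subtype.ext (h1 s hsp _ ?_)
      show s • φ x = 0
      rw [← map_smul]
      have : s • (x : D) = 0 := congrArg Subtype.val (hcx s hs)
      rw [this, map_zero]
    · intro x hx
      obtain ⟨s, hs, hsx⟩ := h2 x (congrArg Subtype.val hx)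
      refine mem_Gam.mpr ⟨Ideal.span {s}, ?_, ?_⟩
      · rw [mem_Zfam, Ideal.span_singleton_le_iff_mem]; exact hs
      · intro r hr
        obtain ⟨t, rfl⟩ := Ideal.mem_span_singleton'.mp hr
        apply Subtype.ext
        show (t * s) • (x : D) = 0
        rw [mul_smul, hsx, smul_zero]
  have hsurj : Function.Surjective φ' := by
    rintro ⟨y, hy⟩
    obtain ⟨k, hk⟩ := mem_Gam_powers.mp hy
    obtain ⟨s, hs, x, hx⟩ := h3 y
    have hkx : ∀ r ∈ p ^ k, φ (r • x) = 0 := by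
      intro r hr
      rw [map_smul, ← hx, smul_comm, hk r hr, smul_zero]
    obtain ⟨t, ht, htx⟩ : ∃ t ∉ p, ∀ r ∈ p ^ k, t • (r • x) = 0 := by
      have hfg : (p ^ k).FG := IsNoetherian.noetherian _
      obtain ⟨G, hG⟩ := hfg
      choose! σ hσ hσ' using h2
      refine ⟨∏ g ∈ G, σ (g • x), ?_, ?_⟩
      · rw [Ideal.IsPrime.prod_mem_iff]
        push Not
        intro g hg
        exact hσ _ (hkx g (hG ▸ Submodule.subset_span hg))
      · intro r hr
        rw [← hG] at hr
        induction hr using Submodule.span_induction with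
        | mem g hg =>
          obtain ⟨c, hc⟩ := Finset.dvd_prod_of_mem (fun g => σ (g • x)) (Finset.mem_coe.mp hg)
          rw [hc, mul_comm, mul_smul, hσ' _ (hkx g (hG ▸ Submodule.subset_span hg)), smul_zero]
        | zero => rw [zero_smul, smul_zero]
        | add a b _ _ ha hb => rw [add_smul, smul_add, ha, hb, add_zero]
        | smul c a _ ha => rw [smul_eq_mul, mul_smul, smul_comm, ha, smul_zero]
    let x' : Gam (Submonoid.powers p) D := ⟨t • x, mem_Gam_powers.mpr ⟨k, fun r hr => by
      rw [smul_comm]; exact htx r hr⟩⟩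
    obtain ⟨z, m, hz⟩ := exists_div (Gam_inj (Submonoid.powers p) hD) (s * t) 1 x'
    have hst : s * t ∉ p := fun h => (hp.mem_or_mem h).elim hs ht
    have hstm : (s * t) ^ m ∉ p := fun h => hst (hp.mem_of_pow_mem m h)
    refine ⟨z, Subtype.ext ?_⟩
    have e1 := congrArg (fun w => φ (Subtype.val w)) hz
    have e2 : (s * t) ^ m • ((s * t) ^ 1 • φ z) = (s * t) ^ m • (t • φ x) := by
      rw [← map_smul, ← map_smul, ← map_smul φ t, ← map_smul φ ((s * t) ^ m)]; exact e1
    have e3 : (s * t) • φ z = (s * t) • y := by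
      rw [← sub_eq_zero]
      apply h1 _ hstm
      rw [pow_one] at e2
      rw [smul_sub, e2, ← hx, ← mul_smul t s, mul_comm t s, sub_self]
    rw [← sub_eq_zero]
    apply h1 _ hst
    show (s * t) • (φ z - y) = 0
    rw [smul_sub, e3, sub_self]
  refine ⟨(Submodule.quotEquivOfEq _ _ hker).trans (φ'.quotKerEquivOfSurjective hsurj), ?_⟩
  intro x
  rfl
end P7g
end GGP

namespace GGP
section P7h
open GG
variable {Q R : Type u} [CommRing Q] [CommRing R]

lemma unif (p : Ideal Q) [hp : p.IsPrime] {D : Type u} [AddCommGroup D] [Module Q D]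
    (I : Ideal Q) (hI : I.FG) (x : D) (h : ∀ r ∈ I, ∃ s ∉ p, s • (r • x) = 0) :
    ∃ t ∉ p, ∀ r ∈ I, t • (r • x) = 0 := by
  obtain ⟨G, hG⟩ := hI
  choose! σ hσ hσ' using h
  refine ⟨∏ g ∈ G, σ g, ?_, ?_⟩
  · rw [Ideal.IsPrime.prod_mem_iff]
    push Not
    intro g hg
    exact hσ _ (hG ▸ Submodule.subset_span hg)
  · intro r hr
    rw [← hG] at hr
    induction hr using Submodule.span_induction with
    | mem g hg =>
      obtain ⟨c, hc⟩ := Finset.dvd_prod_of_mem σ (Finset.mem_coe.mp hg)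
      rw [hc, mul_comm, mul_smul, hσ' _ (hG ▸ Submodule.subset_span hg), smul_zero]
    | zero => rw [zero_smul, smul_zero]
    | add a b _ _ ha hb => rw [add_smul, smul_add, ha, hb, add_zero]
    | smul c a _ ha => rw [smul_eq_mul, mul_smul, smul_comm, ha, smul_zero]

variable {f : Q →+* R} {hf : Function.Surjective f} {J J' : Type u} [AddCommGroup J]
    [Module Q J] [AddCommGroup J'] [Module Q J']

noncomputable abbrev TM (f : Q →+* R) (hf : Function.Surjective f) (p : Ideal R) [p.IsPrime]
    (J : Type u) [AddCommGroup J] [Module Q J] : ModuleCat.{u} R :=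
  DM f hf (LocalizedModule (p.comap f).primeCompl J)

/-- localization map -/
noncomputable abbrev Tmk (f : Q →+* R) (hf : Function.Surjective f) (p : Ideal R) [p.IsPrime]
    (J : Type u) [AddCommGroup J] [Module Q J] : DM f hf J →ₗ[R] TM f hf p J :=
  DMmap f hf (LocalizedModule.mkLinearMap (p.comap f).primeCompl J)

lemma smul_mk_zero (p : Ideal Q) [hp : p.IsPrime] (c : Q) (hc : c ∉ p)
    (y : LocalizedModule p.primeCompl J) (h : c • y = 0) : y = 0 := by
  induction y using LocalizedModule.induction_on with
  | h m s =>
    rw [LocalizedModule.smul'_mk, mk_zero_iff] at h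
    obtain ⟨t, ht⟩ := h
    rw [mk_zero_iff]
    refine ⟨t * ⟨c, hc⟩, ?_⟩
    rw [mul_smul]; exact ht

lemma Tmk_iso [IsNoetherianRing Q] [IsNoetherianRing R] (p : Ideal R) [hp : p.IsPrime]
    (hJ : Module.Injective Q J) :
    ∃ Φ : Loc p (DM f hf J) ≃ₗ[R] Gam (Submonoid.powers p) (TM f hf p J),
      ∀ x : Gam (Submonoid.powers p) (DM f hf J),
        (Φ ((Gam (Zfam p) (Gam (Submonoid.powers p) (DM f hf J))).mkQ x) : TM f hf p J)
          = Tmk f hf p J x := by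
  refine loc_iso p (DM_inj hJ) _ ?_ ?_ ?_
  · intro s hs y hy
    obtain ⟨c, rfl⟩ := hf s
    apply DMj_inj
    rw [DMj_zero]
    refine smul_mk_zero (p.comap f) c hs _ ?_
    rw [← DMj_smul, hy, DMj_zero]
  · intro x hx
    have h1 : LocalizedModule.mk (DMj x) 1 = 0 := congrArg DMj hx
    rw [mk_zero_iff] at h1
    obtain ⟨t, ht⟩ := h1
    refine ⟨f t, t.2, DMj_inj ?_⟩
    rw [DMj_smul]; exact ht
  · intro y
    obtain ⟨x, s, hxs⟩ : ∃ x s, DMj y = LocalizedModule.mk x s := by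
      generalize DMj y = z
      induction z using LocalizedModule.induction_on with
      | h m s => exact ⟨m, s, rfl⟩
    obtain ⟨t, ht, htx⟩ := unif (p.comap f) (RingHom.ker f) (IsNoetherian.noetherian _) x (by
      intro r hr
      have := DMj_mem y r hr
      rw [hxs, LocalizedModule.smul'_mk, mk_zero_iff] at this
      obtain ⟨t, ht⟩ := this
      exact ⟨t, t.2, ht⟩)
    refine ⟨f (s * t), (p.comap f).primeCompl.mul_mem s.2 ht,
      DMk (t • x) (fun r hr => by rw [smul_comm]; exact htx r hr), DMj_inj ?_⟩
    rw [DMj_smul, DMj_map, DMj_k, hxs, LocalizedModule.smul'_mk, mul_smul,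
      LocalizedModule.mkLinearMap_apply]
    exact LocalizedModule.mk_cancel s (t • x)

variable {J : ℕ → Type u} [∀ i, AddCommGroup (J i)] [∀ i, Module Q (J i)]
  {d : ∀ i, J i →ₗ[Q] J (i + 1)}

lemma DM_fg [IsNoetherianRing Q] (h : Res d) :
    FgCoh (D := fun i => DM f hf (J i)) (fun i => DMmap f hf (d i)) := by
  intro i
  cases i with
  | zero =>
    refine ⟨⊥, Submodule.fg_bot, bot_le, fun x _ => ?_⟩
    have : x = 0 := DMj_inj (h.h0 _)
    rw [this]; exact zero_mem _
  | succ i =>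
    obtain ⟨m, c, hc, hc'⟩ := FG_EC h (RingHom.ker f) i
    let c' : Fin m → DM f hf (J (i + 1)) := fun j => DMk (c j) (fun r hr => (hc j).1 r hr)
    refine ⟨Submodule.span R (Set.range c'), Submodule.fg_span (Set.finite_range c'), ?_, ?_⟩
    · rw [Submodule.span_le]
      rintro _ ⟨j, rfl⟩
      exact DMj_inj (hc j).2
    · intro x hx
      obtain ⟨r, g, hg, hx'⟩ := hc' (DMj x) (fun r hr => DMj_mem x r hr) (congrArg DMj hx)
      have : x = ∑ j, f (r j) • c' j + DMmap f hf (d i) (DMk g (fun r hr => hg r hr)) := by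
        apply DMj_inj
        rw [DMj_add, DMj_map, DMj_k, hx']
        congr 1
        let jj : DM f hf (J (i + 1)) →+ J (i + 1) := ⟨⟨DMj, DMj_zero⟩, DMj_add⟩
        refine Eq.trans ?_ (map_sum jj _ _).symm
        refine Finset.sum_congr rfl fun j _ => ?_
        exact (DMj_smul (r j) (c' j)).symm
      rw [this]
      refine Submodule.add_mem_sup (Submodule.sum_mem _ fun j _ => Submodule.smul_mem _ _
        (Submodule.subset_span ⟨j, rfl⟩)) ⟨_, rfl⟩

end P7h
end GGP

namespace GGP
section P7i
open GG

lemma locsplit_of {R : Type u} [CommRing R] {D : ℕ → Type u} [∀ i, AddCommGroup (D i)]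
    [∀ i, Module R (D i)] (d : ∀ i, D i →ₗ[R] D (i + 1)) (q : Ideal R) [q.IsPrime]
    {G : ℕ → Type u} [∀ i, AddCommGroup (G i)] [∀ i, Module R (G i)]
    (Φ : ∀ k, Loc q (D k) ≃ₗ[R] G k) (g : ∀ k, G k →ₗ[R] G (k + 1))
    (comm : ∀ k x, Φ (k + 1) (locd q d k x) = g k (Φ k x)) (n : ℕ)
    (ρ : G (n + 1) →ₗ[R] G (n + 1)) (h1 : ∀ x, ρ (ρ x) = ρ x)
    (h2 : ∀ x, g (n + 1) (ρ x) = 0) (h3 : ∀ y, ρ (g n y) = 0) (h4 : ∃ v, ρ v ≠ 0) :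
    ∃ (H : ModuleCat.{u} R) (n : ℕ) (i : H →ₗ[R] Loc q (D n))
    (r : ∀ k, Loc q (D k) →ₗ[R] H), r n ∘ₗ i = LinearMap.id ∧ locd q d n ∘ₗ i = 0 ∧
    (∀ k, r (k + 1) ∘ₗ locd q d k = 0) ∧ ∃ v : H, v ≠ 0 := by
  let H := LinearMap.range ρ
  let r0 : Loc q (D (n + 1)) →ₗ[R] H := ρ.rangeRestrict ∘ₗ (Φ (n + 1)).toLinearMap
  let r : ∀ k, Loc q (D k) →ₗ[R] H := fun k =>
    if h : k = n + 1 then h ▸ r0 else 0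
  have hr : r (n + 1) = r0 := by simp [r]
  refine ⟨ModuleCat.of R H, n + 1, (Φ (n + 1)).symm.toLinearMap ∘ₗ H.subtype, r, ?_, ?_, ?_, ?_⟩
  · rw [hr]
    apply LinearMap.ext
    rintro ⟨_, x, rfl⟩
    apply Subtype.ext
    show ρ (Φ (n + 1) ((Φ (n + 1)).symm (ρ x))) = ρ x
    rw [LinearEquiv.apply_symm_apply, h1]
  · apply LinearMap.ext
    rintro ⟨_, x, rfl⟩
    apply (Φ (n + 1 + 1)).injective
    rw [LinearMap.zero_apply, map_zero]
    refine (comm (n + 1) _).trans ?_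
    show g (n + 1) (Φ (n + 1) ((Φ (n + 1)).symm (ρ x))) = 0
    rw [LinearEquiv.apply_symm_apply, h2]
  · intro k
    by_cases hk : k = n
    · subst hk
      rw [hr]
      apply LinearMap.ext
      intro x
      apply Subtype.ext
      show ρ (Φ (k + 1) (locd q d k x)) = 0
      rw [comm, h3]
    · have : r (k + 1) = 0 := by
        simp only [r]; rw [dif_neg (by omega)]
      rw [this, LinearMap.zero_comp]
  · obtain ⟨v, hv⟩ := h4
    exact ⟨⟨ρ v, v, rfl⟩, fun h => hv (congrArg Subtype.val h)⟩

variable {Q R : Type u} [CommRing Q] [CommRing R]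
variable {f : Q →+* R} {hf : Function.Surjective f} 
variable {J : ℕ → Type u} [∀ i, AddCommGroup (J i)] [∀ i, Module Q (J i)]
  {d : ∀ i, J i →ₗ[Q] J (i + 1)}

lemma kil_map_pow (q : Ideal Q) [q.IsPrime] (k : ℕ) {T : Type u} [AddCommGroup T] [Module Q T]
    [Module (Localization.AtPrime q) T] [IsScalarTower Q (Localization.AtPrime q) T]
    (y : T) (h : ∀ r ∈ q ^ k, r • y = 0) :
    ∀ r ∈ IsLocalRing.maximalIdeal (Localization.AtPrime q) ^ k, r • y = 0 := by
  rw [← Localization.AtPrime.map_eq_maximalIdeal, ← Ideal.map_pow]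
  intro r hr
  induction hr using Submodule.span_induction with
  | mem g hg =>
    obtain ⟨c, hc, rfl⟩ := hg
    rw [algebraMap_smul]; exact h c hc
  | zero => rw [zero_smul]
  | add a b _ _ ha hb => rw [add_smul, ha, hb, add_zero]
  | smul c a _ ha => rw [smul_eq_mul, mul_smul, ha, smul_zero]

lemma DM_locsplit [IsNoetherianRing Q] [IsNoetherianRing R] (hG : IsGorensteinRing Q)
    (h : Res d) :
    LocSplit (D := fun i => DM f hf (J i)) (fun i => DMmap f hf (d i)) := by
  intro p hp
  obtain ⟨n, -, -, ρ, r1, r2, r3, v, hv, hv0⟩ := gor_loc hG h (p.comap f)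
  have hΦ := fun i => Tmk_iso (f := f) (hf := hf) p (h.hinj i)
  choose Φ hΦ using hΦ
  let td : ∀ i, TM f hf p (J i) →ₗ[R] TM f hf p (J (i + 1)) := fun i =>
    DMmap f hf ((ld (p.comap f).primeCompl d i).restrictScalars Q)
  let ρT : TM f hf p (J (n + 1)) →ₗ[R] TM f hf p (J (n + 1)) := DMmap f hf (ρ.restrictScalars Q)
  refine locsplit_of (D := fun i => DM f hf (J i)) _ p Φ
    (gd (Submonoid.powers p) td) ?_ n
    (ρT.restrict (fun _ hx => Gam_map ρT hx)) ?_ ?_ ?_ ?_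
  · intro k x
    obtain ⟨x, rfl⟩ := Submodule.mkQ_surjective _ x
    apply Subtype.ext
    refine (hΦ (k + 1) _).trans ?_
    refine Eq.trans ?_ (congrArg (td k) (hΦ k x)).symm
    apply DMj_inj
    exact (LocalizedModule.map_mk _ _ _ _).symm
  · intro x
    exact Subtype.ext (DMj_inj (r1 _))
  · intro x
    exact Subtype.ext (DMj_inj (r2 _))
  · rintro ⟨y, hy⟩
    apply Subtype.ext
    apply DMj_inj
    refine r3 (DMj y) ?_
    obtain ⟨k, hk⟩ := mem_Gam_powers.mp hy
    refine mem_Gam_powers.mpr ⟨k, kil_map_pow _ k _ ?_⟩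
    intro r hr
    have : f r ∈ p ^ k := by
      have := Ideal.mem_map_of_mem f hr
      rw [Ideal.map_pow] at this
      exact Ideal.pow_right_mono Ideal.map_comap_le k this
    have := hk _ this
    rw [← DMj_smul, this, DMj_zero]
  · have hk : ∀ r, f r ∈ p → r • v = 0 := by
      intro r hr
      rw [← algebraMap_smul (Localization.AtPrime (p.comap f)) r v]
      refine hv _ ?_
      rw [← Localization.AtPrime.map_eq_maximalIdeal]
      exact Ideal.mem_map_of_mem _ hr
    refine ⟨⟨DMk v (fun r hr => hk r (hr ▸ p.zero_mem)), mem_Gam_powers.mpr ⟨1, ?_⟩⟩, ?_⟩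
    · intro r hr
      rw [pow_one] at hr
      obtain ⟨c, rfl⟩ := hf r
      apply DMj_inj
      rw [DMj_smul]
      exact hk c hr
    · intro h0
      exact hv0 (congrArg (fun w => DMj (Subtype.val w)) h0)

lemma exists_dual {R : Type u} [CommRing R] [IsNoetherianRing R] (hR : HasDualizingComplex R) :
    Nonempty (Dual R) := by
  obtain ⟨Q, hQ, hd, hG, f, hf⟩ := hR
  obtain ⟨N, hN⟩ := gor_bdd hG hd
  exact ⟨{
    D := fun i => DM f hf (RJ Q i)
    d := fun i => DMmap f hf (Rd Q i)
    N := N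
    hN := fun i hi x => DMj_inj (hN i hi _)
    hdd := fun i x => DMj_inj (Rd_res.hdd i _)
    hinj := fun i => DM_inj (Rd_res.hinj i)
    hs := DM_locsplit hG Rd_res
    hfg := DM_fg Rd_res }⟩
end P7i
end GGP

namespace GGP
section P8a
open GG
variable {R : Type u} [CommRing R]

/-- support contained in a set -/
def SuppIn (G : Set (PrimeSpectrum R)) (K : Type u) [AddCommGroup K] [Module R K] : Prop :=
  ∀ q, q ∉ G → ∀ x : K, ∃ s ∉ q.asIdeal, s • x = 0

/-- `B` consists of minimal members of `G` -/
structure Lay (G B : Set (PrimeSpectrum R)) : Prop where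
  sub : B ⊆ G
  min : ∀ p ∈ B, ∀ q ∈ G, q ≤ p → q = p

/-- nice filtrations -/
structure Filt (F : ℕ → Set (PrimeSpectrum R)) : Prop where
  lay : ∀ n, Lay (F n) (F n \ F (n + 1))
  up : ∀ n p q, p ∈ F n → p ≤ q → q ∈ F n
  anti : ∀ n, F (n + 1) ⊆ F n

variable {G B : Set (PrimeSpectrum R)} {K : Type u} [AddCommGroup K] [Module R K]

lemma tors (h : Lay G B) (hK : SuppIn G K) (p : PrimeSpectrum R) (hp : p ∈ B)
    (z : LocalizedModule p.asIdeal.primeCompl K) (s : R) (hs : s ∈ p.asIdeal) :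
    ∃ k : ℕ, s ^ k • z = 0 := by
  induction z using LocalizedModule.induction_on with
  | h x t =>
    by_contra hcon
    push Not at hcon
    let T : Submonoid R := Submonoid.powers s ⊔ p.asIdeal.primeCompl
    let I : Ideal R := LinearMap.ker (LinearMap.toSpanSingleton R K x)
    have hI : ∀ r, r ∈ I ↔ r • x = 0 := fun r => by
      rw [LinearMap.mem_ker, LinearMap.toSpanSingleton_apply]
    have hd : Disjoint (I : Set R) T := by
      rw [Set.disjoint_left]
      intro r hr hrT
      obtain ⟨_, ⟨k, rfl⟩, u, hu, rfl⟩ := Submonoid.mem_sup.mp hrT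
      apply hcon k
      rw [LocalizedModule.smul'_mk, mk_zero_iff]
      refine ⟨⟨u, hu⟩, ?_⟩
      show u • (s ^ k • x) = 0
      rw [← mul_smul, mul_comm]
      exact (hI _).mp hr
    obtain ⟨q, hq, hIq, hqT⟩ := Ideal.exists_le_prime_disjoint I T hd
    rw [Set.disjoint_left] at hqT
    have hqp : (⟨q, hq⟩ : PrimeSpectrum R) ≤ p := by
      intro r hr
      by_contra hrp
      exact hqT hr (Submonoid.mem_sup_right (S := Submonoid.powers s) hrp)
    by_cases hqG : (⟨q, hq⟩ : PrimeSpectrum R) ∈ G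
    · have := h.min p hp _ hqG hqp
      rw [← this] at hs
      exact hqT hs (Submonoid.mem_sup_left (Submonoid.mem_powers s))
    · obtain ⟨u, hu, hux⟩ := hK _ hqG x
      exact hu (hIq ((hI u).mpr hux))

lemma theta_fin [IsNoetherianRing R] (h : Lay G B) (hK : SuppIn G K) (x : K) :
    thetaFull R B K x ∈ finSupp R B K := by
  let I : Ideal R := LinearMap.ker (LinearMap.toSpanSingleton R K x)
  have hI : ∀ r, r ∈ I ↔ r • x = 0 := fun r => by
      rw [LinearMap.mem_ker, LinearMap.toSpanSingleton_apply]
  have hfin := I.finite_minimalPrimes_of_isNoetherianRing R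
  show {p : B | thetaFull R B K x p ≠ 0}.Finite
  refine Set.Finite.of_finite_image (f := fun p : B => p.1.asIdeal) (hfin.subset ?_) ?_
  · rintro _ ⟨p, hp, rfl⟩
    have hIp : I ≤ p.1.asIdeal := by
      intro r hr
      by_contra hrp
      apply hp
      show LocalizedModule.mk x 1 = 0
      rw [mk_zero_iff]
      exact ⟨⟨r, hrp⟩, (hI r).mp hr⟩
    refine ⟨⟨p.1.2, hIp⟩, ?_⟩
    rintro q ⟨hq, hIq⟩ hqp
    have hqG : (⟨q, hq⟩ : PrimeSpectrum R) ∈ G := by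
      by_contra hqG
      obtain ⟨u, hu, hux⟩ := hK _ hqG x
      exact hu (hIq ((hI u).mpr hux))
    have := h.min p.1 p.2 _ hqG hqp
    exact (congrArg PrimeSpectrum.asIdeal this).symm.le
  · intro p _ p' _ h
    exact Subtype.ext (PrimeSpectrum.ext h)

lemma kill (h : Lay G B) (hK : SuppIn G K) (q : Ideal R) [hq : q.IsPrime] (y : locProd R B K)
    (hy : y ∈ finSupp R B K) (h0 : ∀ p : B, p.1.asIdeal ≤ q → y p = 0) :
    ∃ s ∉ q, s • y = 0 := by
  have hfin : {p : B | y p ≠ 0}.Finite := hy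
  have hex : ∀ p : B, ∃ s ∉ q, s • y p = 0 := by
    intro p
    by_cases hpq : p.1.asIdeal ≤ q
    · exact ⟨1, fun h => hq.ne_top ((Ideal.eq_top_iff_one _).mpr h), by rw [h0 p hpq, smul_zero]⟩
    · obtain ⟨s, hs, hsq⟩ := Set.not_subset.mp hpq
      obtain ⟨k, hk⟩ := tors h hK p.1 p.2 (y p) s hs
      exact ⟨s ^ k, fun h => hsq (hq.mem_of_pow_mem k h), hk⟩
  choose σ h1 h2 using hex
  refine ⟨∏ p ∈ hfin.toFinset, σ p, ?_, ?_⟩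
  · rw [Ideal.IsPrime.prod_mem_iff]
    push Not
    exact fun p _ => h1 p
  · funext p
    show (∏ p ∈ hfin.toFinset, σ p) • y p = 0
    by_cases hp : y p = 0
    · rw [hp, smul_zero]
    · obtain ⟨c, hc⟩ := Finset.dvd_prod_of_mem σ (hfin.mem_toFinset.mpr hp)
      rw [hc, mul_comm, mul_smul, h2, smul_zero]

lemma exists_mk {S : Submonoid R} (z : LocalizedModule S K) : ∃ x s, z = LocalizedModule.mk x s := by
  induction z using LocalizedModule.induction_on with
  | h x s => exact ⟨x, s, rfl⟩

lemma suppIn_next [IsNoetherianRing R] {F : ℕ → Set (PrimeSpectrum R)} (hF : Filt F) (n : ℕ)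
    (hK : SuppIn (F n) K) : SuppIn (F (n + 1)) (nextKType R (F n \ F (n + 1)) K) := by
  intro q hq y
  obtain ⟨y, rfl⟩ := Submodule.mkQ_surjective _ y
  by_cases hqn : q ∈ F n
  · have hqB : q ∈ F n \ F (n + 1) := ⟨hqn, hq⟩
    obtain ⟨x, t, hxt⟩ := exists_mk (y.1 ⟨q, hqB⟩)
    let w : finSupp R (F n \ F (n + 1)) K := (t : R) • y - ⟨_, theta_fin (hF.lay n) hK x⟩
    obtain ⟨s, hs, hsw⟩ := kill (hF.lay n) hK q.asIdeal w.1 w.2 (by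
      intro p hpq
      have hp : p = ⟨q, hqB⟩ := Subtype.ext ((hF.lay n).min q hqB p.1 p.2.1 hpq)
      rw [hp]
      show (t : R) • y.1 ⟨q, hqB⟩ - LocalizedModule.mk x 1 = 0
      rw [hxt, LocalizedModule.smul'_mk, sub_eq_zero]
      exact LocalizedModule.mk_cancel t x)
    refine ⟨s * t, fun h => (q.2.mem_or_mem h).elim hs t.2, ?_⟩
    rw [← map_smul, Submodule.mkQ_apply, Submodule.Quotient.mk_eq_zero]
    refine ⟨s • x, ?_⟩
    have : s • ((t : R) • y.1 - thetaFull R _ K x) = 0 := hsw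
    rw [smul_sub, sub_eq_zero] at this
    rw [map_smul, ← this, ← mul_smul]; rfl
  · obtain ⟨s, hs, hsy⟩ := kill (hF.lay n) hK q.asIdeal y.1 y.2 (fun p hp =>
      absurd (hF.up n p.1 q p.2.1 hp) hqn)
    refine ⟨s, hs, ?_⟩
    have : s • y = 0 := Subtype.ext hsy
    rw [← map_smul, this, map_zero]

lemma suppIn_cousin [IsNoetherianRing R] {F : ℕ → Set (PrimeSpectrum R)} (hF : Filt F)
    (M : ModuleCat.{u} R) (hM : SuppIn (F 0) M) : ∀ n, SuppIn (F n) (cousinK R F M n)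
  | 0 => hM
  | n + 1 => suppIn_next hF n (suppIn_cousin hF M hM n)

lemma filt_height (M : Type u) [AddCommGroup M] [Module R M] : Filt (heightFiltration R M) := by
  have anti : ∀ n, heightFiltration R M (n + 1) ⊆ heightFiltration R M n := by
    intro n p hp
    refine ⟨hp.1, le_trans ?_ hp.2⟩
    exact_mod_cast Nat.le_succ n
  have mono : ∀ p q, p ∈ Module.support R M → p ≤ q → htM R M p ≤ htM R M q := by
    intro p q hp hpq
    have hq := Module.mem_support_mono hpq hp
    rw [htM, htM, iSup_pos hp, iSup_pos hq]
    exact Order.height_mono hpq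
  refine ⟨fun n => ⟨Set.sdiff_subset, ?_⟩, ?_, anti⟩
  · rintro p ⟨hp, hp'⟩ q hq hqp
    by_contra hne
    apply hp'
    refine ⟨hp.1, ?_⟩
    have hlt : (⟨q, hq.1⟩ : Module.support R M) < ⟨p, hp.1⟩ := lt_of_le_of_ne hqp
      (fun h => hne (congrArg Subtype.val h))
    have h1 := hq.2
    rw [htM, iSup_pos hq.1] at h1
    rw [htM, iSup_pos hp.1]
    push_cast
    exact (add_le_add_left h1 1).trans (Order.height_add_one_le hlt)
  · intro n p q hp hpq
    exact ⟨Module.mem_support_mono hpq hp.1, hp.2.trans (mono p q hp.1 hpq)⟩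

lemma suppIn_height (M : Type u) [AddCommGroup M] [Module R M] :
    SuppIn (heightFiltration R M 0) M := by
  intro q hq x
  have : q ∉ Module.support R M := fun h => hq ⟨h, by simp⟩
  exact Module.notMem_support_iff'.mp this x

lemma resolves_iff [IsNoetherianRing R] {F : ℕ → Set (PrimeSpectrum R)} (hF : Filt F)
    (M : ModuleCat.{u} R) (hM : SuppIn (F 0) M) (P : ModuleCat.{u} R → Prop) :
    CousinResolves R F M P ↔ (∀ n, Function.Injective (cousinTheta R F M n)) ∧
      (∀ n, P (ModuleCat.of R (cousinC R F M n))) := by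
  have key : ∀ n, (LinearMap.ker (cousinD R F M n) =
    Submodule.comap (finSupp R (F n \ F (n + 1)) (cousinK R F M n)).subtype
      (LinearMap.range (cousinTheta R F M n))) ↔ Function.Injective (cousinTheta R F M (n + 1)) := by
    intro n
    let π := Submodule.mkQ (Submodule.comap (finSupp R (F n \ F (n + 1)) (cousinK R F M n)).subtype
      (LinearMap.range (thetaFull R (F n \ F (n + 1)) (cousinK R F M n))))
    have hπ : ∀ x, π x = 0 ↔ x ∈ Submodule.comap (finSupp R (F n \ F (n + 1))
      (cousinK R F M n)).subtype
      (LinearMap.range (cousinTheta R F M n)) := fun x => by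
      rw [Submodule.mkQ_apply, Submodule.Quotient.mk_eq_zero]; rfl
    constructor
    · intro h
      rw [injective_iff_map_eq_zero]
      intro x hx
      obtain ⟨y, hy⟩ := Submodule.mkQ_surjective _ x
      have h1 : y ∈ LinearMap.ker (cousinD R F M n) := 
        (congrArg (cousinTheta R F M (n + 1)) hy).trans hx
      rw [h] at h1
      exact hy.symm.trans ((hπ y).mpr h1)
    · intro h
      ext y
      rw [← hπ y]
      constructor
      · intro hy
        exact h (Eq.trans hy (map_zero _).symm)
      · intro hy
        exact (congrArg (cousinTheta R F M (n + 1)) hy).trans (map_zero _)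
  constructor
  · rintro ⟨-, h0, h1, h2⟩
    refine ⟨fun n => ?_, h2⟩
    cases n with
    | zero => exact h0
    | succ n => exact (key n).mp (h1 n)
  · rintro ⟨h1, h2⟩
    refine ⟨?_, h1 0, fun n => (key n).mpr (h1 _), h2⟩
    rintro n _ ⟨x, rfl⟩
    exact theta_fin (hF.lay n) (suppIn_cousin hF M hM n) x

end P8a
end GGP

namespace GGP
section P8b
open GG

lemma exLoc {R A : Type u} [CommRing R] [CommRing A] [Algebra R A] {K L : Type u} [AddCommGroup K]
    [Module R K] [AddCommGroup L] [Module A L] (S : Submonoid R) (f : K →ₛₗ[algebraMap R A] L)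
    (h1 : ∀ s ∈ S, ∀ y : L, algebraMap R A s • y = 0 → y = 0)
    (h1' : ∀ s ∈ S, ∀ y : L, ∃ z, algebraMap R A s • z = y)
    (h2 : ∀ x, f x = 0 → ∃ s : S, s • x = 0)
    (h3 : ∀ y, ∃ (s : S) (x : K), algebraMap R A s • y = f x) :
    ∃ h : LocalizedModule S K →ₛₗ[algebraMap R A] L,
      (∀ x, h (LocalizedModule.mk x 1) = f x) ∧ Function.Bijective h := by
  let _ : Module R L := Module.compHom L (algebraMap R A)
  have hs : ∀ (r : R) (y : L), r • y = algebraMap R A r • y := fun _ _ => rfl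
  let g : K →ₗ[R] L := { toFun := f, map_add' := map_add f, map_smul' := f.map_smulₛₗ }
  have hloc : IsLocalizedModule S g := by
    refine ⟨?_, ?_, ?_⟩
    · intro s
      rw [Module.End.isUnit_iff]
      constructor
      · rw [injective_iff_map_eq_zero]
        intro y hy
        exact h1 s s.2 y hy
      · intro y
        exact h1' s s.2 y
    · intro y
      obtain ⟨s, x, hx⟩ := h3 y
      exact ⟨(x, s), hx⟩
    · intro x y hxy
      have : f (x - y) = 0 := by
        rw [map_sub, sub_eq_zero]; exact hxy
      obtain ⟨s, hs⟩ := h2 _ this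
      refine ⟨s, ?_⟩
      rwa [smul_sub, sub_eq_zero] at hs
  let e := IsLocalizedModule.iso S g
  refine ⟨{ toFun := e, map_add' := map_add e, map_smul' := fun r x => map_smul e r x },
    fun x => ?_, e.bijective⟩
  show e (LocalizedModule.mk x 1) = g x
  exact IsLocalizedModule.iso_mk_one S g x

variable {R : Type u} [CommRing R] (q : Ideal R) [hq : q.IsPrime] {K K' : Type u} [AddCommGroup K]
  [Module R K] [AddCommGroup K'] [Module (Localization.AtPrime q) K']
  (f : K →ₛₗ[algebraMap R (Localization.AtPrime q)] K')

lemma at_repr (t : Localization.AtPrime q) : ∃ a : R, ∃ u ∉ q,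
    algebraMap R (Localization.AtPrime q) u * t = algebraMap R (Localization.AtPrime q) a := by
  obtain ⟨⟨a, u⟩, h⟩ := IsLocalization.surj q.primeCompl t
  exact ⟨a, u, u.2, by rw [mul_comm]; exact h⟩

lemma comap_le (p' : PrimeSpectrum (Localization.AtPrime q)) :
    (PrimeSpectrum.comap (algebraMap R (Localization.AtPrime q)) p').asIdeal ≤ q := by
  intro r hr
  by_contra hrq
  exact p'.2.ne_top (Ideal.eq_top_of_isUnit_mem _ hr
    (IsLocalization.map_units (Localization.AtPrime q) (⟨r, hrq⟩ : q.primeCompl)))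

lemma comap_inj : Function.Injective
    (PrimeSpectrum.comap (algebraMap R (Localization.AtPrime q))) :=
  PrimeSpectrum.localization_comap_injective (Localization.AtPrime q) q.primeCompl

lemma exists_comap (p : PrimeSpectrum R) (hp : p.asIdeal ≤ q) :
    ∃ p' : PrimeSpectrum (Localization.AtPrime q),
      PrimeSpectrum.comap (algebraMap R (Localization.AtPrime q)) p' = p := by
  have : p ∈ Set.range (PrimeSpectrum.comap (algebraMap R (Localization.AtPrime q))) := by
    rw [PrimeSpectrum.localization_comap_range (Localization.AtPrime q) q.primeCompl]
    show Disjoint (q.primeCompl : Set R) p.asIdeal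
    rw [Set.disjoint_left]
    exact fun r hr hrp => hr (hp hrp)
  exact this

lemma exPtLoc (hf : IsLoc q.primeCompl f) (p : PrimeSpectrum R)
    (p' : PrimeSpectrum (Localization.AtPrime q))
    (hpp : PrimeSpectrum.comap (algebraMap R (Localization.AtPrime q)) p' = p) :
    ∃ h : LocalizedModule p.asIdeal.primeCompl K →ₛₗ[algebraMap R (Localization.AtPrime q)]
        LocalizedModule p'.asIdeal.primeCompl K',
      (∀ x, h (LocalizedModule.mk x 1) = LocalizedModule.mk (f x) 1) ∧ Function.Bijective h := by
  subst hpp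
  have hle := comap_le q p'
  refine exLoc _ ((LocalizedModule.mkLinearMap p'.asIdeal.primeCompl K').comp f) ?_ ?_ ?_ ?_
  · intro s hs y hy
    exact smul_mk_zero p'.asIdeal _ hs y hy
  · intro s hs y
    obtain ⟨x, t, rfl⟩ := exists_mk y
    refine ⟨LocalizedModule.mk x (⟨algebraMap R _ s, hs⟩ * t), ?_⟩
    rw [LocalizedModule.smul'_mk]
    exact LocalizedModule.mk_cancel_common_left (⟨algebraMap R _ s, hs⟩ :
      p'.asIdeal.primeCompl) t x
  · intro x hx
    have : LocalizedModule.mk (f x) 1 = 0 := hx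
    rw [mk_zero_iff] at this
    obtain ⟨t, ht⟩ := this
    obtain ⟨a, u, hu, hau⟩ := at_repr q t
    have h1 : f (a • x) = 0 := by
      rw [f.map_smulₛₗ, ← hau, mul_smul]
      have ht' : (t : Localization.AtPrime q) • f x = 0 := ht
      rw [ht', smul_zero]
    obtain ⟨s, hs⟩ := hf.ker _ h1
    refine ⟨⟨s * a, ?_⟩, ?_⟩
    · have ha : a ∉ (PrimeSpectrum.comap (algebraMap R (Localization.AtPrime q)) p').asIdeal := by
        intro ha
        have ha' : algebraMap R (Localization.AtPrime q) a ∈ p'.asIdeal := ha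
        rw [← hau] at ha'
        exact (p'.2.mem_or_mem ha').elim (fun h => hu (hle h)) t.2
      exact fun h => (((PrimeSpectrum.comap (algebraMap R (Localization.AtPrime q))
        p').2.mem_or_mem h).elim (fun h => s.2 (hle h)) ha)
    · show ((s : R) * a) • x = 0
      rw [mul_smul]; exact hs
  · intro y
    obtain ⟨k, t, rfl⟩ := exists_mk y
    obtain ⟨s, x, hx⟩ := hf.surj k
    obtain ⟨a, u, hu, hau⟩ := at_repr q t
    have ha : a ∉ (PrimeSpectrum.comap (algebraMap R (Localization.AtPrime q)) p').asIdeal := by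
        intro ha
        have ha' : algebraMap R (Localization.AtPrime q) a ∈ p'.asIdeal := ha
        rw [← hau] at ha'
        exact (p'.2.mem_or_mem ha').elim (fun h => hu (hle h)) t.2
    refine ⟨⟨s * a, fun h => (((PrimeSpectrum.comap (algebraMap R (Localization.AtPrime q))
        p').2.mem_or_mem h).elim (fun h => s.2 (hle h)) ha)⟩, u • x, ?_⟩
    show algebraMap R (Localization.AtPrime q) (s * a) • LocalizedModule.mk k t =
      LocalizedModule.mk (f (u • x)) 1
    rw [LocalizedModule.smul'_mk, f.map_smulₛₗ, ← hx, map_mul, ← hau]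
    rw [show algebraMap R (Localization.AtPrime q) s * (algebraMap R (Localization.AtPrime q) u * t)
      = t * (algebraMap R (Localization.AtPrime q) u * algebraMap R (Localization.AtPrime q) s)
      by ring, mul_smul, mul_smul]
    exact LocalizedModule.mk_cancel t _

variable {G B : Set (PrimeSpectrum R)}

lemma finSupp_loc (h : Lay G B) (hK : SuppIn G K) (hf : IsLoc q.primeCompl f)
    (B' : Set (PrimeSpectrum (Localization.AtPrime q)))
    (hB : B' = PrimeSpectrum.comap (algebraMap R (Localization.AtPrime q)) ⁻¹' B) :
    ∃ g : finSupp R B K →ₛₗ[algebraMap R (Localization.AtPrime q)]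
        finSupp (Localization.AtPrime q) B' K', IsLoc q.primeCompl g ∧
      (∀ (y : finSupp R B K) x, thetaFull R B K x = y.1 →
        thetaFull (Localization.AtPrime q) B' K' (f x) = (g y).1) ∧
      (∀ p' ∈ B', ∀ p : B, PrimeSpectrum.comap (algebraMap R (Localization.AtPrime q)) p' = p.1 →
        ∃ hh : LocalizedModule p.1.asIdeal.primeCompl K →ₛₗ[algebraMap R (Localization.AtPrime q)]
        LocalizedModule p'.asIdeal.primeCompl K', Function.Bijective hh) := by
  subst hB
  have hex := fun p p' hpp => exPtLoc q f hf p p' hpp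
  choose L hL hLb using hex
  let cm := PrimeSpectrum.comap (algebraMap R (Localization.AtPrime q))
  let g0 : finSupp R B K → locProd (Localization.AtPrime q) (cm ⁻¹' B) K' := fun y p' =>
    L _ p'.1 rfl (y.1 ⟨cm p'.1, p'.2⟩)
  have hg0 : ∀ y, g0 y ∈ finSupp (Localization.AtPrime q) (cm ⁻¹' B) K' := by
    intro y
    have hy : {p : B | y.1 p ≠ 0}.Finite := y.2
    show {p' : ↑(cm ⁻¹' B) | g0 y p' ≠ 0}.Finite
    refine Set.Finite.of_finite_image (f := fun p' : ↑(cm ⁻¹' B) => (⟨cm p'.1, p'.2⟩ : B))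
      (hy.subset ?_) ?_
    · rintro _ ⟨p', hp', rfl⟩ h0
      apply hp'
      show L _ p'.1 rfl (y.1 ⟨cm p'.1, p'.2⟩) = 0
      rw [h0, map_zero]
    · intro a _ b _ hab
      exact Subtype.ext (comap_inj q (congrArg Subtype.val hab))
  refine ⟨{ toFun := fun y => ⟨g0 y, hg0 y⟩, map_add' := ?_, map_smul' := ?_ }, ⟨?_, ?_⟩, ?_, ?_⟩
  · intro x y
    apply Subtype.ext
    funext p'
    exact map_add (L _ p'.1 rfl) _ _
  · intro r y
    apply Subtype.ext
    funext p'
    exact (L _ p'.1 rfl).map_smulₛₗ _ _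
  · intro y'
    have hz : ∀ p : B, ∃ z : LocalizedModule p.1.asIdeal.primeCompl K,
        (∀ (p' : ↑(cm ⁻¹' B)) (hp : cm p'.1 = p.1), L p.1 p'.1 hp z = y'.1 p') ∧
        ((∀ (p' : ↑(cm ⁻¹' B)), cm p'.1 = p.1 → y'.1 p' = 0) → z = 0) := by
      intro p
      by_cases hp : ∃ p' : ↑(cm ⁻¹' B), cm p'.1 = p.1
      · obtain ⟨p', hp'⟩ := hp
        obtain ⟨z, hz⟩ := (hLb p.1 p'.1 hp').2 (y'.1 p')
        refine ⟨z, ?_, ?_⟩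
        · intro p'' hp''
          obtain rfl : p'' = p' := Subtype.ext (comap_inj q (hp''.trans hp'.symm))
          exact hz
        · intro h
          apply (hLb p.1 p'.1 hp').1
          rw [hz, map_zero, h p' hp']
      · exact ⟨0, fun p' h => absurd ⟨p', h⟩ hp, fun _ => rfl⟩
    choose z hz1 hz2 using hz
    have hzf : z ∈ finSupp R B K := by
      have hy : {p' : ↑(cm ⁻¹' B) | y'.1 p' ≠ 0}.Finite := y'.2
      refine (hy.image (fun p' : ↑(cm ⁻¹' B) => (⟨cm p'.1, p'.2⟩ : B))).subset ?_
      intro p hp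
      by_contra hcon
      apply hp
      apply hz2
      intro p' hpp
      by_contra h0
      exact hcon ⟨p', h0, Subtype.ext hpp⟩
    refine ⟨1, ⟨z, hzf⟩, ?_⟩
    rw [OneMemClass.coe_one, map_one, one_smul]
    apply Subtype.ext
    funext p'
    exact (hz1 ⟨cm p'.1, p'.2⟩ p' rfl).symm
  · intro y hy
    obtain ⟨s, hs, hsy⟩ := kill h hK q y.1 y.2 (by
      intro p hpq
      obtain ⟨p', hp'⟩ := exists_comap q p.1 hpq
      have hpB : p' ∈ cm ⁻¹' B := by
        show cm p' ∈ B
        exact (congrArg (fun w => w ∈ B) hp').mpr p.2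
      have h0 : g0 y ⟨p', hpB⟩ = 0 := congrFun (congrArg Subtype.val hy) ⟨p', hpB⟩
      have h1 : y.1 ⟨cm p', hpB⟩ = 0 := by
        apply (hLb _ p' rfl).1
        rw [map_zero]; exact h0
      have h2 : p = ⟨cm p', hpB⟩ := Subtype.ext hp'.symm
      rw [h2]; exact h1)
    exact ⟨⟨s, hs⟩, Subtype.ext hsy⟩
  · intro y x hx
    funext p'
    show LocalizedModule.mk (f x) 1 = L _ p'.1 rfl (y.1 ⟨cm p'.1, p'.2⟩)
    rw [← hx, ← hL _ p'.1 rfl]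
    rfl
  · intro p' _ p hp
    exact ⟨L p.1 p' hp, hLb _ _ _⟩

lemma next_loc (h : Lay G B) (hK : SuppIn G K) (hf : IsLoc q.primeCompl f)
    [IsNoetherianRing R]
    (B' : Set (PrimeSpectrum (Localization.AtPrime q)))
    (hB : B' = PrimeSpectrum.comap (algebraMap R (Localization.AtPrime q)) ⁻¹' B) :
    ∃ k : nextKType R B K →ₛₗ[algebraMap R (Localization.AtPrime q)]
        nextKType (Localization.AtPrime q) B' K', IsLoc q.primeCompl k := by
  obtain ⟨g, hg, hg1, -⟩ := finSupp_loc q f h hK hf B' hB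
  refine ⟨Submodule.mapQ _ _ g ?_, ⟨?_, ?_⟩⟩
  · rintro y ⟨x, hx⟩
    exact ⟨f x, hg1 y x hx⟩
  · intro y'
    obtain ⟨y', rfl⟩ := Submodule.mkQ_surjective _ y'
    obtain ⟨s, y, hy⟩ := hg.surj y'
    refine ⟨s, Submodule.mkQ _ y, ?_⟩
    rw [← map_smul, hy]
    rfl
  · intro y hy
    obtain ⟨y, rfl⟩ := Submodule.mkQ_surjective _ y
    have hy' : Submodule.mkQ _ (g y) = 0 := hy
    rw [Submodule.mkQ_apply, Submodule.Quotient.mk_eq_zero] at hy'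
    obtain ⟨x', hx'⟩ := hy'
    obtain ⟨s, x, hx⟩ := hf.surj x'
    let w : finSupp R B K := ⟨_, theta_fin h hK x⟩
    have h1 := hg1 w x rfl
    have h2 : g ((s : R) • y - w) = 0 := by
      rw [map_sub, sub_eq_zero, g.map_smulₛₗ]
      apply Subtype.ext
      rw [← h1, ← hx, map_smul, hx']
      rfl
    obtain ⟨t, ht⟩ := hg.ker _ h2
    refine ⟨t * s, ?_⟩
    have h3 : ((t : R) * s) • y = (t : R) • w := by
      have : (t : R) • ((s : R) • y - w) = 0 := ht
      rwa [smul_sub, sub_eq_zero, ← mul_smul] at this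
    refine (map_smul (Submodule.mkQ _) ((t : R) * s) y).symm.trans ?_
    rw [h3, Submodule.mkQ_apply, Submodule.Quotient.mk_eq_zero]
    refine ⟨(t : R) • x, ?_⟩
    rw [map_smul]; rfl

end P8b
end GGP

namespace GGP
section P8c
open GG

lemma height_emb {α β : Type u} [Preorder α] [Preorder β] (φ : α → β)
    (h1 : ∀ a b, φ a ≤ φ b ↔ a ≤ b) (h2 : ∀ b a, b ≤ φ a → ∃ c, φ c = b) (a : α) :
    Order.height (φ a) = Order.height a := by
  have hlt : ∀ a b, φ a < φ b ↔ a < b := by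
    intro a b
    rw [lt_iff_le_not_ge, lt_iff_le_not_ge, h1, h1]
  apply le_antisymm
  · rw [Order.height_le_iff]
    intro p hp
    have hex : ∀ i, ∃ c, φ c = p i := fun i => h2 _ a ((p.monotone (Fin.le_last i)).trans hp)
    choose c hc using hex
    have hs : StrictMono c := by
      intro i j hij
      rw [← hlt, hc, hc]
      exact p.strictMono hij
    let p' : LTSeries α := LTSeries.mk p.length c hs
    have : p'.last ≤ a := by
      rw [← h1]
      exact (hc (Fin.last _)).le.trans hp
    exact Order.length_le_height this
  · exact Order.height_le_height_apply_of_strictMono φ (fun a b h => (hlt a b).mpr h) a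

variable {R : Type u} [CommRing R] (q : Ideal R) [hq : q.IsPrime]

/-- localization map -/
noncomputable def mkLoc (M : Type u) [AddCommGroup M] [Module R M] :
    M →ₛₗ[algebraMap R (Localization.AtPrime q)] LocalizedModule q.primeCompl M where
  toFun x := LocalizedModule.mk x 1
  map_add' x y := map_add (LocalizedModule.mkLinearMap q.primeCompl M) x y
  map_smul' r x := (map_smul (LocalizedModule.mkLinearMap q.primeCompl M) r x).trans
    (algebraMap_smul _ _ _).symm

lemma mkLoc_isLoc (M : Type u) [AddCommGroup M] [Module R M] :
    IsLoc q.primeCompl (mkLoc q M) := by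
  refine ⟨?_, ?_⟩
  · intro y
    obtain ⟨x, s, rfl⟩ := exists_mk y
    refine ⟨s, x, ?_⟩
    rw [algebraMap_smul, LocalizedModule.smul'_mk]
    exact LocalizedModule.mk_cancel s x
  · intro x hx
    exact (mk_zero_iff x 1).mp hx

lemma comap_le_iff (a b : PrimeSpectrum (Localization.AtPrime q)) :
    PrimeSpectrum.comap (algebraMap R (Localization.AtPrime q)) a ≤
      PrimeSpectrum.comap (algebraMap R (Localization.AtPrime q)) b ↔ a ≤ b := by
  constructor
  · intro h t ht
    obtain ⟨r, u, hu, hru⟩ := at_repr q t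
    have h1 : algebraMap R (Localization.AtPrime q) r ∈ a.asIdeal := by
      rw [← hru]; exact Ideal.mul_mem_left _ _ ht
    have h2 : algebraMap R (Localization.AtPrime q) r ∈ b.asIdeal := h h1
    rw [← hru] at h2
    exact (b.2.mem_or_mem h2).resolve_left (fun h => hu (comap_le q b h))
  · intro h r hr
    exact h hr

lemma supp_loc (M : Type u) [AddCommGroup M] [Module R M]
    (p' : PrimeSpectrum (Localization.AtPrime q)) :
    p' ∈ Module.support (Localization.AtPrime q) (LocalizedModule q.primeCompl M) ↔
      PrimeSpectrum.comap (algebraMap R (Localization.AtPrime q)) p' ∈ Module.support R M := by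
  obtain ⟨h, -, hb⟩ := exPtLoc q _ (mkLoc_isLoc q M) _ p' rfl
  rw [Module.mem_support_iff, Module.mem_support_iff]
  exact (Equiv.ofBijective h hb).nontrivial_congr.symm

lemma height_loc (M : Type u) [AddCommGroup M] [Module R M] (n : ℕ) :
    heightFiltration (Localization.AtPrime q) (LocalizedModule q.primeCompl M) n =
      PrimeSpectrum.comap (algebraMap R (Localization.AtPrime q)) ⁻¹' heightFiltration R M n := by
  ext p'
  have hs := supp_loc q M p'
  by_cases hp : p' ∈ Module.support (Localization.AtPrime q) (LocalizedModule q.primeCompl M)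
  · have hp2 := hs.mp hp
    let φ : Module.support (Localization.AtPrime q) (LocalizedModule q.primeCompl M) →
      Module.support R M := fun a => ⟨_, (supp_loc q M a.1).mp a.2⟩
    have key := height_emb φ (fun a b => comap_le_iff q a.1 b.1) (by
      intro b a hba
      obtain ⟨c, hc⟩ := exists_comap q b.1 (le_trans hba (comap_le q a.1))
      have hc' := (supp_loc q M c).mpr (by rw [hc]; exact b.2)
      exact ⟨⟨c, hc'⟩, Subtype.ext hc⟩) ⟨p', hp⟩
    have : htM (Localization.AtPrime q) (LocalizedModule q.primeCompl M) p' =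
        htM R M (PrimeSpectrum.comap (algebraMap R (Localization.AtPrime q)) p') := by
      rw [htM, htM, iSup_pos hp, iSup_pos hp2]
      exact key.symm
    constructor
    · rintro ⟨_, h⟩
      exact ⟨hp2, h.trans this.le⟩
    · rintro ⟨_, h⟩
      exact ⟨hp, h.trans this.ge⟩
  · constructor
    · rintro ⟨h, _⟩
      exact absurd h hp
    · rintro ⟨h, _⟩
      exact absurd (hs.mpr h) hp

lemma cousin_loc [IsNoetherianRing R] {F : ℕ → Set (PrimeSpectrum R)} (hF : Filt F)
    (M : ModuleCat.{u} R) (hM : SuppIn (F 0) M)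
    (F' : ℕ → Set (PrimeSpectrum (Localization.AtPrime q)))
    (hF' : ∀ n, F' n = PrimeSpectrum.comap (algebraMap R (Localization.AtPrime q)) ⁻¹' F n)
    (M' : ModuleCat.{u} (Localization.AtPrime q))
    (f : M →ₛₗ[algebraMap R (Localization.AtPrime q)] M') (hf : IsLoc q.primeCompl f) :
    ∀ n, ∃ κ : cousinK R F M n →ₛₗ[algebraMap R (Localization.AtPrime q)]
      cousinK (Localization.AtPrime q) F' M' n, IsLoc q.primeCompl κ
  | 0 => ⟨f, hf⟩
  | n + 1 => by
    obtain ⟨κ, hκ⟩ := cousin_loc hF M hM F' hF' M' f hf n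
    exact next_loc q κ (hF.lay n) (suppIn_cousin hF M hM n) hκ _ (by
      rw [hF', hF']; rfl)

lemma cousin_data [IsNoetherianRing R] (M : ModuleCat.{u} R) (n : ℕ) :
    ∃ (κ : cousinK R (heightFiltration R M) M n →ₛₗ[algebraMap R (Localization.AtPrime q)]
        cousinK (Localization.AtPrime q) (heightFiltration (Localization.AtPrime q)
          (LocalizedModule q.primeCompl M)) (ModuleCat.of (Localization.AtPrime q)
            (LocalizedModule q.primeCompl M)) n)
      (g : cousinC R (heightFiltration R M) M n →ₛₗ[algebraMap R (Localization.AtPrime q)]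
        cousinC (Localization.AtPrime q) (heightFiltration (Localization.AtPrime q)
          (LocalizedModule q.primeCompl M)) (ModuleCat.of (Localization.AtPrime q)
            (LocalizedModule q.primeCompl M)) n),
      IsLoc q.primeCompl κ ∧ IsLoc q.primeCompl g ∧
      (∀ (y : cousinC R (heightFiltration R M) M n) x,
        cousinTheta R (heightFiltration R M) M n x = y.1 →
        cousinTheta (Localization.AtPrime q) (heightFiltration (Localization.AtPrime q)
          (LocalizedModule q.primeCompl M)) (ModuleCat.of (Localization.AtPrime q)
            (LocalizedModule q.primeCompl M)) n (κ x) = (g y).1) ∧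
      (∀ p' ∈ heightFiltration (Localization.AtPrime q) (LocalizedModule q.primeCompl M) n \
          heightFiltration (Localization.AtPrime q) (LocalizedModule q.primeCompl M) (n + 1),
        ∀ p : ↑(heightFiltration R M n \ heightFiltration R M (n + 1)),
        PrimeSpectrum.comap (algebraMap R (Localization.AtPrime q)) p' = p.1 →
        ∃ hh : LocalizedModule p.1.asIdeal.primeCompl (cousinK R (heightFiltration R M) M n)
          →ₛₗ[algebraMap R (Localization.AtPrime q)]
        LocalizedModule p'.asIdeal.primeCompl (cousinK (Localization.AtPrime q)
          (heightFiltration (Localization.AtPrime q)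
          (LocalizedModule q.primeCompl M)) (ModuleCat.of (Localization.AtPrime q)
            (LocalizedModule q.primeCompl M)) n), Function.Bijective hh) := by
  obtain ⟨κ, hκ⟩ := cousin_loc q (filt_height M) M (suppIn_height M)
    (heightFiltration (Localization.AtPrime q) (LocalizedModule q.primeCompl M)) (height_loc q M)
    (ModuleCat.of (Localization.AtPrime q) (LocalizedModule q.primeCompl M)) (mkLoc q M)
    (mkLoc_isLoc q M) n
  obtain ⟨g, hg, hg1, hg2⟩ := finSupp_loc q κ ((filt_height M).lay n)
    (suppIn_cousin (filt_height M) M (suppIn_height M) n) hκ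
    (heightFiltration (Localization.AtPrime q) (LocalizedModule q.primeCompl M) n \
          heightFiltration (Localization.AtPrime q) (LocalizedModule q.primeCompl M) (n + 1))
    (by rw [height_loc, height_loc]; rfl)
  exact ⟨κ, g, hκ, hg, hg1, hg2⟩

lemma GI_at [IsNoetherianRing R] (Δ : Dual R) (N : Type u) [AddCommGroup N]
    [Module (Localization.AtPrime q) N] (hN : IsGorensteinInjective (Localization.AtPrime q) N)
    (p : Ideal R) [hp : p.IsPrime] (K : Type u) [AddCommGroup K] [Module R K]
    (ψ : N → LocalizedModule p.primeCompl K) (h0 : ∀ a b, ψ (a + b) = ψ a + ψ b)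
    (h1 : ∀ (r : R) n, ψ (algebraMap R (Localization.AtPrime q) r • n) = r • ψ n)
    (h2 : Function.Surjective ψ)
    (h3 : ∀ n, ψ n = 0 → ∃ s ∉ p, algebraMap R (Localization.AtPrime q) s • n = 0) :
    IsGorensteinInjective R (LocalizedModule p.primeCompl K) := by
  let _ : Module R N := Module.compHom N (algebraMap R (Localization.AtPrime q))
  have : IsScalarTower R (Localization.AtPrime q) N := ⟨fun r a y => by
    rw [Algebra.smul_def, mul_smul]; rfl⟩
  have hN' : IsGorensteinInjective R N := GI_restrict q.primeCompl N hN
  let ψ' : N →ₛₗ[algebraMap R (Localization.AtPrime p)] LocalizedModule p.primeCompl K :=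
    { toFun := ψ, map_add' := h0, map_smul' := fun r n => (h1 r n).trans (algebraMap_smul _ _ _).symm }
  have := GI_loc Δ p.primeCompl ψ' ⟨fun y => by
      obtain ⟨n, hn⟩ := h2 y
      refine ⟨1, n, ?_⟩
      rw [OneMemClass.coe_one, map_one, one_smul]
      exact hn.symm, fun n hn => by
      obtain ⟨s, hs, hsn⟩ := h3 n hn
      exact ⟨⟨s, hs⟩, hsn⟩⟩ hN'
  exact GI_restrict p.primeCompl _ this

lemma GI_pt [IsNoetherianRing R] (Δ : Dual R) {G' B' : Set (PrimeSpectrum (Localization.AtPrime q))}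
    (hL : Lay G' B') {K K' : Type u} [AddCommGroup K] [Module R K] [AddCommGroup K']
    [Module (Localization.AtPrime q) K'] (hK : SuppIn G' K')
    (hGI : IsGorensteinInjective (Localization.AtPrime q) (finSupp (Localization.AtPrime q) B' K'))
    (p' : PrimeSpectrum (Localization.AtPrime q)) (hp' : p' ∈ B') (p : PrimeSpectrum R)
    (hpp : PrimeSpectrum.comap (algebraMap R (Localization.AtPrime q)) p' = p)
    (hh : LocalizedModule p.asIdeal.primeCompl K →ₛₗ[algebraMap R (Localization.AtPrime q)]
        LocalizedModule p'.asIdeal.primeCompl K') (hb : Function.Bijective hh) :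
    IsGorensteinInjective R (LocalizedModule p.asIdeal.primeCompl K) := by
  classical
  let e := Equiv.ofBijective hh hb
  have he : ∀ z, hh (e.symm z) = z := fun z => e.apply_symm_apply z
  refine GI_at q Δ _ hGI p.asIdeal K (fun y => e.symm (y.1 ⟨p', hp'⟩)) ?_ ?_ ?_ ?_
  · intro a b
    apply hb.1
    rw [map_add, he, he, he]; rfl
  · intro r n
    apply hb.1
    rw [hh.map_smulₛₗ, he, he]; rfl
  · intro z
    refine ⟨⟨Pi.single ⟨p', hp'⟩ (hh z), ?_⟩, ?_⟩
    · refine (Set.finite_singleton (⟨p', hp'⟩ : B')).subset ?_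
      intro a ha
      by_contra hne
      exact ha (Pi.single_eq_of_ne hne _)
    · apply hb.1
      rw [he]
      exact Pi.single_eq_same _ _
  · intro n hn
    have h0 : n.1 ⟨p', hp'⟩ = 0 := by
      have := congrArg hh hn
      rwa [he, map_zero] at this
    obtain ⟨t, ht, htn⟩ := kill hL hK p'.asIdeal n.1 n.2 (by
      intro a ha
      have : a = ⟨p', hp'⟩ := Subtype.ext (hL.min p' hp' a.1 (hL.sub a.2) ha)
      rw [this]; exact h0)
    obtain ⟨a, u, hu, hau⟩ := at_repr q t
    refine ⟨a, ?_, ?_⟩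
    · intro ha
      rw [← hpp] at ha
      have ha' : algebraMap R (Localization.AtPrime q) a ∈ p'.asIdeal := ha
      rw [← hau] at ha'
      exact (p'.2.mem_or_mem ha').elim (fun h => hu (comap_le q p' h)) ht
    · rw [← hau, mul_smul]
      have : t • n = 0 := Subtype.ext htn
      rw [this, smul_zero]

lemma GI_finSupp [IsNoetherianRing R] (Δ : Dual R) (B : Set (PrimeSpectrum R)) (K : Type u)
    [AddCommGroup K] [Module R K]
    (h : ∀ p : B, IsGorensteinInjective R (LocalizedModule p.1.asIdeal.primeCompl K)) :
    IsGorensteinInjective R (finSupp R B K) := by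
  classical
  have hs := GI_sum Δ (fun p : B => LocalizedModule p.1.asIdeal.primeCompl K) h
  let φ : (Π₀ p : B, LocalizedModule p.1.asIdeal.primeCompl K) →ₗ[R] finSupp R B K :=
    { toFun := fun v => ⟨fun p => v p, by
        refine v.support.finite_toSet.subset ?_
        intro p hp
        exact DFinsupp.mem_support_iff.mpr hp⟩
      map_add' := fun _ _ => rfl
      map_smul' := fun _ _ => rfl }
  refine GI_congr (LinearEquiv.ofBijective φ ⟨?_, ?_⟩) hs
  · intro a b hab
    apply DFinsupp.ext
    intro p
    exact congrFun (congrArg Subtype.val hab) p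
  · intro y
    have hfin : {p : B | y.1 p ≠ 0}.Finite := y.2
    refine ⟨DFinsupp.mk hfin.toFinset (fun i => y.1 i.1), Subtype.ext (funext fun p => ?_)⟩
    refine DFinsupp.mk_apply.trans ?_
    split_ifs with hp
    · rfl
    · rw [hfin.mem_toFinset] at hp
      exact (not_not.mp hp).symm

end P8c
end GGP

namespace GGP
section P9
open GG
variable {R : Type u} [CommRing R] [IsNoetherianRing R]

lemma gg_iff (M : ModuleCat.{u} R) : IsGGorenstein R M ↔ (∃ x : M, x ≠ 0) ∧ Module.Finite R M ∧
    (∀ n, Function.Injective (cousinTheta R (heightFiltration R M) M n)) ∧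
    (∀ n, IsGorensteinInjective R (cousinC R (heightFiltration R M) M n)) := by
  rw [IsGGorenstein, resolves_iff (filt_height M) M (suppIn_height M)]

lemma gg_loc (Δ : Dual R) (M : ModuleCat.{u} R) (h : IsGGorenstein R M) (p : PrimeSpectrum R)
    (hp : p ∈ Module.support R M) :
    IsGGorenstein (Localization.AtPrime p.asIdeal)
          (ModuleCat.of (Localization.AtPrime p.asIdeal)
            (LocalizedModule p.asIdeal.primeCompl M)) := by
  have : IsNoetherianRing (Localization.AtPrime p.asIdeal) :=
    IsLocalization.isNoetherianRing p.asIdeal.primeCompl _ inferInstance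
  rw [gg_iff] at h ⊢
  obtain ⟨-, hfin, hinj, hGI⟩ := h
  refine ⟨?_, ?_, ?_, ?_⟩
  · have : Nontrivial (LocalizedModule p.asIdeal.primeCompl M) := hp
    exact exists_ne (0 : LocalizedModule p.asIdeal.primeCompl M)
  · exact Module.Finite.of_isLocalizedModule p.asIdeal.primeCompl
      (LocalizedModule.mkLinearMap p.asIdeal.primeCompl M)
  · intro n
    obtain ⟨κ, g, hκ, hg, hc, -⟩ := cousin_data p.asIdeal M n
    refine (injective_iff_map_eq_zero _).mpr ?_
    intro x' hx'
    obtain ⟨s, x, hx⟩ := hκ.surj x'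
    let y : cousinC R (heightFiltration R M) M n := ⟨_, theta_fin ((filt_height M).lay n)
      (suppIn_cousin (filt_height M) M (suppIn_height M) n) x⟩
    have h1 := hc y x rfl
    rw [← hx, map_smul] at h1
    have h2 : g y = 0 := by
      apply Subtype.ext
      refine h1.symm.trans ?_
      exact (congrArg _ hx').trans (smul_zero _)
    obtain ⟨t, ht⟩ := hg.ker _ h2
    have h3 : (t : R) • x = 0 := by
      apply hinj n
      rw [map_smul, map_zero]
      exact congrArg Subtype.val ht
    have h4 : κ ((t : R) • x) = 0 := by rw [h3, map_zero]
    rw [κ.map_smulₛₗ, ← hx] at h4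
    have ut := IsLocalization.map_units (Localization.AtPrime p.asIdeal) t
    have us := IsLocalization.map_units (Localization.AtPrime p.asIdeal) s
    exact (us.smul_eq_zero).mp ((ut.smul_eq_zero).mp h4)
  · intro n
    obtain ⟨κ, g, hκ, hg, hc, -⟩ := cousin_data p.asIdeal M n
    exact GI_loc Δ _ g hg (hGI n)

lemma gg_of_max (Δ : Dual R) (M : ModuleCat.{u} R) (hM0 : ∃ x : M, x ≠ 0)
    (hMf : Module.Finite R M)
    (h : ∀ p ∈ Module.support R M, p.asIdeal.IsMaximal →
        IsGGorenstein (Localization.AtPrime p.asIdeal)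
          (ModuleCat.of (Localization.AtPrime p.asIdeal)
            (LocalizedModule p.asIdeal.primeCompl M))) : IsGGorenstein R M := by
  rw [gg_iff]
  refine ⟨hM0, hMf, ?_, ?_⟩
  · intro n
    refine (injective_iff_map_eq_zero _).mpr ?_
    intro x hx
    by_contra hx0
    let I : Ideal R := LinearMap.ker (LinearMap.toSpanSingleton R _ x)
    have hI : ∀ r, r ∈ I ↔ r • x = 0 := fun r => by
      rw [LinearMap.mem_ker, LinearMap.toSpanSingleton_apply]
    have hI1 : I ≠ ⊤ := by
      intro hI1
      apply hx0
      have := (hI 1).mp (hI1 ▸ Submodule.mem_top)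
      rwa [one_smul] at this
    obtain ⟨m, hm, hIm⟩ := Ideal.exists_le_maximal I hI1
    let q : PrimeSpectrum R := ⟨m, hm.isPrime⟩
    have hsupp := suppIn_cousin (filt_height M) M (suppIn_height M) n
    by_cases hq : q ∈ Module.support R M
    · have : IsNoetherianRing (Localization.AtPrime q.asIdeal) :=
        IsLocalization.isNoetherianRing q.asIdeal.primeCompl _ inferInstance
      obtain ⟨-, -, hinj, -⟩ := (gg_iff _).mp (h q hq hm)
      obtain ⟨κ, g, hκ, hg, hc, -⟩ := cousin_data q.asIdeal M n
      have h1 := hc 0 x hx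
      have h2 : κ x = 0 := by
        apply hinj n
        refine h1.trans ?_
        rw [map_zero, map_zero]; rfl
      obtain ⟨s, hs⟩ := hκ.ker x h2
      exact s.2 (hIm ((hI s).mpr hs))
    · obtain ⟨s, hs, hsx⟩ := hsupp q (fun h => hq h.1) x
      exact hs (hIm ((hI s).mpr hsx))
  · intro n
    refine GI_finSupp Δ _ _ ?_
    intro p
    obtain ⟨m, hm, hpm⟩ := Ideal.exists_le_maximal p.1.asIdeal p.1.2.ne_top
    let q : PrimeSpectrum R := ⟨m, hm.isPrime⟩
    have hq : q ∈ Module.support R M := Module.mem_support_mono (p := p.1) hpm p.2.1.1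
    have : IsNoetherianRing (Localization.AtPrime q.asIdeal) :=
      IsLocalization.isNoetherianRing q.asIdeal.primeCompl _ inferInstance
    obtain ⟨-, -, -, hGI⟩ := (gg_iff _).mp (h q hq hm)
    obtain ⟨κ, g, hκ, hg, -, hp⟩ := cousin_data q.asIdeal M n
    obtain ⟨p', hp'⟩ := exists_comap q.asIdeal p.1 hpm
    have hpB : p' ∈ heightFiltration (Localization.AtPrime q.asIdeal)
        (LocalizedModule q.asIdeal.primeCompl M) n \
        heightFiltration (Localization.AtPrime q.asIdeal)
        (LocalizedModule q.asIdeal.primeCompl M) (n + 1) := by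
      rw [height_loc, height_loc]
      have := p.2
      rw [← hp'] at this
      exact this
    obtain ⟨hh, hb⟩ := hp p' hpB p hp'
    exact GI_pt q.asIdeal Δ ((filt_height _).lay n)
      (suppIn_cousin (filt_height _) (ModuleCat.of (Localization.AtPrime q.asIdeal)
            (LocalizedModule q.asIdeal.primeCompl M)) (suppIn_height _) n) (hGI n) p' hpB p.1 hp' hh hb

end P9
end GGP

open GG in
/-- G–Gorenstein-ness localizes and is detected on localizations at (maximal) primes of the
support. -/
theorem stmt2 (R : Type u) [CommRing R] [IsNoetherianRing R] (hR : HasDualizingComplex R)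
    (M : ModuleCat.{u} R) (hM0 : ∃ x : M, x ≠ 0) (hMf : Module.Finite R M) :
    (IsGGorenstein R M ↔
      ∀ p ∈ Module.support R M,
        IsGGorenstein (Localization.AtPrime p.asIdeal)
          (ModuleCat.of (Localization.AtPrime p.asIdeal)
            (LocalizedModule p.asIdeal.primeCompl M))) ∧
    (IsGGorenstein R M ↔
      ∀ p ∈ Module.support R M, p.asIdeal.IsMaximal →
        IsGGorenstein (Localization.AtPrime p.asIdeal)
          (ModuleCat.of (Localization.AtPrime p.asIdeal)
            (LocalizedModule p.asIdeal.primeCompl M))) := by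
  obtain ⟨Δ⟩ := GGP.exists_dual hR
  refine ⟨⟨fun h p hp => GGP.gg_loc Δ M h p hp,
    fun h => GGP.gg_of_max Δ M hM0 hMf (fun p hp _ => h p hp)⟩,
    ⟨fun h p hp _ => GGP.gg_loc Δ M h p hp, fun h => GGP.gg_of_max Δ M hM0 hMf h⟩⟩
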